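/- (Diamond b_3 ∪ d_{23}) Let 0 < ε, α < 1/2. For i = 1,2,3 let E_i ⊆ [0,∞) be measurable of finite measure with |E_3| < |E_2| and 1 ≤ |E_2| ≤ 2. Then there exists a major subset E_2' ⊆ E_2 (i.e., |E_2'| ≥ |E_2|/2), depending on E_1, E_2, E_3, such that for all measurable f_1, f_3 with |f_1| ≤ 1_{E_1}, |f_3| ≤ 1_{E_3}, and f_2 with |f_2| ≤ 1_{E_2} supported in E_2', one has |Λ_L(f_1, f_2, f_3)| ≤ C_{α,ε} |E_1|^{α} |E_3|^{1−ε}, with constant C_{α,ε} independent of L. -/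

import Mathlib

open MeasureTheory Set ENNReal NNReal

noncomputable section

namespace Quartile

/-- The Walsh functions on `[0,1)` (extended by zero), in Walsh-Paley order,
defined by the recursion `W_{2l} = W_l(2x) + W_l(2x-1)`, `W_{2l+1} = W_l(2x) - W_l(2x-1)`. -/
def walsh (n : ℕ) (x : ℝ) : ℝ :=
  if h : n = 0 then (if 0 ≤ x ∧ x < 1 then 1 else 0)
  else if n % 2 = 0 then walsh (n / 2) (2 * x) + walsh (n / 2) (2 * x - 1)
  else walsh (n / 2) (2 * x) - walsh (n / 2) (2 * x - 1)
termination_by n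
decreasing_by
  all_goals exact Nat.div_lt_self (Nat.pos_of_ne_zero h) one_lt_two

/-- The dyadic interval `[2^k n, 2^k (n+1)) ⊆ [0,∞)`. -/
def dyadicI (k : ℤ) (n : ℕ) : Set ℝ := Ico ((2:ℝ)^k * n) ((2:ℝ)^k * (n+1))

/-- A tile: the dyadic rectangle `[2^k n, 2^k(n+1)) × [2^{-k} l, 2^{-k}(l+1))` of area one. -/
structure Tile where
  k : ℤ
  n : ℕ
  l : ℕ

namespace Tile

/-- The time interval `I_p` of a tile. -/
def timeI (p : Tile) : Set ℝ := Ico ((2:ℝ)^p.k * p.n) ((2:ℝ)^p.k * (p.n+1))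

/-- The frequency interval `ω_p` of a tile. -/
def freqI (p : Tile) : Set ℝ := Ico ((2:ℝ)^(-p.k) * p.l) ((2:ℝ)^(-p.k) * (p.l+1))

/-- The tile as a subset of the phase plane. -/
def toSet (p : Tile) : Set (ℝ × ℝ) := p.timeI ×ˢ p.freqI

/-- The Walsh wave packet `w_p` of a tile, `L²`-normalized. -/
def wp (p : Tile) (x : ℝ) : ℝ :=
  Real.sqrt ((2:ℝ)^(-p.k)) * walsh p.l ((2:ℝ)^(-p.k) * x - p.n)

end Tile

/-- The order on dyadic rectangles: `p ≤ q` iff `I_p ⊆ I_q` and `ω_q ⊆ ω_p`, for tiles. -/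
def tileLE (p q : Tile) : Prop := p.timeI ⊆ q.timeI ∧ q.freqI ⊆ p.freqI

/-- The inner product `⟨f, w_p⟩` of a function with a (real valued) wave packet. -/
def coef (f : ℝ → ℂ) (p : Tile) : ℂ := ∫ x, f x * (p.wp x : ℂ)

/-- The rank one projection `Π_p f = ⟨f, w_p⟩ w_p` associated to a single tile. -/
def projT (p : Tile) (f : ℝ → ℂ) (x : ℝ) : ℂ := coef f p * (p.wp x : ℂ)

/-- The projection associated to a collection of (pairwise disjoint) tiles. -/
def projSet (𝔭 : Set Tile) (f : ℝ → ℂ) (x : ℝ) : ℂ := ∑' p : 𝔭, projT p f x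

/-- The maximal tiles contained in a subset `S` of the phase plane; when `S` is a disjoint
union of tiles (of the kind appearing below) these form the canonical tiling of `S`. -/
def maxTiles (S : Set (ℝ × ℝ)) : Set Tile :=
  {p | p.toSet ⊆ S ∧ ∀ q : Tile, q.toSet ⊆ S → tileLE p q → q = p}

/-- The phase plane projection `Π_S` associated to a subset `S` of the phase plane,
computed with the canonical tiling of `S` by maximal tiles (the projection is independent
of the chosen tiling). -/
def piProj (S : Set (ℝ × ℝ)) (f : ℝ → ℂ) (x : ℝ) : ℂ := projSet (maxTiles S) f x

/-- A bitile: the dyadic rectangle `[2^k n, 2^k(n+1)) × [2^{1-k} l, 2^{1-k}(l+1))` of area two. -/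
structure Bitile where
  k : ℤ
  n : ℕ
  l : ℕ

namespace Bitile

/-- The time interval `I_P` of a bitile. -/
def timeI (P : Bitile) : Set ℝ := Ico ((2:ℝ)^P.k * P.n) ((2:ℝ)^P.k * (P.n+1))

/-- The frequency interval `ω_P` of a bitile. -/
def freqI (P : Bitile) : Set ℝ := Ico ((2:ℝ)^(1-P.k) * P.l) ((2:ℝ)^(1-P.k) * (P.l+1))

/-- The bitile as a subset of the phase plane. -/
def toSet (P : Bitile) : Set (ℝ × ℝ) := P.timeI ×ˢ P.freqI

/-- The lower tile `P_d` of a bitile. -/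
def d (P : Bitile) : Tile := ⟨P.k, P.n, 2*P.l⟩

/-- The upper tile `P_u` of a bitile. -/
def u (P : Bitile) : Tile := ⟨P.k, P.n, 2*P.l+1⟩

/-- The left tile of a bitile. -/
def left (P : Bitile) : Tile := ⟨P.k-1, 2*P.n, P.l⟩

/-- The right tile of a bitile. -/
def right (P : Bitile) : Tile := ⟨P.k-1, 2*P.n+1, P.l⟩

/-- The `L^∞`-normalized wave packet `φ_{P_d} = |I_P|^{1/2} w_{P_d}`. -/
def phid (P : Bitile) (x : ℝ) : ℝ := Real.sqrt ((2:ℝ)^P.k) * P.d.wp x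

end Bitile

/-- The order on dyadic rectangles, for bitiles. -/
def bitileLE (P Q : Bitile) : Prop := P.timeI ⊆ Q.timeI ∧ Q.freqI ⊆ P.freqI

/-- Strict order on bitiles. -/
def bitileLT (P Q : Bitile) : Prop := bitileLE P Q ∧ P ≠ Q

/-- A collection of bitiles is convex if together with `P₁ < P < P₂` for `P₁, P₂` in the
collection it contains `P`. -/
def IsConvex (PP : Set Bitile) : Prop :=
  ∀ P1 P2 P : Bitile, P1 ∈ PP → P2 ∈ PP → bitileLT P1 P → bitileLT P P2 → P ∈ PP

/-- A tree: a collection of bitiles with a (unique) maximal element `P_T = I_T × ω_T`. -/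
structure Tree where
  carrier : Set Bitile
  top : Bitile
  top_mem : top ∈ carrier
  le_top : ∀ P ∈ carrier, bitileLE P top

namespace Tree

/-- `T_d`: those bitiles of the tree whose lower tile frequency interval contains `ω_T`
(in the paper's notation, `P_T ≤ P_d`). -/
def Td (T : Tree) : Set Bitile := {P | P ∈ T.carrier ∧ T.top.freqI ⊆ P.d.freqI}

/-- `T_u`: those bitiles of the tree whose upper tile frequency interval contains `ω_T`
(in the paper's notation, `P_T ≤ P_u`). -/
def Tu (T : Tree) : Set Bitile := {P | P ∈ T.carrier ∧ T.top.freqI ⊆ P.u.freqI}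

/-- The region `⋃_{P ∈ T} P` of the phase plane occupied by a tree. -/
def unionSet (T : Tree) : Set (ℝ × ℝ) := ⋃ P ∈ T.carrier, P.toSet

/-- The phase plane projection `Π_T` of a (convex) tree. -/
def proj (T : Tree) (f : ℝ → ℂ) : ℝ → ℂ := piProj T.unionSet f

end Tree

/-- The vertical dilation `2^L S` of a subset of the phase plane. -/
def dilate (L : ℕ) (S : Set (ℝ × ℝ)) : Set (ℝ × ℝ) := (fun q => (q.1, (2:ℝ)^L * q.2)) '' S

/-- The enlarged tree `T^{(L)}` with respect to a frequency `ξ ∈ ω_T`: all bitiles `P` with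
`2^L ξ ∈ ω_P` contained in a rectangle `2^L P'` with `P' ∈ T`. -/
def Tree.enlarged (L : ℕ) (T : Tree) (ξ : ℝ) : Set Bitile :=
  {P | (2:ℝ)^L * ξ ∈ P.freqI ∧ ∃ P' ∈ T.carrier, P.toSet ⊆ dilate L P'.toSet}

/-- The region of the phase plane occupied by the enlarged tree `T^{(L)}`. -/
def Tree.enlargedSet (L : ℕ) (T : Tree) (ξ : ℝ) : Set (ℝ × ℝ) :=
  ⋃ P ∈ T.enlarged L ξ, P.toSet

/-- The left endpoint of `ω_T`, a canonical choice of `ξ ∈ ω_T`. -/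
def Tree.xiTop (T : Tree) : ℝ := (2:ℝ)^(1-T.top.k) * T.top.l

/-- The phase plane projection `Π_{T^{(L)}}` of the enlarged tree (independent of the
choice of `ξ ∈ ω_T`; we use the canonical choice).  For `L = 0` this is `Π_T`. -/
def Tree.projL (L : ℕ) (T : Tree) (f : ℝ → ℂ) : ℝ → ℂ := piProj (T.enlargedSet L T.xiTop) f

/-- `size^{(L)}(PP, f) = sup |I_T|^{-1/2} ‖Π_{T^{(L)}} f‖₂`, the supremum over convex trees
`T ⊆ PP`.  For `L = 0` this is the plain `size(PP, f)`. -/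
def size (L : ℕ) (PP : Set Bitile) (f : ℝ → ℂ) : ℝ≥0∞ :=
  ⨆ (T : Tree) (_ : T.carrier ⊆ PP ∧ IsConvex T.carrier),
    (ENNReal.ofReal (Real.sqrt ((2:ℝ)^T.top.k)))⁻¹ * eLpNorm (T.projL L f) 2 volume

/-- The quartile form `Λ_{PP}` restricted to a collection `PP` of bitiles. -/
def quartileFormOn (L : ℕ) (PP : Set Bitile) (f1 f2 f3 : ℝ → ℂ) : ℂ :=
  ∫ x, ∑' P : PP, (P.1.phid x : ℂ) * projT P.1.u f1 x *
      piProj (dilate L P.1.d.toSet) f2 x * piProj (dilate L P.1.d.toSet) f3 x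

/-- The bitiles contained in the strip `ℝ₊ × [0, 2^N)`. -/
def stripBitiles (N : ℕ) : Set Bitile := {P | P.freqI ⊆ Ico (0:ℝ) ((2:ℝ)^N)}

/-- The quartile form `Λ_L` (with frequency truncation parameter `N`). -/
def quartileForm (L N : ℕ) (f1 f2 f3 : ℝ → ℂ) : ℂ :=
  quartileFormOn L (stripBitiles N) f1 f2 f3

/-- The quartile form perturbed by a bounded sequence of coefficients `c_P`. -/
def quartileFormC (L N : ℕ) (c : Bitile → ℂ) (f1 f2 f3 : ℝ → ℂ) : ℂ :=
  ∫ x, ∑' P : stripBitiles N, c P.1 * (P.1.phid x : ℂ) * projT P.1.u f1 x *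
      piProj (dilate L P.1.d.toSet) f2 x * piProj (dilate L P.1.d.toSet) f3 x

/-- The counting function `Σ_{T ∈ 𝕋} 1_{I_T}` of a collection of trees. -/
def countingFn (𝕋 : Set Tree) (x : ℝ) : ℝ≥0∞ :=
  ∑' T : 𝕋, (T.1.top.timeI).indicator (fun _ => (1:ℝ≥0∞)) x

/-- The average of an `ℝ≥0∞`-valued function over a set. -/
def avgOn (I : Set ℝ) (g : ℝ → ℝ≥0∞) : ℝ≥0∞ := (volume I)⁻¹ * ∫⁻ x in I, g x

/-- The dyadic BMO norm on `[0,∞)` of an `ℝ≥0∞`-valued function. -/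
def dyadicBMO (g : ℝ → ℝ≥0∞) : ℝ≥0∞ :=
  ⨆ (k : ℤ) (n : ℕ), avgOn (dyadicI k n)
    (fun x => (g x - avgOn (dyadicI k n) g) + (avgOn (dyadicI k n) g - g x))

/-- The dyadic Hardy-Littlewood maximal function on `[0,∞)`. -/
def dyadicMax (f : ℝ → ℂ) (x : ℝ) : ℝ≥0∞ :=
  ⨆ (k : ℤ) (n : ℕ) (_ : x ∈ dyadicI k n),
    (volume (dyadicI k n))⁻¹ * ∫⁻ y in dyadicI k n, ‖f y‖₊

/-- The dyadic interval of length `2^j` containing `y ≥ 0`. -/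
def freqInterval (j : ℤ) (y : ℝ) : Set ℝ :=
  Ico ((2:ℝ)^j * ⌊y / (2:ℝ)^j⌋) ((2:ℝ)^j * (⌊y / (2:ℝ)^j⌋ + 1))

/-- The projection `Π_l := Π_{I_T × ω_l}`, where `ω_l` is the dyadic interval of
length `2^l` containing the frequency `y`. -/
def PiScale (T : Tree) (j : ℤ) (y : ℝ) (f : ℝ → ℂ) : ℝ → ℂ :=
  piProj (T.top.timeI ×ˢ freqInterval j y) f

/-- The difference projection `Π_l^Δ = Π_l - Π_{l-1}`. -/
def PiDelta (T : Tree) (j : ℤ) (y : ℝ) (f : ℝ → ℂ) (x : ℝ) : ℂ :=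
  PiScale T j y f x - PiScale T (j-1) y f x

section Work
open Classical

/-- block sums -/
def bs {M : Type*} [AddCommMonoid M] : ℕ → ℕ → (ℕ → M) → M
  | 0, m, F => F m
  | d+1, m, F => bs d (2*m) F + bs d (2*m+1) F

section bsl
variable {M : Type*} [AddCommMonoid M]

lemma bs_zero (m : ℕ) (F : ℕ → M) : bs 0 m F = F m := rfl
lemma bs_succ (d m : ℕ) (F : ℕ → M) : bs (d+1) m F = bs d (2*m) F + bs d (2*m+1) F := rfl

lemma bs_add (a b m : ℕ) (F : ℕ → M) : bs (a+b) m F = bs a m (fun j => bs b j F) := by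
  induction a generalizing m with
  | zero => simp [bs_zero]
  | succ a ih => rw [show a+1+b = (a+b)+1 by ring, bs_succ, bs_succ, ih, ih]

lemma div_child {d j m : ℕ} {c : ℕ} (hc : c < 2) (h : j / 2^d = 2*m+c) : j / 2^(d+1) = m := by
  rw [pow_succ, ← Nat.div_div_eq_div_mul, h]; omega

lemma bs_congr {d m : ℕ} {F G : ℕ → M} (h : ∀ j, j / 2^d = m → F j = G j) :
    bs d m F = bs d m G := by
  induction d generalizing m with
  | zero => exact h m (by simp)
  | succ d ih =>
    rw [bs_succ, bs_succ, ih, ih]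
    · intro j hj; exact h j (div_child one_lt_two hj)
    · intro j hj; exact h j (div_child (c := 0) two_pos (by simpa using hj))

lemma bs_eq_sum (d m : ℕ) (F : ℕ → M) :
    bs d m F = ∑ j ∈ Finset.Ico (m*2^d) ((m+1)*2^d), F j := by
  induction d generalizing m with
  | zero => simp [bs_zero]
  | succ d ih =>
    rw [bs_succ, ih, ih, Finset.sum_Ico_consecutive]
    · congr 2 <;> ring
    · exact Nat.mul_le_mul_right _ (by omega)
    · exact Nat.mul_le_mul_right _ (by omega)

lemma bs_fadd (d m : ℕ) (F G : ℕ → M) : bs d m (fun j => F j + G j) = bs d m F + bs d m G := by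
  simp only [bs_eq_sum, Finset.sum_add_distrib]

lemma bs_fzero (d m : ℕ) : bs d m (fun _ => (0:M)) = 0 := by
  simp only [bs_eq_sum, Finset.sum_const_zero]

lemma bs_sum {ι : Type*} (s : Finset ι) (d m : ℕ) (F : ι → ℕ → M) :
    bs d m (fun j => ∑ i ∈ s, F i j) = ∑ i ∈ s, bs d m (F i) := by
  simp only [bs_eq_sum]; exact Finset.sum_comm

lemma mem_block {d m j : ℕ} : j ∈ Finset.Ico (m*2^d) ((m+1)*2^d) ↔ j / 2^d = m := by
  have : 0 < 2^d := by positivity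
  rw [Finset.mem_Ico, Nat.div_eq_iff this]
  constructor
  · rintro ⟨h1, h2⟩; exact ⟨h1, by rw [add_mul, one_mul] at h2; omega⟩
  · rintro ⟨h1, h2⟩; exact ⟨h1, by rw [add_mul, one_mul]; omega⟩
end bsl

lemma bs_mul {K : Type*} [Semiring K] (d m : ℕ) (c : K) (F : ℕ → K) :
    bs d m (fun j => c * F j) = c * bs d m F := by
  simp only [bs_eq_sum, Finset.mul_sum]

lemma bs_fsub {K : Type*} [AddCommGroup K] (d m : ℕ) (F G : ℕ → K) :
    bs d m (fun j => F j - G j) = bs d m F - bs d m G := by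
  simp only [bs_eq_sum, Finset.sum_sub_distrib]

lemma bs_mono {d m : ℕ} {F G : ℕ → ℝ} (h : ∀ j, j / 2^d = m → F j ≤ G j) :
    bs d m F ≤ bs d m G := by
  simp only [bs_eq_sum]; exact Finset.sum_le_sum fun j hj => h j (mem_block.1 hj)

lemma bs_nonneg {d m : ℕ} {F : ℕ → ℝ} (h : ∀ j, 0 ≤ F j) : 0 ≤ bs d m F := by
  simp only [bs_eq_sum]; exact Finset.sum_nonneg fun j _ => h j

lemma bs_norm {d m : ℕ} (F : ℕ → ℂ) : ‖bs d m F‖ ≤ bs d m (fun j => ‖F j‖) := by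
  simp only [bs_eq_sum]; exact norm_sum_le _ _

/-- tree sums -/
def TS {K : Type*} [Field K] (F : ℕ → ℕ → K) : ℕ → ℕ → ℕ → K
  | 0, _, _ => 0
  | d+1, i, m => F i m + (TS F d (i+1) (2*m) + TS F d (i+1) (2*m+1)) / 2

section tsl
variable {K : Type*} [Field K]
lemma TS_zero (F : ℕ → ℕ → K) (i m : ℕ) : TS F 0 i m = 0 := rfl
lemma TS_succ (F : ℕ → ℕ → K) (d i m : ℕ) :
    TS F (d+1) i m = F i m + (TS F d (i+1) (2*m) + TS F d (i+1) (2*m+1)) / 2 := rfl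

lemma TS_eq (F : ℕ → ℕ → K) (d i m : ℕ) :
    TS F d i m = ∑ j ∈ Finset.range d, (1/2:K)^j * bs j m (F (i+j)) := by
  induction d generalizing i m with
  | zero => simp [TS_zero]
  | succ d ih =>
    rw [TS_succ, ih, ih, Finset.sum_range_succ']
    simp only [pow_zero, one_mul, bs_zero, add_zero, bs_succ, ← Finset.sum_add_distrib, Finset.sum_div]
    rw [add_comm]; congr 1
    refine Finset.sum_congr rfl fun j _ => ?_
    rw [show i+1+j = i+(j+1) by ring, pow_succ]; ring

lemma TS_congr {F G : ℕ → ℕ → K} {d i m : ℕ}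
    (h : ∀ j < d, ∀ m', m' / 2^j = m → F (i+j) m' = G (i+j) m') : TS F d i m = TS G d i m := by
  rw [TS_eq, TS_eq]
  refine Finset.sum_congr rfl fun j hj => ?_
  rw [bs_congr (h j (Finset.mem_range.1 hj))]

lemma TS_fadd (F G : ℕ → ℕ → K) (d i m : ℕ) :
    TS (fun i m => F i m + G i m) d i m = TS F d i m + TS G d i m := by
  simp only [TS_eq, bs_fadd, mul_add, Finset.sum_add_distrib]

lemma TS_mul (c : K) (F : ℕ → ℕ → K) (d i m : ℕ) :
    TS (fun i m => c * F i m) d i m = c * TS F d i m := by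
  simp only [TS_eq, bs_mul, Finset.mul_sum]
  exact Finset.sum_congr rfl fun j _ => by ring

lemma TS_fzero (d i m : ℕ) : TS (fun _ _ => (0:K)) d i m = 0 := by
  simp only [TS_eq, bs_fzero, mul_zero, Finset.sum_const_zero]

/-- shifted average -/
def shf (M : ℕ) (w : ℕ → ℕ → K) (i m : ℕ) : K := (1/2:K)^M * bs M m (w (i+M))

lemma TS_shift (w : ℕ → ℕ → K) (M r i m : ℕ) :
    TS w (M+r) i m = TS w M i m + TS (shf M w) r i m := by
  rw [TS_eq, Finset.sum_range_add, TS_eq, TS_eq]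
  congr 1
  refine Finset.sum_congr rfl fun j _ => ?_
  have e : shf M w (i+j) = fun m => (1/2:K)^M * bs M m (w (i+j+M)) := rfl
  rw [e, bs_mul, add_comm M j, bs_add, pow_add]
  rw [show i + (j+M) = i+j+M by ring]; ring
end tsl

lemma TS_mono {F G : ℕ → ℕ → ℝ} {d i m : ℕ}
    (h : ∀ j < d, ∀ m', m' / 2^j = m → F (i+j) m' ≤ G (i+j) m') : TS F d i m ≤ TS G d i m := by
  rw [TS_eq, TS_eq]
  refine Finset.sum_le_sum fun j hj => ?_
  exact mul_le_mul_of_nonneg_left (bs_mono (h j (Finset.mem_range.1 hj))) (by positivity)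

lemma TS_nonneg {F : ℕ → ℕ → ℝ} (h : ∀ i m, 0 ≤ F i m) (d i m : ℕ) : 0 ≤ TS F d i m := by
  rw [TS_eq]; exact Finset.sum_nonneg fun j _ => mul_nonneg (by positivity) (bs_nonneg (h _))

lemma TS_norm (F : ℕ → ℕ → ℂ) (d i m : ℕ) : ‖TS F d i m‖ ≤ TS (fun i m => ‖F i m‖) d i m := by
  rw [TS_eq, TS_eq]
  refine (norm_sum_le _ _).trans (Finset.sum_le_sum fun j _ => ?_)
  rw [norm_mul, norm_pow]
  simp only [norm_div, norm_one, Complex.norm_ofNat]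
  exact mul_le_mul_of_nonneg_left (bs_norm _) (by positivity)

lemma TS_depth {F : ℕ → ℕ → ℝ} (h : ∀ i m, 0 ≤ F i m) {d d' : ℕ} (hd : d ≤ d') (i m : ℕ) :
    TS F d i m ≤ TS F d' i m := by
  obtain ⟨r, rfl⟩ := Nat.exists_eq_add_of_le hd
  rw [TS_shift]
  have : 0 ≤ TS (shf d F) r i m := TS_nonneg (fun i m => by
    unfold shf; exact mul_nonneg (by positivity) (bs_nonneg (h _))) _ _ _
  linarith

/-- Cauchy–Schwarz for tree sums, in AM-GM form -/
lemma TS_cs {F a b : ℕ → ℕ → ℝ} {d i m : ℕ} {α β : ℝ} (hα : 0 < α) (hβ : 0 < β)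
    (hF : ∀ i m, F i m ≤ (β/α * a i m + α/β * b i m)/2)
    (ha : TS a d i m ≤ α^2) (hb : TS b d i m ≤ β^2) :
    TS F d i m ≤ α * β := by
  have h1 : TS F d i m ≤ TS (fun i m => β/(2*α) * a i m + α/(2*β) * b i m) d i m := by
    refine TS_mono fun j _ m' _ => (hF _ _).trans (le_of_eq ?_)
    field_simp
  rw [TS_fadd, TS_mul, TS_mul] at h1
  have h2 : β/(2*α) * TS a d i m ≤ β/(2*α) * α^2 := mul_le_mul_of_nonneg_left ha (by positivity)
  have h3 : α/(2*β) * TS b d i m ≤ α/(2*β) * β^2 := mul_le_mul_of_nonneg_left hb (by positivity)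
  have h4 : β/(2*α) * α^2 + α/(2*β) * β^2 = α * β := by field_simp; ring
  linarith

lemma amgm {α β x y : ℝ} (hα : 0 < α) (hβ : 0 < β) :
    x * y ≤ (β/α * x^2 + α/β * y^2)/2 := by
  have : (β/α * x^2 + α/β * y^2)/2 - x*y = (β*x - α*y)^2/(2*α*β) := by field_simp; ring
  have h : 0 ≤ (β*x - α*y)^2/(2*α*β) := by positivity
  linarith

/-- summation by parts -/
def SB {K : Type*} [Field K] (g w : ℕ → ℕ → K) : ℕ → ℕ → ℕ → K
  | 0, _, _ => 0
  | d+1, i, m => g i m * ((TS w d (i+1) (2*m) - TS w d (i+1) (2*m+1))/2)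
      + (SB g w d (i+1) (2*m) + SB g w d (i+1) (2*m+1)) / 2

lemma SB_parts {K : Type*} [Field K] (g w y : ℕ → ℕ → K)
    (hy0 : ∀ i m, y (i+1) (2*m) = y i m + g i m)
    (hy1 : ∀ i m, y (i+1) (2*m+1) = y i m - g i m) (d i m : ℕ) :
    TS (fun i m => w i m * y i m) d i m = y i m * TS w d i m + SB g w d i m := by
  induction d generalizing i m with
  | zero => simp [TS_zero, SB]
  | succ d ih =>
    rw [TS_succ, ih, ih, TS_succ, SB, hy0, hy1]; ring

lemma SB_zero_of {K : Type*} [Field K] (g w : ℕ → ℕ → K) (d i m : ℕ)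
    (hg : ∀ j m, i ≤ j → g j m = 0) : SB g w d i m = 0 := by
  induction d generalizing i m with
  | zero => rfl
  | succ d ih =>
    rw [SB, hg i m le_rfl, ih, ih]
    · simp
    · intro j m h; exact hg j m (by omega)
    · intro j m h; exact hg j m (by omega)

lemma SB_split {K : Type*} [Field K] (g w : ℕ → ℕ → K) (M r i m : ℕ)
    (hg : ∀ j m, i + r ≤ j → g j m = 0) :
    SB g w (M+r) i m = TS (fun i m => g i m *
      ((TS w M (i+1) (2*m) - TS w M (i+1) (2*m+1))/2)) r i m + SB g (shf M w) r i m := by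
  induction r generalizing i m with
  | zero => rw [SB_zero_of]; · simp [TS_zero, SB]
            · simpa using hg
  | succ r ih =>
    rw [show M + (r+1) = (M+r)+1 by ring, SB, ih, ih, TS_shift, TS_shift, TS_succ, SB]
    · ring
    · intro j m h; exact hg j m (by omega)
    · intro j m h; exact hg j m (by omega)

/-- numeric Bellman inequality -/
lemma bellman_num {μ M1 M2 Y G c : ℝ} (hμ : 0 ≤ μ) (h1 : 0 ≤ M1) (h2 : 0 ≤ M2) (h1' : M1 ≤ 1)
    (h2' : M2 ≤ 1) (hM : μ + (M1+M2)/2 ≤ 1/2) (hc : c^2 ≤ Y * G) (hY : 0 ≤ Y) (hG : 0 ≤ G) :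
    μ * Y + 2 * ((Y + G + 2*c) * (M1/(1+M1)) + (Y + G - 2*c) * (M2/(1+M2)))
      ≤ 8 * G + 4 * (Y * ((μ + (M1+M2)/2)/(1+(μ + (M1+M2)/2)))) := by
  set a := M1/(1+M1) with ha
  set b := M2/(1+M2) with hb
  set e := (μ + (M1+M2)/2)/(1+(μ + (M1+M2)/2)) with he
  have ha1 : a ≤ 1/2 := by rw [ha, div_le_iff₀ (by linarith)]; linarith
  have hb1 : b ≤ 1/2 := by rw [hb, div_le_iff₀ (by linarith)]; linarith
  have key : μ + (a-b)^2 ≤ 4 * e - 2*(a+b) := by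
    have hq : (μ + (M1+M2)/2)/(1+(μ + (M1+M2)/2)) - ((M1+M2)/2)/(1+(M1+M2)/2) ≥ μ/4 := by
      rw [ge_iff_le, div_sub_div _ _ (by linarith) (by linarith), le_div_iff₀ (by nlinarith)]
      have : (1+(μ + (M1+M2)/2)) * (1+(M1+M2)/2) ≤ 4 := by nlinarith
      nlinarith
    have hr : 4 * (((M1+M2)/2)/(1+(M1+M2)/2)) - 2*(a+b) ≥ (a-b)^2 := by
      have e1 : 4 * (((M1+M2)/2)/(1+(M1+M2)/2)) - 2*(a+b) = 2*(M1-M2)^2/((1+M1)*(1+M2)*(2+M1+M2)) := by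
        rw [ha, hb]; field_simp; ring
      have e2 : (a-b)^2 = (M1-M2)^2/((1+M1)*(1+M2))^2 := by
        rw [ha, hb]; field_simp; ring
      rw [e1, e2, ge_iff_le, div_le_div_iff₀ (by positivity) (by positivity)]
      have : (1+M1)*(1+M2)*(2+M1+M2) ≤ 2 * ((1+M1)*(1+M2))^2 := by
        have : (2+M1+M2) ≤ 2 * ((1+M1)*(1+M2)) := by nlinarith
        nlinarith [mul_pos (show 0 < 1+M1 by linarith) (show 0 < 1+M2 by linarith)]
      nlinarith [sq_nonneg (M1-M2)]
    rw [he]; linarith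
  have hcross : 4 * c * (a-b) ≤ 4 * G + Y * (a-b)^2 := by
    have h0 : (4*c*(a-b))^2 ≤ (4*G + Y*(a-b)^2)^2 := by
      have := mul_le_mul_of_nonneg_right hc (sq_nonneg (a-b))
      nlinarith [sq_nonneg (4*G - Y*(a-b)^2)]
    exact (abs_le_of_sq_le_sq' h0 (by positivity)).2
  nlinarith [mul_le_mul_of_nonneg_left key hY]

/-- Carleson embedding -/
lemma carleson {T : ℕ → ℕ → Prop} {μ : ℕ → ℕ → ℝ} {g y : ℕ → ℕ → ℂ}
    (hμ : ∀ i m, 0 ≤ μ i m)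
    (hT : ∀ i m, T (i+1) m → T i (m/2))
    (hg : ∀ i m, ¬ T i m → g i m = 0)
    (hy0 : ∀ i m, y (i+1) (2*m) = y i m + g i m)
    (hy1 : ∀ i m, y (i+1) (2*m+1) = y i m - g i m)
    (hB : ∀ d i m, T i m → TS μ d i m ≤ 1/2) (d i m : ℕ) (hM : TS μ d i m ≤ 1) :
    TS (fun i m => μ i m * ‖y i m‖^2) d i m ≤
      8 * TS (fun i m => ‖g i m‖^2) d i m + 4 * (‖y i m‖^2 * (TS μ d i m/(1+TS μ d i m))) := by
  have nonT : ∀ d i m, ¬ T i m → TS (fun i m => μ i m * ‖y i m‖^2) d i m = ‖y i m‖^2 * TS μ d i m := by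
    intro d
    induction d with
    | zero => intro i m _; simp [TS_zero]
    | succ d ih =>
      intro i m h
      have h0 : ¬ T (i+1) (2*m) := fun h' => h (by simpa using hT _ _ h')
      have h1 : ¬ T (i+1) (2*m+1) := fun h' => h (by
        have := hT _ _ h'; rwa [show (2*m+1)/2 = m by omega] at this)
      rw [TS_succ, ih _ _ h0, ih _ _ h1, hy0, hy1, hg i m h, TS_succ]; simp; ring
  have hnn := fun d i m => TS_nonneg hμ d i m
  induction d generalizing i m with
  | zero => simp [TS_zero]
  | succ d ih =>
    by_cases h : T i m
    · have hM' := hB (d+1) i m h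
      rw [TS_succ] at hM'
      have n1 := hnn d (i+1) (2*m)
      have n2 := hnn d (i+1) (2*m+1)
      have n0 := hμ i m
      have i1 := ih (i+1) (2*m) (by linarith)
      have i2 := ih (i+1) (2*m+1) (by linarith)
      rw [TS_succ, TS_succ, TS_succ]
      rw [hy0] at i1
      rw [hy1] at i2
      set M1 := TS μ d (i+1) (2*m)
      set M2 := TS μ d (i+1) (2*m+1)
      have e1 : ‖y i m + g i m‖^2 = ‖y i m‖^2 + ‖g i m‖^2 + 2*(y i m * (starRingEnd ℂ) (g i m)).re := by
        rw [Complex.sq_norm, Complex.sq_norm, Complex.sq_norm, Complex.normSq_add]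
      have e2 : ‖y i m - g i m‖^2 = ‖y i m‖^2 + ‖g i m‖^2 - 2*(y i m * (starRingEnd ℂ) (g i m)).re := by
        rw [Complex.sq_norm, Complex.sq_norm, Complex.sq_norm, Complex.normSq_sub]
      have ec : (y i m * (starRingEnd ℂ) (g i m)).re^2 ≤ ‖y i m‖^2 * ‖g i m‖^2 := by
        have := Complex.abs_re_le_norm (y i m * (starRingEnd ℂ) (g i m))
        rw [norm_mul, RCLike.norm_conj] at this
        rw [← mul_pow, ← sq_abs]
        exact pow_le_pow_left₀ (abs_nonneg _) this 2
      rw [e1] at i1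
      rw [e2] at i2
      have := bellman_num n0 n1 n2 (by linarith) (by linarith) hM' ec (by positivity) (by positivity)
      linarith
    · rw [nonT _ _ _ h]
      have h0 := hnn (d+1) i m
      set M := TS μ (d+1) i m
      have hv : 0 ≤ TS (fun i m => ‖g i m‖^2) (d+1) i m := TS_nonneg (fun i m => by positivity) _ _ _
      have : M ≤ 4 * (M/(1+M)) := by
        rw [← mul_div_assoc, le_div_iff₀ (by linarith)]; nlinarith
      nlinarith [mul_le_mul_of_nonneg_left this (sq_nonneg ‖y i m‖)]

lemma carleson' {T : ℕ → ℕ → Prop} {μ : ℕ → ℕ → ℝ} {g y : ℕ → ℕ → ℂ} {B : ℝ} (hBp : 0 < B)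
    (hμ : ∀ i m, 0 ≤ μ i m)
    (hT : ∀ i m, T (i+1) m → T i (m/2))
    (hg : ∀ i m, ¬ T i m → g i m = 0)
    (hy0 : ∀ i m, y (i+1) (2*m) = y i m + g i m)
    (hy1 : ∀ i m, y (i+1) (2*m+1) = y i m - g i m)
    (hB : ∀ d i m, T i m → TS μ d i m ≤ B) (d i m : ℕ) (hT0 : T i m) (h0 : y i m = 0) :
    TS (fun i m => μ i m * ‖y i m‖^2) d i m ≤ 16 * B * TS (fun i m => ‖g i m‖^2) d i m := by
  have key := carleson (T := T) (μ := fun i m => (1/(2*B)) * μ i m) (g := g) (y := y)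
    (fun i m => mul_nonneg (by positivity) (hμ i m)) hT hg hy0 hy1 (fun d i m h => by
      rw [TS_mul]
      have := mul_le_mul_of_nonneg_left (hB d i m h) (show 0 ≤ 1/(2*B) by positivity)
      refine this.trans (le_of_eq ?_); field_simp) d i m (by
      rw [TS_mul]
      have := mul_le_mul_of_nonneg_left (hB d i m hT0) (show 0 ≤ 1/(2*B) by positivity)
      refine this.trans ?_
      rw [show 1/(2*B)*B = 1/2 by field_simp]; norm_num)
  simp only [mul_assoc] at key
  rw [TS_mul, h0] at key
  simp only [norm_zero] at key
  have e : TS (fun i m => μ i m * ‖y i m‖^2) d i m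
     = 2*B*(1/(2*B) * TS (fun i m => μ i m * ‖y i m‖^2) d i m) := by field_simp
  rw [e]
  have := mul_le_mul_of_nonneg_left key (show 0 ≤ 2*B by positivity)
  refine this.trans (le_of_eq ?_); ring

end Work

section Work
open Classical

/-- summed Haar coefficients along the tree -/
def yy (g : ℕ → ℕ → ℂ) : ℕ → ℕ → ℂ
  | 0, _ => 0
  | i+1, m => yy g i (m/2) + (if m % 2 = 0 then g i (m/2) else - g i (m/2))

lemma yy0 (g : ℕ → ℕ → ℂ) (i m : ℕ) : yy g (i+1) (2*m) = yy g i m + g i m := by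
  simp [yy]
lemma yy1 (g : ℕ → ℕ → ℂ) (i m : ℕ) : yy g (i+1) (2*m+1) = yy g i m - g i m := by
  have h1 : (2*m+1)/2 = m := by omega
  have h2 : (2*m+1)%2 = 1 := by omega
  simp [yy, h1, h2, sub_eq_add_neg]

/-- the Haar part of a martingale -/
def hh (u : ℕ → ℕ → ℂ) (i m : ℕ) : ℂ := (u (i+1) (2*m) - u (i+1) (2*m+1))/2

lemma prod_block (u v : ℕ → ℕ → ℂ)
    (hu : ∀ i m, u i m = (u (i+1) (2*m) + u (i+1) (2*m+1))/2)
    (hv : ∀ i m, v i m = (v (i+1) (2*m) + v (i+1) (2*m+1))/2) (d i m : ℕ) :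
    (1/2:ℂ)^d * bs d m (fun j => u (i+d) j * v (i+d) j) =
      u i m * v i m + TS (fun i m => hh u i m * hh v i m) d i m := by
  induction d generalizing i m with
  | zero => simp [bs_zero, TS_zero]
  | succ d ih =>
    have h1 := ih (i+1) (2*m)
    have h2 := ih (i+1) (2*m+1)
    rw [show i+1+d = i+(d+1) by ring] at h1 h2
    rw [bs_succ, TS_succ, pow_succ]
    have : (1/2:ℂ)^d * (1/2) * (bs d (2*m) (fun j => u (i+(d+1)) j * v (i+(d+1)) j) +
      bs d (2*m+1) (fun j => u (i+(d+1)) j * v (i+(d+1)) j)) =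
      ((1/2:ℂ)^d * bs d (2*m) (fun j => u (i+(d+1)) j * v (i+(d+1)) j) +
      (1/2:ℂ)^d *bs d (2*m+1) (fun j => u (i+(d+1)) j * v (i+(d+1)) j))/2 := by ring
    rw [this, h1, h2, hu i m, hv i m]
    simp only [hh]; ring

lemma shf_nonneg {M : ℕ} {w : ℕ → ℕ → ℝ} (hw : ∀ i m, 0 ≤ w i m) (i m : ℕ) : 0 ≤ shf M w i m := by
  unfold shf; exact mul_nonneg (by positivity) (bs_nonneg (hw _))

theorem tree_abs {T S : ℕ → ℕ → Prop} {u v g : ℕ → ℕ → ℂ} {M r n0 : ℕ} {s1 s2 s3 : ℝ}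
    (p1 : 0 < s1) (p2 : 0 < s2) (p3 : 0 < s3)
    (hT : ∀ i m, T (i+1) m → T i (m/2)) (hT0 : T 0 n0)
    (hg : ∀ i m, ¬ T i m → g i m = 0) (hgr : ∀ i m, r ≤ i → g i m = 0)
    (hu : ∀ i m, u i m = (u (i+1) (2*m) + u (i+1) (2*m+1))/2)
    (hv : ∀ i m, v i m = (v (i+1) (2*m) + v (i+1) (2*m+1))/2)
    (bu : ∀ i m, T i m → ‖u i m‖ ≤ s2) (bv : ∀ i m, T i m → ‖v i m‖ ≤ s3)
    (hTS : ∀ i m, T i m → S i m)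
    (hS : ∀ i m e m', T i m → e ≤ M → m' / 2^e = m →
      S (i+e) m' ∨ hh u (i+e) m' * hh v (i+e) m' = 0)
    (mu : ∀ d i m, T i m → TS (fun i m => if S i m then ‖hh u i m‖^2 else 0) d i m ≤ 3*s2^2)
    (mv : ∀ d i m, T i m → TS (fun i m => if S i m then ‖hh v i m‖^2 else 0) d i m ≤ 3*s3^2)
    (hgs : ∀ d, TS (fun i m => ‖g i m‖^2) d 0 n0 ≤ s1^2) :
    ‖TS (fun i m => g i m * ((1/2:ℂ)^(M+1) * (bs M (2*m) (fun j => u (i+1+M) j * v (i+1+M) j)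
      - bs M (2*m+1) (fun j => u (i+1+M) j * v (i+1+M) j)))) r 0 n0‖ ≤ 32 * (s1*s2*s3) := by
  set μu : ℕ → ℕ → ℝ := fun i m => if S i m then ‖hh u i m‖^2 else 0 with hμu
  set μv : ℕ → ℕ → ℝ := fun i m => if S i m then ‖hh v i m‖^2 else 0 with hμv
  have nu : ∀ i m, 0 ≤ μu i m := fun i m => by rw [hμu]; dsimp only; split_ifs <;> positivity
  have nv : ∀ i m, 0 ≤ μv i m := fun i m => by rw [hμv]; dsimp only; split_ifs <;> positivity
  set w : ℕ → ℕ → ℂ := fun i m => if S i m then hh u i m * hh v i m else 0 with hw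
  set y := yy g with hy
  have e1 : TS (fun i m => g i m * ((1/2:ℂ)^(M+1) * (bs M (2*m) (fun j => u (i+1+M) j * v (i+1+M) j)
      - bs M (2*m+1) (fun j => u (i+1+M) j * v (i+1+M) j)))) r 0 n0
      = TS (fun i m => g i m * (u i m * hh v i m)) r 0 n0
        + TS (fun i m => g i m * (hh u i m * v i m)) r 0 n0
        + TS (fun i m => g i m * ((TS w M (i+1) (2*m) - TS w M (i+1) (2*m+1))/2)) r 0 n0 := by
    rw [← TS_fadd, ← TS_fadd]
    refine TS_congr fun j _ m _ => ?_
    simp only [zero_add]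
    by_cases hTj : T j m
    · have tw : ∀ c < 2, TS w M (j+1) (2*m+c) = TS (fun i m => hh u i m * hh v i m) M (j+1) (2*m+c) := by
        intro c hc
        refine TS_congr fun e he m' hm' => ?_
        have := hS j m (e+1) m' hTj he (div_child hc hm')
        rw [show j + (e+1) = j+1+e by ring] at this
        simp only [hw]
        rcases this with h | h
        · rw [if_pos h]
        · split_ifs
          · rfl
          · exact h.symm
      have t0 := tw 0 two_pos
      have t1 := tw 1 one_lt_two
      rw [add_zero] at t0
      rw [t0, t1]
      have q0 := prod_block u v hu hv M (j+1) (2*m)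
      have q1 := prod_block u v hu hv M (j+1) (2*m+1)
      have : (1/2:ℂ)^(M+1) * (bs M (2*m) (fun k => u (j+1+M) k * v (j+1+M) k)
        - bs M (2*m+1) (fun k => u (j+1+M) k * v (j+1+M) k)) =
        ((1/2:ℂ)^M * bs M (2*m) (fun k => u (j+1+M) k * v (j+1+M) k)
        - (1/2:ℂ)^M * bs M (2*m+1) (fun k => u (j+1+M) k * v (j+1+M) k))/2 := by ring
      rw [this, q0, q1, hu j m, hv j m]
      simp only [hh]; ring
    · rw [hg _ _ hTj]; simp
  have e2 : TS (fun i m => g i m * ((TS w M (i+1) (2*m) - TS w M (i+1) (2*m+1))/2)) r 0 n0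
      = TS (fun i m => w i m * y i m) (M+r) 0 n0 - TS (fun i m => shf M w i m * y i m) r 0 n0 := by
    have a1 := SB_parts g w y (yy0 g) (yy1 g) (M+r) 0 n0
    have a2 := SB_parts g (shf M w) y (yy0 g) (yy1 g) r 0 n0
    have a3 := SB_split g w M r 0 n0 (by simpa using hgr)
    have y0 : y 0 n0 = 0 := rfl
    rw [a1, a2, a3, y0]; ring
  have shl : ∀ (μ : ℕ → ℕ → ℝ), (∀ i m, 0 ≤ μ i m) → ∀ d i m, TS (shf M μ) d i m ≤ TS μ (M+d) i m := by
    intro μ hμ d i m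
    rw [TS_shift]; linarith [TS_nonneg hμ M i m]
  have c1 : ∀ d, TS (fun i m => μv i m * ‖y i m‖^2) d 0 n0 ≤ (7*(s1*s3))^2 := by
    intro d
    have := carleson' (T := T) (μ := μv) (g := g) (y := y) (B := 3*s3^2) (by positivity) nv hT hg
      (yy0 g) (yy1 g) (fun d i m h => mv d i m h) d 0 n0 hT0 rfl
    have h2 := mul_le_mul_of_nonneg_left (hgs d) (show 0 ≤ 16 * (3*s3^2) by positivity)
    have h3 : 0 ≤ s1^2*s3^2 := by positivity
    nlinarith
  have c2 : ∀ d, TS (fun i m => shf M μv i m * ‖y i m‖^2) d 0 n0 ≤ (7*(s1*s3))^2 := by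
    intro d
    have := carleson' (T := T) (μ := shf M μv) (g := g) (y := y) (B := 3*s3^2) (by positivity)
      (shf_nonneg nv) hT hg
      (yy0 g) (yy1 g) (fun d i m h => (shl μv nv d i m).trans (mv _ i m h)) d 0 n0 hT0 rfl
    have h2 := mul_le_mul_of_nonneg_left (hgs d) (show 0 ≤ 16 * (3*s3^2) by positivity)
    have h3 : 0 ≤ s1^2*s3^2 := by positivity
    nlinarith
  have hgT : ∀ i m, ‖g i m‖ = if T i m then ‖g i m‖ else 0 := by
    intro i m; split_ifs with h; rfl; rw [hg i m h, norm_zero]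
  have b1 : ‖TS (fun i m => g i m * (u i m * hh v i m)) r 0 n0‖ ≤ s2 * (s1*(2*s3)) := by
    refine (TS_norm _ _ _ _).trans ?_
    refine (TS_mono (G := fun i m => s2 * (‖g i m‖ * (if S i m then ‖hh v i m‖ else 0))) ?_).trans ?_
    · intro j _ m _
      rw [norm_mul, norm_mul]
      by_cases h : T (0+j) m
      · rw [if_pos (hTS _ _ h)]
        have := mul_le_mul_of_nonneg_left (bu _ _ h) (mul_nonneg (norm_nonneg (g (0+j) m)) (norm_nonneg (hh v (0+j) m)))
        linarith
      · rw [hg _ _ h]; simp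
    · rw [TS_mul]
      refine mul_le_mul_of_nonneg_left ?_ p2.le
      refine TS_cs (a := fun i m => ‖g i m‖^2) (b := μv) p1 (by positivity) ?_ (hgs r) ?_
      · intro i m
        refine (amgm p1 (show 0 < 2*s3 by positivity)).trans (le_of_eq ?_)
        simp only [hμv]; split_ifs <;> simp
      · exact (mv r 0 n0 hT0).trans (by nlinarith)
  have b2 : ‖TS (fun i m => g i m * (hh u i m * v i m)) r 0 n0‖ ≤ s3 * (s1*(2*s2)) := by
    refine (TS_norm _ _ _ _).trans ?_
    refine (TS_mono (G := fun i m => s3 * (‖g i m‖ * (if S i m then ‖hh u i m‖ else 0))) ?_).trans ?_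
    · intro j _ m _
      rw [norm_mul, norm_mul]
      by_cases h : T (0+j) m
      · rw [if_pos (hTS _ _ h)]
        have := mul_le_mul_of_nonneg_left (bv _ _ h) (mul_nonneg (norm_nonneg (g (0+j) m)) (norm_nonneg (hh u (0+j) m)))
        linarith
      · rw [hg _ _ h]; simp
    · rw [TS_mul]
      refine mul_le_mul_of_nonneg_left ?_ p3.le
      refine TS_cs (a := fun i m => ‖g i m‖^2) (b := μu) p1 (by positivity) ?_ (hgs r) ?_
      · intro i m
        refine (amgm p1 (show 0 < 2*s2 by positivity)).trans (le_of_eq ?_)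
        simp only [hμu]; split_ifs <;> simp
      · exact (mu r 0 n0 hT0).trans (by nlinarith)
  have hwn : ∀ i m, ∀ Y : ℝ, 0 ≤ Y → ‖w i m‖ * Y ≤
      ((7*(s1*s3))/(2*s2) * μu i m + (2*s2)/(7*(s1*s3)) * (μv i m * Y^2))/2 := by
    intro i m Y hY
    simp only [hw, hμu, hμv]
    split_ifs
    · rw [norm_mul, mul_assoc]
      refine (amgm (show 0 < 2*s2 by positivity) (show 0 < 7*(s1*s3) by positivity)).trans (le_of_eq ?_)
      rw [mul_pow]
    · simp
  have b3 : ‖TS (fun i m => w i m * y i m) (M+r) 0 n0‖ ≤ (2*s2)*(7*(s1*s3)) := by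
    refine (TS_norm _ _ _ _).trans ?_
    refine TS_cs (a := μu) (b := fun i m => μv i m * ‖y i m‖^2) (by positivity) (by positivity) ?_
      ((mu _ 0 n0 hT0).trans (by nlinarith)) (c1 _)
    intro i m
    rw [norm_mul]; exact hwn i m _ (norm_nonneg _)
  have b4 : ‖TS (fun i m => shf M w i m * y i m) r 0 n0‖ ≤ (2*s2)*(7*(s1*s3)) := by
    refine (TS_norm _ _ _ _).trans ?_
    refine TS_cs (a := shf M μu) (b := fun i m => shf M μv i m * ‖y i m‖^2) (by positivity) (by positivity) ?_
      (((shl μu nu _ _ _).trans (mu _ 0 n0 hT0)).trans (by nlinarith)) (c2 _)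
    intro i m
    rw [norm_mul]
    have h1 : ‖shf M w i m‖ ≤ (1/2:ℝ)^M * bs M m (fun j => ‖w (i+M) j‖) := by
      unfold shf
      rw [norm_mul, norm_pow]
      simp only [norm_div, norm_one, Complex.norm_ofNat]
      exact mul_le_mul_of_nonneg_left (bs_norm _) (by positivity)
    refine (mul_le_mul_of_nonneg_right h1 (norm_nonneg _)).trans ?_
    have h2 : bs M m (fun j => ‖y i m‖ * ‖w (i+M) j‖) ≤ bs M m (fun j =>
      (7*(s1*s3))/(2*s2)/2 * μu (i+M) j + (2*s2)/(7*(s1*s3))/2 * ‖y i m‖^2 * μv (i+M) j) := by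
      refine bs_mono fun j _ => ?_
      refine (le_of_eq (mul_comm _ _)).trans ((hwn (i+M) j _ (norm_nonneg _)).trans (le_of_eq ?_))
      ring
    rw [bs_mul, bs_fadd, bs_mul, bs_mul] at h2
    have h3 := mul_le_mul_of_nonneg_left h2 (show (0:ℝ) ≤ (1/2)^M by positivity)
    unfold shf
    calc _ = (1/2:ℝ)^M * (‖y i m‖ * bs M m (fun j => ‖w (i+M) j‖)) := by ring
      _ ≤ _ := h3
      _ = _ := by ring
  rw [e1, e2]
  have := norm_add_le (TS (fun i m => g i m * (u i m * hh v i m)) r 0 n0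
        + TS (fun i m => g i m * (hh u i m * v i m)) r 0 n0) (TS (fun i m => w i m * y i m) (M+r) 0 n0 - TS (fun i m => shf M w i m * y i m) r 0 n0)
  have := norm_add_le (TS (fun i m => g i m * (u i m * hh v i m)) r 0 n0)
        (TS (fun i m => g i m * (hh u i m * v i m)) r 0 n0)
  have := norm_sub_le (TS (fun i m => w i m * y i m) (M+r) 0 n0) (TS (fun i m => shf M w i m * y i m) r 0 n0)
  linarith

end Work

section Work
open Classical

/-- families satisfying the wave packet recursion -/
def IsAmp (A : ℤ → ℕ → ℕ → ℂ) : Prop := ∀ k n l,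
  A k n (2*l) = (A (k-1) (2*n) l + A (k-1) (2*n+1) l)/2 ∧
  A k n (2*l+1) = (A (k-1) (2*n) l - A (k-1) (2*n+1) l)/2

def EE (A : ℤ → ℕ → ℕ → ℂ) (k : ℤ) (n l : ℕ) : ℝ := (2:ℝ)^k * ‖A k n l‖^2

lemma EE_nonneg (A : ℤ → ℕ → ℕ → ℂ) (k : ℤ) (n l : ℕ) : 0 ≤ EE A k n l := by
  unfold EE; positivity

def sib (l : ℕ) : ℕ := if l % 2 = 0 then l+1 else l-1

lemma sib_even (l : ℕ) : sib (2*l) = 2*l+1 := by simp [sib]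
lemma sib_odd (l : ℕ) : sib (2*l+1) = 2*l := by
  have : (2*l+1)%2 ≠ 0 := by omega
  simp [sib]

lemma EE_split2 {A : ℤ → ℕ → ℕ → ℂ} (hA : IsAmp A) (k : ℤ) (n l : ℕ) :
    EE A (k-1) (2*n) l + EE A (k-1) (2*n+1) l = EE A k n (2*l) + EE A k n (2*l+1) := by
  obtain ⟨h1, h2⟩ := hA k n l
  unfold EE
  rw [h1, h2, norm_div, norm_div, div_pow, div_pow]
  have := parallelogram_law_with_norm ℝ (A (k-1) (2*n) l) (A (k-1) (2*n+1) l)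
  have e : (2:ℝ)^k = 2 * 2^(k-1) := by rw [← zpow_one_add₀ two_ne_zero]; congr 1; ring
  rw [e]
  simp only [Complex.norm_ofNat]
  have h3 : ‖A (k-1) (2*n) l + A (k-1) (2*n+1) l‖^2 + ‖A (k-1) (2*n) l - A (k-1) (2*n+1) l‖^2
    = 2*(‖A (k-1) (2*n) l‖^2 + ‖A (k-1) (2*n+1) l‖^2) := by
    simp only [sq]; linarith
  linear_combination (-(2:ℝ)^(k-1)/2) * h3

lemma EE_split {A : ℤ → ℕ → ℕ → ℂ} (hA : IsAmp A) (k : ℤ) (n η : ℕ) :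
    EE A (k-1) (2*n) (η/2) + EE A (k-1) (2*n+1) (η/2) = EE A k n η + EE A k n (sib η) := by
  rw [EE_split2 hA]
  rcases Nat.even_or_odd' η with ⟨c, rfl | rfl⟩
  · rw [sib_even, show 2*c/2 = c by omega]
  · rw [sib_odd, show (2*c+1)/2 = c by omega]; ring

def ZZ (A : ℤ → ℕ → ℕ → ℂ) (bad : ℤ → ℕ → Prop) : ℕ → ℤ → ℕ → ℕ → ℝ
  | 0, k, n, η => EE A k n η
  | d+1, k, n, η => if bad k n then EE A k n η else
      ZZ A bad d (k-1) (2*n) (η/2) + ZZ A bad d (k-1) (2*n+1) (η/2)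

def DownC (bad : ℤ → ℕ → Prop) : Prop := ∀ k n, bad k n → bad (k-1) (2*n) ∧ bad (k-1) (2*n+1)

lemma DownC.desc {bad : ℤ → ℕ → Prop} (hb : DownC bad) {k : ℤ} {n : ℕ} (h : bad k n) (j m : ℕ)
    (hm : m / 2^j = n) : bad (k-j) m := by
  induction j generalizing m with
  | zero => simp at hm; subst hm; simpa using h
  | succ j ih =>
    have h1 : (m/2)/2^j = n := by
      rw [Nat.div_div_eq_div_mul, ← pow_succ']; exact hm
    have h2 := hb _ _ (ih _ h1)
    rw [show k - ((j+1:ℕ):ℤ) = k - j - 1 by push_cast; ring]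
    rcases Nat.even_or_odd' m with ⟨c, rfl | rfl⟩
    · rw [show 2*c/2 = c by omega] at h2; exact h2.1
    · rw [show (2*c+1)/2 = c by omega] at h2; exact h2.2

lemma ZZ_lower {A : ℤ → ℕ → ℕ → ℂ} (hA : IsAmp A) {bad : ℤ → ℕ → Prop} (hb : DownC bad)
    (d : ℕ) (k : ℤ) (n η : ℕ) :
    EE A k n η + ∑ j ∈ Finset.range d, bs j n (fun m => if bad (k-j) m then 0 else
      EE A (k-j) m (sib (η/2^j))) ≤ ZZ A bad d k n η := by
  induction d generalizing k n η with
  | zero => simp [ZZ]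
  | succ d ih =>
    rw [ZZ]
    split_ifs with h
    · rw [Finset.sum_eq_zero]
      · simp
      · intro j _
        rw [bs_congr (G := fun _ => 0), bs_fzero]
        intro m hm
        rw [if_pos (hb.desc h j m hm)]
    · have h1 := ih (k-1) (2*n) (η/2)
      have h2 := ih (k-1) (2*n+1) (η/2)
      have h3 := EE_split hA k n η
      rw [Finset.sum_range_succ']
      simp only [bs_zero, Nat.cast_zero, sub_zero, pow_zero, Nat.div_one, if_neg h, bs_succ,
        Finset.sum_add_distrib]
      have e : ∀ j : ℕ, k - ((j+1:ℕ):ℤ) = k - 1 - j := fun j => by push_cast; ring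
      have e2 : ∀ j : ℕ, η/2^(j+1) = η/2/2^j := fun j => by
        rw [Nat.div_div_eq_div_mul, ← pow_succ']
      simp only [e, e2]
      linarith

lemma EE_le_bs {A : ℤ → ℕ → ℕ → ℂ} (hA : IsAmp A) (d : ℕ) (k : ℤ) (n η : ℕ) :
    EE A k n η ≤ bs d n (fun m => EE A (k-d) m (η/2^d)) := by
  induction d generalizing k n η with
  | zero => simp [bs_zero]
  | succ d ih =>
    have h1 := ih (k-1) (2*n) (η/2)
    have h2 := ih (k-1) (2*n+1) (η/2)
    have h3 := EE_split hA k n η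
    have h4 := EE_nonneg A k n (sib η)
    rw [bs_succ, show k - ((d+1:ℕ):ℤ) = k - 1 - d by push_cast; ring,
      show η/2^(d+1) = η/2/2^d by rw [Nat.div_div_eq_div_mul, ← pow_succ']]
    linarith

lemma ZZ_upper {A : ℤ → ℕ → ℕ → ℂ} (hA : IsAmp A) (bad : ℤ → ℕ → Prop) (d : ℕ) (k : ℤ) (n η : ℕ) :
    ZZ A bad d k n η ≤ bs d n (fun m => EE A (k-d) m (η/2^d)) := by
  induction d generalizing k n η with
  | zero => simp [bs_zero, ZZ]
  | succ d ih =>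
    rw [ZZ]
    split_ifs
    · exact EE_le_bs hA _ _ _ _
    · have h1 := ih (k-1) (2*n) (η/2)
      have h2 := ih (k-1) (2*n+1) (η/2)
      rw [bs_succ, show k - ((d+1:ℕ):ℤ) = k - 1 - d by push_cast; ring,
        show η/2^(d+1) = η/2/2^d by rw [Nat.div_div_eq_div_mul, ← pow_succ']]
      linarith

lemma ZZ_upper' {A : ℤ → ℕ → ℕ → ℂ} (hA : IsAmp A) (bad : ℤ → ℕ → Prop) (L : ℕ) (k : ℤ) (n η l : ℕ)
    (hl : η / 2^(L+1) = l) :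
    ZZ A bad (L+1) k n η ≤ bs L n (fun m => EE A (k-L) m (2*l)) + bs L n (fun m => EE A (k-L) m (2*l+1)) := by
  refine (ZZ_upper hA bad (L+1) k n η).trans (le_of_eq ?_)
  rw [bs_add, ← bs_fadd, hl]
  congr 1
  funext j
  rw [← EE_split2 hA, bs_succ, bs_zero, bs_zero, show k - ((L+1:ℕ):ℤ) = k - L - 1 by push_cast; ring]

lemma ZZ_init {A : ℤ → ℕ → ℕ → ℂ} {bad : ℤ → ℕ → Prop} {ρ : ℤ → ℕ → ℝ} {lam : ℝ}
    (h0 : ∀ k n, 0 ≤ ρ k n) (hρ : ∀ k n, ρ k n = (ρ (k-1) (2*n) + ρ (k-1) (2*n+1))/2)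
    (hA : ∀ k n l, ‖A k n l‖ ≤ ρ k n) (hb : ∀ k n, ¬ bad k n → ρ k n ≤ lam)
    (d : ℕ) (k : ℤ) (n η : ℕ) (h : ρ k n ≤ 2*lam) :
    ZZ A bad d k n η ≤ 2*lam*(2^k * ρ k n) := by
  have base : ∀ (k : ℤ) n η, ρ k n ≤ 2*lam → EE A k n η ≤ 2*lam*(2^k * ρ k n) := by
    intro k n η h
    unfold EE
    have h1 : ‖A k n η‖^2 ≤ ρ k n^2 := pow_le_pow_left₀ (norm_nonneg _) (hA k n η) 2
    have h2 : ρ k n^2 ≤ 2*lam*ρ k n := by rw [sq]; exact mul_le_mul_of_nonneg_right h (h0 k n)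
    have h3 : (0:ℝ) < 2^k := by positivity
    nlinarith
  induction d generalizing k n η with
  | zero => exact base k n η h
  | succ d ih =>
    rw [ZZ]
    split_ifs with hbd
    · exact base k n η h
    · have h1 := hb k n hbd
      have h2 := hρ k n
      have h3 := h0 (k-1) (2*n)
      have h4 := h0 (k-1) (2*n+1)
      have i1 := ih (k-1) (2*n) (η/2) (by linarith)
      have i2 := ih (k-1) (2*n+1) (η/2) (by linarith)
      have e : (2:ℝ)^k = 2 * 2^(k-1) := by rw [← zpow_one_add₀ two_ne_zero]; congr 1; ring
      refine (add_le_add i1 i2).trans (le_of_eq ?_)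
      rw [h2, e]; ring

/-! ### order on bitiles -/

def nd (t : Bitile) (i m : ℕ) : Bitile := ⟨t.k - i, m, t.l/2^i⟩

def ble (P t : Bitile) : Prop := ∃ i : ℕ, P = nd t i P.n ∧ P.n/2^i = t.n

def ltb (b : ℕ) (P t : Bitile) : Prop :=
  ∃ j : ℕ, P = nd t (j+1) P.n ∧ P.n/2^(j+1) = t.n ∧ (t.l/2^j) % 2 = b

lemma ble_refl (t : Bitile) : ble t t := ⟨0, by simp [nd], by simp⟩

lemma nd_nd (t : Bitile) (i j m m' : ℕ) : nd (nd t i m) j m' = nd t (i+j) m' := by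
  simp only [nd, Bitile.mk.injEq, true_and]
  exact ⟨by push_cast; ring, by rw [Nat.div_div_eq_div_mul, ← pow_add]⟩

lemma ble_trans {P Q R : Bitile} (h1 : ble P Q) (h2 : ble Q R) : ble P R := by
  obtain ⟨i, h1, h1'⟩ := h1
  obtain ⟨j, h2, h2'⟩ := h2
  refine ⟨j+i, ?_, ?_⟩
  · rw [← nd_nd R j i Q.n, ← h2]; exact h1
  · rw [add_comm, pow_add, ← Nat.div_div_eq_div_mul, h1', h2']

lemma ltb.ble {b : ℕ} {P t : Bitile} (h : ltb b P t) : ble P t := by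
  obtain ⟨j, h1, h2, _⟩ := h; exact ⟨j+1, h1, h2⟩

lemma nd_ble (t : Bitile) {i m : ℕ} (h : m/2^i = t.n) : ble (nd t i m) t := ⟨i, rfl, h⟩

lemma nd_inj {t : Bitile} {i m i' m' : ℕ} (h : nd t i m = nd t i' m') : i = i' ∧ m = m' := by
  simp only [nd, Bitile.mk.injEq] at h; exact ⟨by omega, h.2.1⟩

lemma nd_k (t : Bitile) (i m : ℕ) : (nd t i m).k = t.k - i := rfl
lemma nd_n (t : Bitile) (i m : ℕ) : (nd t i m).n = m := rfl
lemma nd_l (t : Bitile) (i m : ℕ) : (nd t i m).l = t.l/2^i := rfl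

lemma ltb_nd {t : Bitile} {j m b : ℕ} (hm : m/2^(j+1) = t.n) :
    ltb b (nd t (j+1) m) t ↔ (t.l/2^j) % 2 = b := by
  constructor
  · rintro ⟨j', h1, _, h3⟩
    have := (nd_inj h1).1
    rw [show j = j' by omega]; exact h3
  · intro h; exact ⟨j, rfl, hm, h⟩

lemma not_ltb_self (t : Bitile) (b : ℕ) : ¬ ltb b t t := by
  rintro ⟨j, h, _⟩
  have := congrArg Bitile.k h
  rw [nd_k] at this; push_cast at this; omega

lemma tree_sum {M : Type*} [AddCommMonoid M] (PP : Finset Bitile) (t : Bitile) (X : Bitile → M) :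
    ∃ D0, ∀ D ≥ D0, ∑ P ∈ PP.filter (fun P => ble P t), X P =
      ∑ i ∈ Finset.range D, bs i t.n (fun m => if nd t i m ∈ PP then X (nd t i m) else 0) := by
  refine ⟨PP.sup (fun P => (t.k - P.k).toNat + 1), fun D hD => ?_⟩
  simp only [bs_eq_sum]
  rw [Finset.sum_sigma', ← Finset.sum_filter]
  symm
  refine Finset.sum_bij (fun x _ => nd t x.1 x.2) ?_ ?_ ?_ ?_
  · rintro ⟨i, m⟩ h
    simp only [Finset.mem_filter, Finset.mem_sigma, mem_block] at h ⊢
    exact ⟨h.2, nd_ble t h.1.2⟩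
  · rintro ⟨i, m⟩ _ ⟨i', m'⟩ _ h
    obtain ⟨rfl, rfl⟩ := nd_inj h; rfl
  · intro P hP
    simp only [Finset.mem_filter] at hP
    obtain ⟨i, h1, h2⟩ := hP.2
    refine ⟨⟨i, P.n⟩, ?_, h1.symm⟩
    simp only [Finset.mem_filter, Finset.mem_sigma, mem_block, Finset.mem_range]
    refine ⟨⟨?_, h2⟩, h1 ▸ hP.1⟩
    have h3 := Finset.le_sup (f := fun P : Bitile => (t.k - P.k).toNat + 1) hP.1
    have h4 := congrArg Bitile.k h1
    rw [nd_k] at h4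
    omega
  · intro x _; rfl

lemma tree_sum_le (PP : Finset Bitile) (t : Bitile) (X : Bitile → ℝ) (hX : ∀ P, 0 ≤ X P) (D : ℕ) :
    ∑ i ∈ Finset.range D, bs i t.n (fun m => if nd t i m ∈ PP then X (nd t i m) else 0) ≤
    ∑ P ∈ PP.filter (fun P => ble P t), X P := by
  obtain ⟨D0, h⟩ := tree_sum PP t X
  rw [h (max D D0) (le_max_right _ _)]
  refine Finset.sum_le_sum_of_subset_of_nonneg (Finset.range_mono (le_max_left _ _)) fun i _ _ => ?_
  refine bs_nonneg fun j => ?_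
  split_ifs; exact hX _; exact le_rfl

lemma sum_ble {M : Type*} [AddCommMonoid M] {PP : Finset Bitile} {t : Bitile} (ht : t ∈ PP)
    (X : Bitile → M) : ∑ P ∈ PP.filter (fun P => ble P t), X P =
      X t + ∑ P ∈ PP.filter (fun P => ltb 0 P t), X P + ∑ P ∈ PP.filter (fun P => ltb 1 P t), X P := by
  have e : PP.filter (fun P => ble P t) =
      insert t (PP.filter (fun P => ltb 0 P t) ∪ PP.filter (fun P => ltb 1 P t)) := by
    ext P
    simp only [Finset.mem_filter, Finset.mem_insert, Finset.mem_union]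
    constructor
    · rintro ⟨h1, i, h2, h3⟩
      rcases i with _ | j
      · left; rw [h2]; simp at h3; simp [nd, h3]
      · right
        rcases Nat.mod_two_eq_zero_or_one (t.l/2^j) with h | h
        · left; exact ⟨h1, j, h2, h3, h⟩
        · right; exact ⟨h1, j, h2, h3, h⟩
    · rintro (rfl | ⟨h1, h2⟩ | ⟨h1, h2⟩)
      · exact ⟨ht, ble_refl _⟩
      · exact ⟨h1, h2.ble⟩
      · exact ⟨h1, h2.ble⟩
  rw [e, Finset.sum_insert, Finset.sum_union, add_assoc]
  · rw [Finset.disjoint_left]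
    intro P h1 h2
    simp only [Finset.mem_filter] at h1 h2
    obtain ⟨j, a1, a2, a3⟩ := h1.2
    obtain ⟨j', b1, b2, b3⟩ := h2.2
    have := (nd_inj (a1.symm.trans b1)).1
    rw [show j' = j by omega] at b3; omega
  · simp only [Finset.mem_union, Finset.mem_filter]
    rintro (h | h) <;> exact not_ltb_self _ _ h.2

def en (A : ℤ → ℕ → ℕ → ℂ) (L : ℕ) (bad : ℤ → ℕ → Prop) (b : ℕ) (P : Bitile) : ℝ :=
  bs L P.n (fun m => if bad (P.k-L) m then 0 else EE A (P.k-L) m (2*P.l+b))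

lemma en_nonneg (A : ℤ → ℕ → ℕ → ℂ) (L : ℕ) (bad : ℤ → ℕ → Prop) (b : ℕ) (P : Bitile) :
    0 ≤ en A L bad b P := by
  refine bs_nonneg fun j => ?_
  split_ifs; exact le_rfl; exact EE_nonneg _ _ _ _

def SizeLE (A : ℤ → ℕ → ℕ → ℂ) (L : ℕ) (bad : ℤ → ℕ → Prop) (PP : Finset Bitile) (s : ℝ) : Prop :=
  (∀ P ∈ PP, ∀ η, η/2^(L+1) = P.l → ZZ A bad (L+1) P.k P.n η ≤ s^2 * 2^P.k) ∧
  (∀ t ∈ PP, ∀ b < 2, ∑ P ∈ PP.filter (fun P => ltb b P t), en A L bad (1-b) P ≤ s^2 * 2^t.k)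

lemma SizeLE.mono {A : ℤ → ℕ → ℕ → ℂ} {L : ℕ} {bad : ℤ → ℕ → Prop} {PP QQ : Finset Bitile} {s : ℝ}
    (h : SizeLE A L bad PP s) (hQ : QQ ⊆ PP) : SizeLE A L bad QQ s := by
  refine ⟨fun P hP => h.1 P (hQ hP), fun t ht b hb => le_trans ?_ (h.2 t (hQ ht) b hb)⟩
  exact Finset.sum_le_sum_of_subset_of_nonneg (Finset.filter_subset_filter _ hQ)
    fun P _ _ => en_nonneg _ _ _ _ _

lemma SizeLE.en_le {A : ℤ → ℕ → ℕ → ℂ} (hA : IsAmp A) {L : ℕ} {bad : ℤ → ℕ → Prop} (hb : DownC bad)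
    {PP : Finset Bitile} {s : ℝ}
    (h : SizeLE A L bad PP s) {P : Bitile} (hP : P ∈ PP) {b : ℕ} (hb2 : b < 2) :
    en A L bad b P ≤ s^2 * 2^P.k := by
  have hη : ∀ c < 2, ((2*P.l+c)*2^L)/2^L = 2*P.l+c := fun c _ => Nat.mul_div_cancel _ (by positivity)
  have h1 := h.1 P hP ((2*P.l+(1-b))*2^L) (by
    rw [pow_succ, ← Nat.div_div_eq_div_mul, hη _ (by omega)]; omega)
  refine le_trans ?_ h1
  refine le_trans ?_ (ZZ_lower hA hb (L+1) P.k P.n _)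
  rw [Finset.sum_range_succ, hη _ (by omega)]
  have e : sib (2*P.l+(1-b)) = 2*P.l+b := by
    interval_cases b
    · exact sib_odd _
    · exact sib_even _
  rw [e]
  have h2 := EE_nonneg A P.k P.n ((2*P.l+(1-b))*2^L)
  have h3 : 0 ≤ ∑ j ∈ Finset.range L, bs j P.n (fun m => if bad (P.k-j) m then 0 else
      EE A (P.k-j) m (sib (((2*P.l+(1-b))*2^L)/2^j))) := Finset.sum_nonneg fun j _ =>
      bs_nonneg fun m => by split_ifs; exact le_rfl; exact EE_nonneg _ _ _ _
  unfold en; linarith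

lemma SizeLE.mass {A : ℤ → ℕ → ℕ → ℂ} (hA : IsAmp A) {L : ℕ} {bad : ℤ → ℕ → Prop} (hb : DownC bad)
    {PP : Finset Bitile} {s : ℝ} (h : SizeLE A L bad PP s) {t : Bitile} (ht : t ∈ PP) {η : ℕ}
    (hη : η/2^(L+1) = t.l) (S : ℕ → ℕ → Prop)
    (hS : ∀ j m, m/2^j = t.n → S j m → ¬ bad (t.k-j) m ∧ (L < j → nd t (j-L) (m/2^L) ∈ PP)) (d : ℕ) :
    ∑ j ∈ Finset.range d, bs j t.n (fun m => if S j m then EE A (t.k-j) m (sib (η/2^j)) else 0)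
      ≤ 3 * s^2 * 2^t.k := by
  set G : ℕ → ℕ → ℝ := fun j m => if S j m then EE A (t.k-j) m (sib (η/2^j)) else 0 with hG
  have hG0 : ∀ j m, 0 ≤ G j m := fun j m => by
    simp only [hG]; split_ifs; exact EE_nonneg _ _ _ _; exact le_rfl
  have h1 : ∑ j ∈ Finset.range d, bs j t.n (G j) ≤ ∑ j ∈ Finset.range ((L+1)+d), bs j t.n (G j) :=
    Finset.sum_le_sum_of_subset_of_nonneg (Finset.range_mono (by omega)) fun j _ _ => bs_nonneg (hG0 j)
  refine h1.trans ?_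
  rw [Finset.sum_range_add]
  have p1 : ∑ j ∈ Finset.range (L+1), bs j t.n (G j) ≤ s^2 * 2^t.k := by
    refine le_trans ?_ (h.1 t ht η hη)
    have := ZZ_lower hA hb (L+1) t.k t.n η
    have h2 := EE_nonneg A t.k t.n η
    refine le_trans (Finset.sum_le_sum fun j _ => ?_) (by linarith)
    refine bs_mono fun m hm => ?_
    simp only [hG]
    split_ifs with a1 a2 a2
    · exact absurd a2 (hS j m hm a1).1
    · exact le_rfl
    · exact le_rfl
    · exact EE_nonneg _ _ _ _
  set Y : Bitile → ℝ := fun P => (if ltb 0 P t then en A L bad 1 P else 0) +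
    (if ltb 1 P t then en A L bad 0 P else 0) with hY
  have hY0 : ∀ P, 0 ≤ Y P := fun P => by
    simp only [hY]
    have := en_nonneg A L bad 1 P
    have := en_nonneg A L bad 0 P
    split_ifs <;> linarith
  have p2 : ∑ j ∈ Finset.range d, bs (L+1+j) t.n (G (L+1+j)) ≤ 2 * s^2 * 2^t.k := by
    have q1 : ∑ j ∈ Finset.range d, bs (L+1+j) t.n (G (L+1+j)) ≤ ∑ j ∈ Finset.range d,
        bs (j+1) t.n (fun m => if nd t (j+1) m ∈ PP then Y (nd t (j+1) m) else 0) := by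
      refine Finset.sum_le_sum fun j _ => ?_
      rw [show L+1+j = (j+1)+L by ring, bs_add]
      refine bs_mono fun m hm => ?_
      have hη2 : η/2^(j+1+L) = 2*(t.l/2^(j+1)) + (t.l/2^j)%2 := by
        rw [show j+1+L = (L+1)+j by ring, pow_add, ← Nat.div_div_eq_div_mul, hη, pow_succ,
          ← Nat.div_div_eq_div_mul]; omega
      split_ifs with hmem
      · have key : ∀ c < 2, (t.l/2^j)%2 = c → bs L m (G (j+1+L)) ≤ en A L bad (1-c) (nd t (j+1) m) := by
          intro c hc hcc
          refine bs_mono fun m' hm' => ?_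
          have e1 : (nd t (j+1) m).k - (L:ℤ) = t.k - ((j+1+L:ℕ):ℤ) := by rw [nd_k]; push_cast; ring
          have e2 : sib (η/2^(j+1+L)) = 2*(nd t (j+1) m).l + (1-c) := by
            rw [hη2, hcc, nd_l]
            interval_cases c
            · exact sib_even _
            · exact sib_odd _
          simp only [hG]
          rw [e1, e2]
          split_ifs with a1 a2 a2
          · exact absurd a2 (hS _ _ (by rw [add_comm, pow_add, ← Nat.div_div_eq_div_mul, hm', hm]) a1).1
          · exact le_rfl
          · exact le_rfl
          · exact EE_nonneg _ _ _ _
        have e0 := en_nonneg A L bad 0 (nd t (j+1) m)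
        have e1 := en_nonneg A L bad 1 (nd t (j+1) m)
        simp only [hY, ltb_nd hm]
        rcases Nat.mod_two_eq_zero_or_one (t.l/2^j) with c | c
        · have := key 0 two_pos c
          simp only [c]; simpa using this
        · have := key 1 one_lt_two c
          simp only [c]; simpa using this
      · rw [bs_congr (G := fun _ => 0), bs_fzero]
        intro m' hm'
        simp only [hG]
        rw [if_neg]
        intro hs
        have := (hS _ _ (by rw [add_comm, pow_add, ← Nat.div_div_eq_div_mul, hm', hm]) hs).2 (by omega)
        rw [show j+1+L-L = j+1 by omega, hm'] at this
        exact hmem this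
    have q2 : ∑ j ∈ Finset.range d,
        bs (j+1) t.n (fun m => if nd t (j+1) m ∈ PP then Y (nd t (j+1) m) else 0) ≤
        ∑ i ∈ Finset.range (d+1), bs i t.n (fun m => if nd t i m ∈ PP then Y (nd t i m) else 0) := by
      rw [Finset.sum_range_succ' _ d]
      have : 0 ≤ bs 0 t.n (fun m => if nd t 0 m ∈ PP then Y (nd t 0 m) else 0) :=
        bs_nonneg fun m => by split_ifs; exact hY0 _; exact le_rfl
      linarith
    have q3 := tree_sum_le PP t Y hY0 (d+1)
    rw [sum_ble ht] at q3
    have z0 : Y t = 0 := by simp [hY, not_ltb_self]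
    have dis : ∀ P, ltb 0 P t → ltb 1 P t → False := by
      rintro P ⟨j, a1, a2, a3⟩ ⟨j', b1, b2, b3⟩
      have := (nd_inj (a1.symm.trans b1)).1
      rw [show j' = j by omega] at b3; omega
    have z1 : ∑ P ∈ PP.filter (fun P => ltb 0 P t), Y P ≤ s^2*2^t.k := by
      refine le_trans (le_of_eq ?_) (h.2 t ht 0 two_pos)
      refine Finset.sum_congr rfl fun P hP => ?_
      have hP := (Finset.mem_filter.1 hP).2
      simp only [hY, if_pos hP]
      rw [if_neg (fun h' => dis P hP h')]; simp
    have z2 : ∑ P ∈ PP.filter (fun P => ltb 1 P t), Y P ≤ s^2*2^t.k := by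
      refine le_trans (le_of_eq ?_) (h.2 t ht 1 one_lt_two)
      refine Finset.sum_congr rfl fun P hP => ?_
      have hP := (Finset.mem_filter.1 hP).2
      simp only [hY, if_pos hP]
      rw [if_neg (fun h' => dis P h' hP)]; simp
    linarith
  linarith

end Work

section Work
open Classical

def Conv (PP : Finset Bitile) : Prop := ∀ P Q R, P ∈ PP → R ∈ PP → ble P Q → ble Q R → Q ∈ PP

/-- the integrated quartile term, with `L = M+1` -/
def Lam (A1 A2 A3 : ℤ → ℕ → ℕ → ℂ) (M : ℕ) (P : Bitile) : ℂ :=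
  A1 P.k P.n (2*P.l+1) * ((2:ℂ)^(P.k - (M+1)) *
    (bs M (2*P.n) (fun m => A2 (P.k-(M+1:ℕ)) m (2*P.l) * A3 (P.k-(M+1:ℕ)) m (2*P.l))
     - bs M (2*P.n+1) (fun m => A2 (P.k-(M+1:ℕ)) m (2*P.l) * A3 (P.k-(M+1:ℕ)) m (2*P.l))))

def sg (η : ℕ) : ℕ → ℕ → ℂ
  | 0, _ => 1
  | i+1, m => sg η i (m/2) * (if m % 2 = 1 ∧ (η/2^i) % 2 = 1 then -1 else 1)

lemma sg_sq (η i m : ℕ) : sg η i m * sg η i m = 1 := by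
  induction i generalizing m with
  | zero => simp [sg]
  | succ i ih =>
    rw [sg, mul_mul_mul_comm, ih]; split_ifs <;> simp

lemma sg_norm (η i m : ℕ) : ‖sg η i m‖ = 1 := by
  have := congrArg norm (sg_sq η i m)
  rw [norm_mul, norm_one] at this
  nlinarith [norm_nonneg (sg η i m)]

/-- demodulated martingale -/
def dm (A : ℤ → ℕ → ℕ → ℂ) (k : ℤ) (η i m : ℕ) : ℂ := sg η i m * A (k-i) m (η/2^i)

lemma dm_step {A : ℤ → ℕ → ℕ → ℂ} (hA : IsAmp A) (k : ℤ) (η i m : ℕ) :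
    dm A k η i m = (dm A k η (i+1) (2*m) + dm A k η (i+1) (2*m+1))/2 ∧
    hh (dm A k η) i m = sg η i m * A (k-i) m (sib (η/2^i)) := by
  unfold hh dm
  have e0 : (2*m)%2 ≠ 1 := by omega
  have e1 : (2*m+1)%2 = 1 := by omega
  have e2 : 2*m/2 = m := by omega
  have e3 : (2*m+1)/2 = m := by omega
  have e4 : η/2^(i+1) = η/2^i/2 := by rw [pow_succ, Nat.div_div_eq_div_mul]
  have e5 : k - ((i+1:ℕ):ℤ) = k - i - 1 := by push_cast; ring
  simp only [sg, e0, e1, e2, e3, e4, e5, false_and, if_false, true_and, mul_one]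
  rcases Nat.even_or_odd' (η/2^i) with ⟨c, hc | hc⟩
  · rw [hc, sib_even, show 2*c/2 = c by omega, (hA _ _ _).1, (hA _ _ _).2]
    have : 2*c%2 ≠ 1 := by omega
    simp only [this, if_false]
    constructor <;> ring
  · rw [hc, sib_odd, show (2*c+1)/2 = c by omega, (hA _ _ _).1, (hA _ _ _).2]
    have : (2*c+1)%2 = 1 := by omega
    simp only [this, if_true]
    constructor <;> ring

lemma SizeLE.amp_le {A : ℤ → ℕ → ℕ → ℂ} (hA : IsAmp A) {L : ℕ} {bad : ℤ → ℕ → Prop} (hb : DownC bad)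
    {PP : Finset Bitile} {s : ℝ} (hs : 0 < s)
    (h : SizeLE A L bad PP s) {P : Bitile} (hP : P ∈ PP) {η : ℕ} (hη : η/2^(L+1) = P.l) :
    ‖A P.k P.n η‖ ≤ s := by
  have h1 := h.1 P hP η hη
  have h2 := ZZ_lower hA hb (L+1) P.k P.n η
  have h3 : 0 ≤ ∑ j ∈ Finset.range (L+1), bs j P.n (fun m => if bad (P.k-j) m then 0 else
      EE A (P.k-j) m (sib (η/2^j))) := Finset.sum_nonneg fun j _ =>
      bs_nonneg fun m => by split_ifs; exact le_rfl; exact EE_nonneg _ _ _ _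
  have h4 : EE A P.k P.n η ≤ s^2*2^P.k := by linarith
  unfold EE at h4
  have h5 : (0:ℝ) < 2^P.k := by positivity
  have h6 : ‖A P.k P.n η‖^2 ≤ s^2 := by
    rw [mul_comm] at h4; exact le_of_mul_le_mul_right h4 h5
  exact (abs_le_of_sq_le_sq' h6 hs.le).2

lemma downC_false : DownC (fun _ _ => False) := fun _ _ h => h.elim

lemma Lam_bound {A1 A2 A3 : ℤ → ℕ → ℕ → ℂ} (M : ℕ) (P : Bitile) {bad : ℤ → ℕ → Prop}
    (hz : ∀ k n l, bad k n → A2 k n l = 0) {s1 s2 s3 : ℝ}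
    (p1 : 0 < s1) (p2 : 0 < s2) (p3 : 0 < s3) (h1 : ‖A1 P.k P.n (2*P.l+1)‖ ≤ s1) :
    ‖Lam A1 A2 A3 M P‖ ≤ s1 * ((s3/s2 * en A2 (M+1) (fun _ _ => False) 0 P
      + s2/s3 * en A3 (M+1) bad 0 P)/2) := by
  unfold Lam
  rw [norm_mul]
  refine mul_le_mul h1 ?_ (norm_nonneg _) p1.le
  rw [norm_mul, norm_zpow, Complex.norm_ofNat]
  set F := fun m => A2 (P.k-(M+1:ℕ)) m (2*P.l) * A3 (P.k-(M+1:ℕ)) m (2*P.l) with hF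
  have e1 : ‖bs M (2*P.n) F - bs M (2*P.n+1) F‖ ≤ bs (M+1) P.n (fun m => ‖F m‖) := by
    rw [bs_succ]
    exact (norm_sub_le _ _).trans (add_le_add (bs_norm _) (bs_norm _))
  refine (mul_le_mul_of_nonneg_left e1 (by positivity)).trans ?_
  unfold en
  rw [← bs_mul, ← bs_mul, ← bs_mul, ← bs_fadd, div_eq_inv_mul, ← bs_mul]
  refine bs_mono fun m _ => ?_
  simp only [hF, if_false]
  by_cases hb : bad (P.k-(M+1:ℕ)) m
  · rw [hz _ _ _ hb]
    simp only [zero_mul, norm_zero, mul_zero]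
    have := EE_nonneg A2 (P.k-(M+1:ℕ)) m (2*P.l+0)
    rw [if_pos hb]; positivity
  · rw [if_neg hb, norm_mul]
    unfold EE
    have := amgm (x := ‖A2 (P.k-(M+1:ℕ)) m (2*P.l)‖) (y := ‖A3 (P.k-(M+1:ℕ)) m (2*P.l)‖) p2 p3
    have h2 : (0:ℝ) < 2^(P.k-(M+1:ℤ)) := by positivity
    push_cast at this ⊢
    rw [add_zero]
    calc _ ≤ _ := mul_le_mul_of_nonneg_left this h2.le
      _ = _ := by ring

theorem tree_estimate {A1 A2 A3 : ℤ → ℕ → ℕ → ℂ} (hA1 : IsAmp A1) (hA2 : IsAmp A2) (hA3 : IsAmp A3)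
    {M : ℕ} {bad : ℤ → ℕ → Prop} (hbad : DownC bad) (hz : ∀ k n l, bad k n → A2 k n l = 0)
    {PP : Finset Bitile} (hc : Conv PP) (hnb : ∀ P ∈ PP, ¬ bad P.k P.n)
    {s1 s2 s3 : ℝ} (p1 : 0 < s1) (p2 : 0 < s2) (p3 : 0 < s3)
    (S1 : SizeLE A1 0 (fun _ _ => False) PP s1) (S2 : SizeLE A2 (M+1) (fun _ _ => False) PP s2)
    (S3 : SizeLE A3 (M+1) bad PP s3) {t : Bitile} (ht : t ∈ PP) :
    ‖∑ P ∈ PP.filter (fun P => ble P t), Lam A1 A2 A3 M P‖ ≤ 34 * (s1*s2*s3) * 2^t.k := by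
  have pk : (0:ℝ) < 2^t.k := by positivity
  have a1 : ∀ P ∈ PP, ‖A1 P.k P.n (2*P.l+1)‖ ≤ s1 := fun P hP =>
    S1.amp_le hA1 downC_false p1 hP (by omega)
  have LB := fun P hP => Lam_bound (A1 := A1) (A2 := A2) (A3 := A3) M P (bad := bad) hz p1 p2 p3 (a1 P hP)
  have arith : s1 * ((s3/s2 * (s2^2 * 2^t.k) + s2/s3 * (s3^2*2^t.k))/2) = s1*s2*s3*2^t.k := by
    field_simp; ring
  -- top
  have top : ‖Lam A1 A2 A3 M t‖ ≤ s1*s2*s3*2^t.k := by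
    refine (LB t ht).trans ?_
    rw [← arith]
    have b2 := S2.en_le hA2 downC_false ht two_pos
    have b3 := S3.en_le hA3 hbad ht two_pos
    gcongr
  -- upper tree
  have upp : ‖∑ P ∈ PP.filter (fun P => ltb 1 P t), Lam A1 A2 A3 M P‖ ≤ s1*s2*s3*2^t.k := by
    refine (norm_sum_le _ _).trans ?_
    refine (Finset.sum_le_sum fun P hP => LB P (Finset.mem_filter.1 hP).1).trans ?_
    rw [← Finset.mul_sum, ← Finset.sum_div, Finset.sum_add_distrib, ← Finset.mul_sum, ← Finset.mul_sum,
      ← arith]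
    have b2 := S2.2 t ht 1 one_lt_two
    have b3 := S3.2 t ht 1 one_lt_two
    simp only [Nat.sub_self] at b2 b3
    gcongr
  -- lower tree
  have low : ‖∑ P ∈ PP.filter (fun P => ltb 0 P t), Lam A1 A2 A3 M P‖ ≤ 32*(s1*s2*s3)*2^t.k := by
    set L := M+1 with hL
    set η := 2^(L+1) * t.l with hη
    have hη1 : ∀ i, η/2^i/2^(L+1) = t.l/2^i := by
      intro i
      rw [Nat.div_div_eq_div_mul, mul_comm, ← Nat.div_div_eq_div_mul, hη,
        Nat.mul_div_cancel_left _ (by positivity)]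
    have hη2 : ∀ i, η/2^(i+1+L) = t.l/2^i := by
      intro i
      rw [show i+1+L = i + (L+1) by ring, pow_add, ← Nat.div_div_eq_div_mul, hη1]
    set T : ℕ → ℕ → Prop := fun i m => nd t i m ∈ PP ∧ m/2^i = t.n with hTd
    obtain ⟨S, hSd⟩ : ∃ S : ℕ → ℕ → Prop, ∀ i m, S i m ↔
        (¬ bad (t.k-i) m ∧ ∃ e, e < L ∧ e ≤ i ∧ T (i-e) (m/2^e)) := ⟨_, fun _ _ => Iff.rfl⟩
    set g : ℕ → ℕ → ℂ := fun i m => if T i m ∧ 1 ≤ i ∧ (t.l/2^(i-1))%2 = 0 then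
      A1 (t.k-i) m (2*(t.l/2^i)+1) else 0 with hgd
    obtain ⟨D0, hD0⟩ := tree_sum PP t (fun P => if ltb 0 P t then Lam A1 A2 A3 M P else 0)
    -- up-closure
    have hup : ∀ i j m, T (i+j) m → T i (m/2^j) := by
      intro i j m h
      refine ⟨?_, by rw [Nat.div_div_eq_div_mul, ← pow_add, add_comm j i]; exact h.2⟩
      refine hc _ _ _ h.1 ht ?_ (nd_ble t (by rw [Nat.div_div_eq_div_mul, ← pow_add, add_comm j i]; exact h.2))
      refine ⟨j, ?_, rfl⟩
      rw [nd_n, nd_nd]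
    have hT : ∀ i m, T (i+1) m → T i (m/2) := fun i m h => by
      simpa using hup i 1 m h
    have hT0 : T 0 t.n := ⟨by simpa [nd] using ht, by simp⟩
    have nr0 : ∃ r0, ∀ i m, r0 ≤ i → ¬ T i m := by
      refine ⟨PP.sup (fun P => (t.k - P.k).toNat + 1), fun i m hi h => ?_⟩
      have h3 := Finset.le_sup (f := fun P : Bitile => (t.k - P.k).toNat + 1) h.1
      rw [nd_k] at h3
      omega
    obtain ⟨r0, hr0⟩ := nr0
    set r := max r0 D0 with hr
    have gT : ∀ i m, ¬ T i m → g i m = 0 := fun i m h => by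
      simp only [hgd]; rw [if_neg]; exact fun h' => h h'.1
    have mem_of : ∀ i m, T i m → nd t i m ∈ PP := fun i m h => h.1
    have massT : ∀ {A : ℤ → ℕ → ℕ → ℂ} (hA : IsAmp A) {bd : ℤ → ℕ → Prop} (hbd : DownC bd)
        (himp : ∀ k n, bd k n → bad k n) {s : ℝ} (hs : SizeLE A L bd PP s) (d i m : ℕ), T i m →
        TS (fun i m => if S i m then ‖hh (dm A t.k η) i m‖^2 else 0) d i m ≤ 3*s^2 := by
      intro A hA bd hbd himp s hs d i m h
      have key := hs.mass hA hbd (mem_of i m h) (η := η/2^i) (by rw [hη1, nd_l])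
        (fun j m' => S (i+j) m') (by
          intro j m' hm' hS'
          rw [nd_n] at hm'
          rw [nd_k]
          obtain ⟨h1, e, he, hei, h2⟩ := (hSd _ _).1 hS'
          refine ⟨fun hb => h1 ?_, fun hLj => ?_⟩
          · have := himp _ _ hb
            rwa [show t.k - (i:ℤ) - j = t.k - ((i+j:ℕ):ℤ) by push_cast; ring] at this
          · rw [nd_nd]
            have : T (i+(j-L)) ((m'/2^e)/2^(L-e)) := by
              apply hup
              rw [show i + (j-L) + (L-e) = i+j-e by omega]; exact h2
            rw [Nat.div_div_eq_div_mul, ← pow_add, show e + (L-e) = L by omega] at this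
            exact this.1) d
      rw [nd_k, nd_n] at key
      have pk2 : (0:ℝ) < 2^(t.k-(i:ℤ)) := by positivity
      refine le_of_mul_le_mul_left ?_ pk2
      rw [show (2:ℝ)^(t.k-(i:ℤ)) * (3*s^2) = 3*s^2*2^(t.k-(i:ℤ)) by ring]
      refine le_trans (le_of_eq ?_) key
      rw [TS_eq, Finset.mul_sum]
      refine Finset.sum_congr rfl fun j _ => ?_
      rw [← mul_assoc, ← bs_mul]
      refine bs_congr fun m' _ => ?_
      rw [(dm_step hA t.k η (i+j) m').2, norm_mul, sg_norm, one_mul]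
      have e1 : η/2^(i+j) = η/2^i/2^j := by rw [pow_add, Nat.div_div_eq_div_mul]
      have e2 : t.k - ((i+j:ℕ):ℤ) = t.k - i - j := by push_cast; ring
      rw [e1, e2]
      unfold EE
      have e3 : (2:ℝ)^(t.k-(i:ℤ)) * (1/2)^j = 2^(t.k-(i:ℤ)-j) := by
        rw [zpow_sub₀ (two_ne_zero) _ (j:ℤ), zpow_natCast, one_div, inv_pow, div_eq_mul_inv]
      rw [e3]; split_ifs <;> simp
    have main := tree_abs (T := T) (S := S) (u := dm A2 t.k η) (v := dm A3 t.k η) (g := g) (M := M)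
      (r := r) (n0 := t.n) p1 p2 p3 hT hT0 gT (fun i m hi => gT i m (hr0 i m (by omega)))
      (fun i m => (dm_step hA2 t.k η i m).1) (fun i m => (dm_step hA3 t.k η i m).1)
      (fun i m h => by
        unfold dm; rw [norm_mul, sg_norm, one_mul]
        exact S2.amp_le hA2 downC_false p2 (mem_of i m h) (η := η/2^i) (by rw [hη1, nd_l]))
      (fun i m h => by
        unfold dm; rw [norm_mul, sg_norm, one_mul]
        exact S3.amp_le hA3 hbad p3 (mem_of i m h) (η := η/2^i) (by rw [hη1, nd_l]))
      (fun i m h => (hSd _ _).2 ⟨hnb _ (mem_of i m h), 0, by omega, by omega, by simpa using h⟩)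
      (fun i m e m' h he hm' => by
        by_cases hb : bad (t.k-((i+e:ℕ):ℤ)) m'
        · right
          rw [(dm_step hA2 t.k η (i+e) m').2, hz _ _ _ hb]; simp
        · left
          exact (hSd _ _).2 ⟨hb, e, by omega, by omega, by rw [hm', show i+e-e = i by omega]; exact h⟩)
      (massT hA2 downC_false (fun _ _ h => h.elim) S2) (massT hA3 hbad (fun _ _ h => h) S3)
      (fun d => by
        refine le_of_mul_le_mul_left ?_ pk
        rw [mul_comm _ (s1^2)]
        refine le_trans ?_ (S1.2 t ht 0 two_pos)
        rw [TS_eq, Finset.mul_sum]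
        have q := tree_sum_le PP t (fun P => if ltb 0 P t then en A1 0 (fun _ _ => False) 1 P else 0)
          (fun P => by
            have := en_nonneg A1 0 (fun _ _ => False) 1 P
            split_ifs <;> linarith) d
        rw [← Finset.sum_filter, Finset.filter_filter] at q
        have e0 : PP.filter (fun P => ble P t ∧ ltb 0 P t) = PP.filter (fun P => ltb 0 P t) :=
          Finset.filter_congr fun P _ => ⟨fun h => h.2, fun h => ⟨h.ble, h⟩⟩
        rw [e0] at q
        refine le_trans (Finset.sum_le_sum fun j _ => ?_) q
        rw [← mul_assoc, ← bs_mul, zero_add]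
        refine bs_mono fun m hm => ?_
        simp only [hgd, hTd]
        by_cases hmem : nd t j m ∈ PP
        · rw [if_pos hmem]
          rcases j with _ | j
          · simp
            have := en_nonneg A1 0 (fun _ _ => False) 1 (nd t 0 m)
            split_ifs <;> linarith
          · have e1 : ltb 0 (nd t (j+1) m) t ↔ (t.l/2^j)%2 = 0 := ltb_nd hm
            by_cases hpar : (t.l/2^j)%2 = 0
            · rw [if_pos ⟨⟨hmem, hm⟩, by omega, by simpa using hpar⟩, if_pos (e1.2 hpar)]
              unfold en
              rw [bs_zero, if_neg not_false, nd_k, nd_n, nd_l]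
              unfold EE
              have e3 : (2:ℝ)^t.k * (1/2)^(j+1) = 2^(t.k-((j+1:ℕ):ℤ)) := by
                rw [zpow_sub₀ (two_ne_zero), zpow_natCast, one_div, inv_pow, div_eq_mul_inv]
              rw [e3, Nat.cast_zero, sub_zero]
            · rw [if_neg, if_neg (fun h => hpar (e1.1 h))]
              · simp
              · rintro ⟨_, _, h⟩; exact hpar (by simpa using h)
        · rw [if_neg hmem, if_neg (fun h => hmem h.1.1)]; simp)
    have e0 : PP.filter (fun P => ble P t ∧ ltb 0 P t) = PP.filter (fun P => ltb 0 P t) :=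
      Finset.filter_congr fun P _ => ⟨fun h => h.2, fun h => ⟨h.ble, h⟩⟩
    have hsum := hD0 r (le_max_right _ _)
    rw [← Finset.sum_filter, Finset.filter_filter, e0] at hsum
    rw [hsum]
    have fin : ∑ i ∈ Finset.range r, bs i t.n (fun m => if nd t i m ∈ PP then
        (if ltb 0 (nd t i m) t then Lam A1 A2 A3 M (nd t i m) else 0) else 0) =
        (2:ℂ)^t.k * TS (fun i m => g i m * ((1/2:ℂ)^(M+1) *
        (bs M (2*m) (fun j => dm A2 t.k η (i+1+M) j * dm A3 t.k η (i+1+M) j)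
      - bs M (2*m+1) (fun j => dm A2 t.k η (i+1+M) j * dm A3 t.k η (i+1+M) j)))) r 0 t.n := by
      rw [TS_eq, Finset.mul_sum]
      refine Finset.sum_congr rfl fun j _ => ?_
      rw [← mul_assoc, ← bs_mul, zero_add]
      refine bs_congr fun m hm => ?_
      simp only [hgd, hTd]
      by_cases hmem : nd t j m ∈ PP
      · rw [if_pos hmem]
        rcases j with _ | j
        · rw [if_neg, if_neg]
          · simp
          · rintro ⟨_, h, _⟩; omega
          · rintro ⟨j, h, _⟩
            have := (nd_inj h).1; omega
        · have e1 : ltb 0 (nd t (j+1) m) t ↔ (t.l/2^j)%2 = 0 := ltb_nd hm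
          by_cases hpar : (t.l/2^j)%2 = 0
          · rw [if_pos (e1.2 hpar), if_pos ⟨⟨hmem, hm⟩, by omega, by simpa using hpar⟩]
            unfold Lam
            rw [nd_k, nd_n, nd_l]
            have e2 : 2*(t.l/2^(j+1)) = η/2^(j+1+1+M) := by
              rw [show j+1+1+M = j+1+L by omega, hη2, pow_succ, ← Nat.div_div_eq_div_mul]; omega
            have e3 : t.k - ((j+1:ℕ):ℤ) - ((M+1:ℕ):ℤ) = t.k - ((j+1+1+M:ℕ):ℤ) := by push_cast; ring
            have e4 : (fun j_1 => dm A2 t.k η (j+1+1+M) j_1 * dm A3 t.k η (j+1+1+M) j_1) =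
              (fun m' => A2 (t.k - ((j+1+1+M:ℕ):ℤ)) m' (η/2^(j+1+1+M)) *
                A3 (t.k - ((j+1+1+M:ℕ):ℤ)) m' (η/2^(j+1+1+M))) := by
              funext m'
              unfold dm
              rw [mul_mul_mul_comm, sg_sq, one_mul]
            rw [e4, e3, e2]
            have e5 : (2:ℂ)^(t.k - ((j+1:ℕ):ℤ) - (M+1)) = (2:ℂ)^t.k * (1/2)^(j+1) * (1/2)^(M+1) := by
              rw [zpow_sub₀ two_ne_zero, zpow_sub₀ two_ne_zero, zpow_natCast,
                show ((M:ℤ)+1) = ((M+1:ℕ):ℤ) by push_cast; ring, zpow_natCast, one_div, inv_pow, inv_pow, div_eq_mul_inv, div_eq_mul_inv]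
            rw [e5]; ring
          · rw [if_neg, if_neg]
            · simp
            · rintro ⟨_, _, h⟩; exact hpar (by simpa using h)
            · exact fun h => hpar (e1.1 h)
      · rw [if_neg hmem, if_neg (fun h => hmem h.1.1)]; simp
    rw [fin, norm_mul, norm_zpow, Complex.norm_ofNat, mul_comm]
    exact mul_le_mul_of_nonneg_right main pk.le
  rw [sum_ble ht]
  have := norm_add_le (Lam A1 A2 A3 M t + ∑ P ∈ PP.filter (fun P => ltb 0 P t), Lam A1 A2 A3 M P)
    (∑ P ∈ PP.filter (fun P => ltb 1 P t), Lam A1 A2 A3 M P)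
  have := norm_add_le (Lam A1 A2 A3 M t) (∑ P ∈ PP.filter (fun P => ltb 0 P t), Lam A1 A2 A3 M P)
  linarith

end Work

section Work
open Classical

lemma size_init {A : ℤ → ℕ → ℕ → ℂ} (hA : IsAmp A) {bad : ℤ → ℕ → Prop} (hbad : DownC bad)
    {ρ : ℤ → ℕ → ℝ} {lam : ℝ}
    (h0 : ∀ k n, 0 ≤ ρ k n) (hρ : ∀ k n, ρ k n = (ρ (k-1) (2*n) + ρ (k-1) (2*n+1))/2)
    (hAr : ∀ k n l, ‖A k n l‖ ≤ ρ k n) (hb : ∀ k n, ¬ bad k n → ρ k n ≤ lam)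
    (L : ℕ) {PP : Finset Bitile} {s : ℝ} (h1 : ∀ P ∈ PP, ρ P.k P.n ≤ 2*lam)
    (h2 : ∀ P ∈ PP, 2*lam*ρ P.k P.n ≤ s^2) : SizeLE A L bad PP s := by
  have zb : ∀ P ∈ PP, ∀ d η, ZZ A bad d P.k P.n η ≤ s^2*2^P.k := by
    intro P hP d η
    refine (ZZ_init h0 hρ hAr hb d P.k P.n η (h1 P hP)).trans ?_
    have := mul_le_mul_of_nonneg_right (h2 P hP) (show (0:ℝ) ≤ 2^P.k by positivity)
    linarith
  refine ⟨fun P hP η _ => zb P hP _ _, fun t ht b hb2 => ?_⟩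
  set η := 2^(L+1) * t.l with hη
  have hη2 : ∀ i, η/2^(i+1+L) = t.l/2^i := by
    intro i
    rw [show i+1+L = (L+1)+i by ring, pow_add, ← Nat.div_div_eq_div_mul, hη,
      Nat.mul_div_cancel_left _ (by positivity)]
  obtain ⟨D, hD⟩ := tree_sum PP t (fun P => if ltb b P t then en A L bad (1-b) P else 0)
  have hD := hD D le_rfl
  have e0 : PP.filter (fun P => ble P t ∧ ltb b P t) = PP.filter (fun P => ltb b P t) :=
    Finset.filter_congr fun P _ => ⟨fun h => h.2, fun h => ⟨h.ble, h⟩⟩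
  rw [← Finset.sum_filter, Finset.filter_filter, e0] at hD
  rw [hD]
  refine le_trans ?_ (zb t ht (L+D) η)
  refine le_trans ?_ (ZZ_lower hA hbad (L+D) t.k t.n η)
  rw [Finset.sum_range_add]
  have n1 := EE_nonneg A t.k t.n η
  have n2 : 0 ≤ ∑ j ∈ Finset.range L, bs j t.n (fun m => if bad (t.k-j) m then 0 else
      EE A (t.k-j) m (sib (η/2^j))) := Finset.sum_nonneg fun j _ =>
      bs_nonneg fun m => by split_ifs; exact le_rfl; exact EE_nonneg _ _ _ _
  refine le_trans (Finset.sum_le_sum (g := fun j => bs (L+j) t.n (fun m => if bad (t.k-(L+j:ℕ)) m then 0 else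
      EE A (t.k-(L+j:ℕ)) m (sib (η/2^(L+j))))) fun i _ => ?_) (by linarith)
  have hnn : ∀ i m, 0 ≤ (if bad (t.k-(L+i:ℕ)) m then 0 else
      EE A (t.k-(L+i:ℕ)) m (sib (η/2^(L+i)))) := fun i m => by
    split_ifs; exact le_rfl; exact EE_nonneg _ _ _ _
  rw [add_comm L i, bs_add]
  refine bs_mono fun m hm => ?_
  rw [add_comm i L]
  by_cases hm1 : nd t i m ∈ PP
  · rw [if_pos hm1]
    by_cases hm2 : ltb b (nd t i m) t
    · rw [if_pos hm2]
      obtain ⟨j, a1, a2, a3⟩ := hm2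
      obtain rfl := (nd_inj a1).1
      refine bs_mono fun m' _ => le_of_eq ?_
      have e1 : (nd t (j+1) m).k - (L:ℤ) = t.k - ((L+(j+1):ℕ):ℤ) := by rw [nd_k]; push_cast; ring
      have e2 : sib (η/2^(L+(j+1))) = 2*(nd t (j+1) m).l + (1-b) := by
        rw [add_comm L, hη2, nd_l, pow_succ, ← Nat.div_div_eq_div_mul]
        interval_cases b
        · rw [show t.l/2^j = 2*(t.l/2^j/2) by omega, sib_even]; omega
        · rw [show t.l/2^j = 2*(t.l/2^j/2)+1 by omega, sib_odd]; omega
      rw [e1, e2]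
    · rw [if_neg hm2]; exact bs_nonneg (hnn i)
  · rw [if_neg hm1]; exact bs_nonneg (hnn i)

/-! ### selection -/

inductive Red : Finset Bitile → Finset Bitile → ℝ → Prop
  | refl (PP : Finset Bitile) : Red PP PP 0
  | step (PP : Finset Bitile) (t : Bitile) (QQ : Finset Bitile) (c : ℝ) (ht : t ∈ PP)
      (h : Red (PP.filter (fun P => ¬ ble P t)) QQ c) : Red PP QQ (2^t.k + c)

lemma Red.trans {PP QQ RR : Finset Bitile} {c c' : ℝ} (h : Red PP QQ c) (h' : Red QQ RR c') :
    Red PP RR (c+c') := by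
  induction h with
  | refl => simpa using h'
  | step PP t QQ c ht h ih => rw [add_assoc]; exact Red.step PP t RR _ ht (ih h')

lemma Red.subset {PP QQ : Finset Bitile} {c : ℝ} (h : Red PP QQ c) : QQ ⊆ PP := by
  induction h with
  | refl => exact subset_rfl
  | step PP t QQ c ht h ih => exact ih.trans (Finset.filter_subset _ _)

lemma Conv.filter {PP : Finset Bitile} (h : Conv PP) (t : Bitile) :
    Conv (PP.filter (fun P => ¬ ble P t)) := by
  intro P Q R hP hR h1 h2
  simp only [Finset.mem_filter] at hP hR ⊢
  exact ⟨h P Q R hP.1 hR.1 h1 h2, fun h3 => hP.2 (ble_trans h1 h3)⟩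

lemma Red.conv {PP QQ : Finset Bitile} {c : ℝ} (h : Red PP QQ c) (hc : Conv PP) : Conv QQ := by
  induction h with
  | refl => exact hc
  | step PP t QQ c ht h ih => exact ih (hc.filter t)

lemma Red.sum_bound {PP QQ : Finset Bitile} {c : ℝ} (h : Red PP QQ c) (X : Bitile → ℂ) (K : ℝ)
    (hc : Conv PP)
    (hK : ∀ RR ⊆ PP, Conv RR → ∀ t ∈ RR, ‖∑ P ∈ RR.filter (fun P => ble P t), X P‖ ≤ K * 2^t.k) :
    ‖∑ P ∈ PP, X P‖ ≤ K * c + ‖∑ P ∈ QQ, X P‖ := by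
  induction h with
  | refl => simp
  | step PP t QQ c ht h ih =>
    have i := ih (hc.filter t) (fun RR hR => hK RR (hR.trans (Finset.filter_subset _ _)))
    rw [← Finset.sum_filter_add_sum_filter_not PP (fun P => ble P t)]
    have := norm_add_le (∑ P ∈ PP.filter (fun P => ble P t), X P) (∑ P ∈ PP.filter (fun P => ¬ ble P t), X P)
    have := hK PP subset_rfl hc t ht
    linarith

def tle (p q : Tile) : Prop := ∃ j : ℕ, p.k = q.k - j ∧ p.n/2^j = q.n ∧ q.l/2^j = p.l

lemma tle_refl (p : Tile) : tle p p := ⟨0, by simp, by simp, by simp⟩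

def Incomp (U : Finset Tile) : Prop := ∀ p ∈ U, ∀ q ∈ U, p ≠ q → ¬ tle p q

def Bessel (A : ℤ → ℕ → ℕ → ℂ) (e : ℝ) : Prop :=
  ∀ U : Finset Tile, Incomp U → ∑ p ∈ U, EE A p.k p.n p.l ≤ e

lemma pass {A : ℤ → ℕ → ℕ → ℂ} {e s : ℝ} (hB : Bessel A e)
    (Q : Finset Bitile → Bitile → Prop) (B : Finset Bitile → Bitile → Finset Tile) (key : Bitile → ℝ)
    (hmono : ∀ PP QQ t, QQ ⊆ PP → Q QQ t → Q PP t)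
    (hen : ∀ PP, ∀ t ∈ PP, Q PP t → s^2 * 2^t.k ≤ ∑ p ∈ B PP t, EE A p.k p.n p.l)
    (hself : ∀ PP, ∀ t ∈ PP, Q PP t → Incomp (B PP t))
    (hcross : ∀ PP, ∀ t ∈ PP, Q PP t → ∀ PP' ⊆ PP.filter (fun P => ¬ ble P t), ∀ t' ∈ PP', Q PP' t' →
      key t ≤ key t' → ∀ p ∈ B PP t, ∀ p' ∈ B PP' t', ¬ tle p p' ∧ ¬ tle p' p)
    (PP : Finset Bitile) :
    ∃ QQ c, Red PP QQ c ∧ (∀ t ∈ QQ, ¬ Q QQ t) ∧ s^2 * c ≤ e := by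
  suffices H : ∀ N : ℕ, ∀ PP : Finset Bitile, PP.card ≤ N → ∃ QQ c U, Red PP QQ c ∧ (∀ t ∈ QQ, ¬ Q QQ t) ∧
      s^2 * c ≤ ∑ p ∈ U, EE A p.k p.n p.l ∧ Incomp U ∧
      ∀ p ∈ U, ∃ PP' ⊆ PP, ∃ t' ∈ PP', Q PP' t' ∧ p ∈ B PP' t' by
    obtain ⟨QQ, c, U, h1, h2, h3, h4, _⟩ := H _ PP le_rfl
    exact ⟨QQ, c, h1, h2, h3.trans (hB U h4)⟩
  intro N
  induction N with
  | zero =>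
    intro PP h
    have : PP = ∅ := Finset.card_eq_zero.1 (by omega)
    subst this
    exact ⟨∅, 0, ∅, Red.refl _, by simp, by simp, by intro p hp; simp at hp, by simp⟩
  | succ N ih =>
    intro PP hcard
    by_cases hex : (PP.filter (fun t => Q PP t)).Nonempty
    · obtain ⟨t, ht, hmin⟩ := Finset.exists_min_image _ key hex
      simp only [Finset.mem_filter] at ht hmin
      have hlt : (PP.filter (fun P => ¬ ble P t)).card < PP.card := by
        apply Finset.card_lt_card
        refine ⟨Finset.filter_subset _ _, fun h => ?_⟩
        have := h ht.1
        simp only [Finset.mem_filter] at this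
        exact this.2 (ble_refl t)
      obtain ⟨QQ, c, U, h1, h2, h3, h4, h5⟩ := ih (PP.filter (fun P => ¬ ble P t)) (by omega)
      have cr : ∀ p ∈ B PP t, ∀ p' ∈ U, ¬ tle p p' ∧ ¬ tle p' p := by
        intro p hp p' hp'
        obtain ⟨PP', hs, t', ht', hq, hb⟩ := h5 p' hp'
        have hs' : PP' ⊆ PP := hs.trans (Finset.filter_subset _ _)
        exact hcross PP t ht.1 ht.2 PP' hs t' ht' hq (hmin t' ⟨hs' ht', hmono _ _ _ hs' hq⟩) p hp p' hb
      refine ⟨QQ, 2^t.k + c, B PP t ∪ U, Red.step PP t QQ c ht.1 h1, h2, ?_, ?_, ?_⟩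
      · rw [Finset.sum_union, mul_add]
        · exact add_le_add (hen PP t ht.1 ht.2) h3
        · rw [Finset.disjoint_left]
          intro p hp hp'
          exact (cr p hp p hp').1 (tle_refl p)
      · intro p hp q hq hpq
        rw [Finset.mem_union] at hp hq
        rcases hp with hp | hp <;> rcases hq with hq | hq
        · exact hself PP t ht.1 ht.2 p hp q hq hpq
        · exact (cr p hp q hq).1
        · exact (cr q hq p hp).2
        · exact h4 p hp q hq hpq
      · intro p hp
        rw [Finset.mem_union] at hp
        rcases hp with hp | hp
        · exact ⟨PP, subset_rfl, t, ht.1, ht.2, hp⟩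
        · obtain ⟨PP', hs, r⟩ := h5 p hp
          exact ⟨PP', hs.trans (Finset.filter_subset _ _), r⟩
    · refine ⟨PP, 0, ∅, Red.refl _, ?_, by simp, by intro p hp; simp at hp, by simp⟩
      intro t ht hq
      exact hex ⟨t, Finset.mem_filter.2 ⟨ht, hq⟩⟩

/-- small tiles under a bitile -/
def jt (L b : ℕ) (P : Bitile) : Finset Tile :=
  (Finset.Ico (P.n*2^L) ((P.n+1)*2^L)).image (fun m => (⟨P.k-L, m, 2*P.l+b⟩ : Tile))

lemma mem_jt {L b : ℕ} {P : Bitile} {p : Tile} :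
    p ∈ jt L b P ↔ p.k = P.k - L ∧ p.n/2^L = P.n ∧ p.l = 2*P.l+b := by
  unfold jt
  rw [Finset.mem_image]
  constructor
  · rintro ⟨m, hm, rfl⟩
    exact ⟨rfl, mem_block.1 hm, rfl⟩
  · rintro ⟨h1, h2, h3⟩
    refine ⟨p.n, mem_block.2 h2, ?_⟩
    cases p; simp at h1 h3 ⊢; exact ⟨h1.symm, h3.symm⟩

lemma sum_jt (A : ℤ → ℕ → ℕ → ℂ) (L b : ℕ) (P : Bitile) :
    ∑ p ∈ jt L b P, EE A p.k p.n p.l = bs L P.n (fun m => EE A (P.k-L) m (2*P.l+b)) := by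
  unfold jt
  rw [Finset.sum_image, bs_eq_sum]
  intro m _ m' _ h
  simpa using h

lemma en_le_jt (A : ℤ → ℕ → ℕ → ℂ) (L : ℕ) (bad : ℤ → ℕ → Prop) (b : ℕ) (P : Bitile) :
    en A L bad b P ≤ ∑ p ∈ jt L b P, EE A p.k p.n p.l := by
  rw [sum_jt]
  refine bs_mono fun m _ => ?_
  split_ifs; exact EE_nonneg _ _ _ _; exact le_rfl

lemma Tile.ext3 {p q : Tile} (h1 : p.k = q.k) (h2 : p.n = q.n) (h3 : p.l = q.l) : p = q := by
  cases p; cases q; simp_all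

lemma Bitile.ext3 {p q : Bitile} (h1 : p.k = q.k) (h2 : p.n = q.n) (h3 : p.l = q.l) : p = q := by
  cases p; cases q; simp_all

lemma jt_lift {L b b' : ℕ} (hb : b < 2) (hb' : b' < 2) {P P' : Bitile} {p p' : Tile} (hp : p ∈ jt L b P) (hp' : p' ∈ jt L b' P')
    {j : ℕ} (h1 : p'.k = p.k - j) (h2 : p'.n/2^j = p.n) (h3 : p.l/2^j = p'.l) :
    P' = nd P j P'.n ∧ P'.n/2^j = P.n := by
  rw [mem_jt] at hp hp'
  refine ⟨Bitile.ext3 ?_ rfl ?_, ?_⟩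
  · rw [nd_k]; omega
  · rw [nd_l]
    have e1 : P'.l = p'.l/2 := by omega
    have e2 : P.l = p.l/2 := by omega
    rw [e1, e2, ← h3, Nat.div_div_eq_div_mul, Nat.div_div_eq_div_mul, mul_comm]
  · rw [← hp'.2.1, ← hp.2.1, ← h2, Nat.div_div_eq_div_mul, Nat.div_div_eq_div_mul, mul_comm]

lemma jt_lift' {L b b' : ℕ} (hb : b < 2) (hb' : b' < 2) {P P' : Bitile} {p p' : Tile} (hp : p ∈ jt L b P) (hp' : p' ∈ jt L b' P')
    (h : tle p' p) : ble P' P := by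
  obtain ⟨j, h1, h2, h3⟩ := h
  exact ⟨j, jt_lift hb hb' hp hp' h1 h2 h3⟩

lemma top_pass {A : ℤ → ℕ → ℕ → ℂ} (hA : IsAmp A) {e s : ℝ} (hB : Bessel A e) (L : ℕ) (bad : ℤ → ℕ → Prop)
    (PP : Finset Bitile) : ∃ QQ c, Red PP QQ c ∧
      (∀ P ∈ QQ, ∀ η, η/2^(L+1) = P.l → ZZ A bad (L+1) P.k P.n η ≤ s^2 * 2^P.k) ∧ s^2 * c ≤ e := by
  have hB2 : ∀ (P : Bitile) p, p ∈ jt L 0 P ∪ jt L 1 P → ∃ b < 2, p ∈ jt L b P := by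
    intro P p hp
    rw [Finset.mem_union] at hp
    rcases hp with hp | hp
    · exact ⟨0, two_pos, hp⟩
    · exact ⟨1, one_lt_two, hp⟩
  obtain ⟨QQ, c, h1, h2, h3⟩ := pass (s := s) hB
    (fun _ P => ∃ η, η/2^(L+1) = P.l ∧ s^2*2^P.k < ZZ A bad (L+1) P.k P.n η)
    (fun _ P => jt L 0 P ∪ jt L 1 P) (fun P => -(P.k:ℝ)) (fun _ _ _ _ h => h)
    (by
      rintro PP t - ⟨η, hη, h⟩
      have := ZZ_upper' hA bad L t.k t.n η t.l hη
      rw [Finset.sum_union, sum_jt, sum_jt]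
      · simp only [add_zero]; linarith
      · rw [Finset.disjoint_left]
        intro p hp hp'
        rw [mem_jt] at hp hp'
        omega)
    (by
      intro PP t _ _ p hp q hq hpq h
      obtain ⟨b, hb, hp⟩ := hB2 _ _ hp
      obtain ⟨b', hb', hq⟩ := hB2 _ _ hq
      obtain ⟨j, a1, a2, a3⟩ := h
      rw [mem_jt] at hp hq
      obtain rfl : j = 0 := by omega
      exact hpq (Tile.ext3 (by simpa using a1) (by simpa using a2) (by simpa using a3.symm)))
    (by
      intro PP t ht _ PP' hs t' ht' _ hk p hp p' hp'
      obtain ⟨b, hb, hp⟩ := hB2 _ _ hp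
      obtain ⟨b', hb', hp'⟩ := hB2 _ _ hp'
      have hk : t'.k ≤ t.k := by
        have : (t'.k:ℝ) ≤ t.k := by linarith
        exact_mod_cast this
      have hn := (Finset.mem_filter.1 (hs ht')).2
      have second : ¬ tle p' p := fun h => hn (jt_lift' hb hb' hp hp' h)
      refine ⟨?_, second⟩
      rintro ⟨j, a1, a2, a3⟩
      have m1 := mem_jt.1 hp
      have m2 := mem_jt.1 hp'
      obtain rfl : j = 0 := by omega
      apply second
      rw [Tile.ext3 (p := p) (q := p') (by simpa using a1) (by simpa using a2) (by simpa using a3.symm)]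
      exact tle_refl _) PP
  refine ⟨QQ, c, h1, fun P hP η hη => ?_, h3⟩
  by_contra hcon
  exact h2 P hP ⟨η, hη, not_le.1 hcon⟩

def xi (t : Bitile) : ℝ := (t.l:ℝ) * 2^(-t.k)

lemma xi_bounds {t : Bitile} {j c : ℕ} {q : ℤ} (h : t.l/2^j = c) (hq : q = t.k - j) :
    (c:ℝ) * 2^(-q) ≤ xi t ∧ xi t < ((c:ℝ)+1) * 2^(-q) := by
  have h1 : c * 2^j ≤ t.l := by rw [← h]; exact Nat.div_mul_le_self _ _
  have h2 : t.l < (c+1) * 2^j := by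
    rw [← h, mul_comm]; exact Nat.lt_mul_div_succ _ (by positivity)
  have h1' : (c:ℝ) * 2^j ≤ t.l := by exact_mod_cast h1
  have h2' : (t.l:ℝ) < (c+1) * 2^j := by exact_mod_cast h2
  have e : (2:ℝ)^(-q) = 2^j * 2^(-t.k) := by
    rw [hq, neg_sub, sub_eq_add_neg, zpow_add₀ two_ne_zero, zpow_natCast]
  have pk : (0:ℝ) < 2^(-t.k) := by positivity
  unfold xi
  rw [e, ← mul_assoc, ← mul_assoc]
  exact ⟨mul_le_mul_of_nonneg_right h1' pk.le, mul_lt_mul_of_pos_right h2' pk⟩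

lemma half_shift {j L0 c : ℕ} {a : ℕ} (hc : c < 2) (hj : 1 ≤ j) (h : (2*a+c)/2^j = L0) : a/2^(j-1) = L0 := by
  obtain ⟨i, rfl⟩ : ∃ i, j = i+1 := ⟨j-1, by omega⟩
  rw [pow_succ', ← Nat.div_div_eq_div_mul, show (2*a+c)/2 = a by omega] at h
  simpa using h

lemma b_pass {A : ℤ → ℕ → ℕ → ℂ} {e s : ℝ} (hB : Bessel A e) (L : ℕ) (bad : ℤ → ℕ → Prop)
    (b : ℕ) (hb : b < 2) (PP : Finset Bitile) : ∃ QQ c, Red PP QQ c ∧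
      (∀ t ∈ QQ, ∑ P ∈ QQ.filter (fun P => ltb b P t), en A L bad (1-b) P ≤ s^2 * 2^t.k) ∧ s^2 * c ≤ e := by
  have hb1 : 1 - b < 2 := by omega
  -- within one tree
  have hselfP : ∀ t P1 P2 p1 p2, ltb b P1 t → ltb b P2 t → p1 ∈ jt L (1-b) P1 → p2 ∈ jt L (1-b) P2 →
      tle p1 p2 → p1 = p2 := by
    rintro t P1 P2 p1 p2 ⟨j1, a1, a2, a3⟩ ⟨j2, c1, c2, c3⟩ hp1 hp2 ⟨j, d1, d2, d3⟩
    have m1 := mem_jt.1 hp1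
    have m2 := mem_jt.1 hp2
    rcases Nat.eq_zero_or_pos j with rfl | hj
    · exact Tile.ext3 (by simpa using d1) (by simpa using d2) (by simpa using d3.symm)
    exfalso
    rw [m2.2.2, m1.2.2] at d3
    have q1 := half_shift hb1 hj d3
    have k1 := congrArg Bitile.k a1
    have k2 := congrArg Bitile.k c1
    have l1 := congrArg Bitile.l a1
    have l2 := congrArg Bitile.l c1
    rw [nd_k] at k1 k2
    rw [nd_l] at l1 l2
    rw [l2, Nat.div_div_eq_div_mul, ← pow_add, show j2+1+(j-1) = j1 by push_cast at k1 k2; omega] at q1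
    rw [pow_succ, ← Nat.div_div_eq_div_mul] at l1
    omega
  obtain ⟨QQ, c, h1, h2, h3⟩ := pass (s := s) hB
    (fun PP t => s^2*2^t.k < ∑ P ∈ PP.filter (fun P => ltb b P t), en A L bad (1-b) P)
    (fun PP t => (PP.filter (fun P => ltb b P t)).biUnion (fun P => jt L (1-b) P))
    (fun t => if b = 1 then xi t else - xi t)
    (fun PP QQ t h hq => hq.trans_le (Finset.sum_le_sum_of_subset_of_nonneg
      (Finset.filter_subset_filter _ h) fun P _ _ => en_nonneg _ _ _ _ _))
    (by
      intro PP t _ h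
      rw [Finset.sum_biUnion]
      · exact h.le.trans (Finset.sum_le_sum fun P _ => en_le_jt _ _ _ _ _)
      · intro P1 hP1 P2 hP2 hne
        rw [Function.onFun, Finset.disjoint_left]
        intro p hp hp'
        rw [mem_jt] at hp hp'
        exact hne (Bitile.ext3 (by omega) (by omega) (by omega)))
    (by
      intro PP t _ _ p hp q hq hpq h
      simp only [Finset.mem_biUnion, Finset.mem_filter] at hp hq
      obtain ⟨P1, ⟨_, hP1⟩, hp⟩ := hp
      obtain ⟨P2, ⟨_, hP2⟩, hq⟩ := hq
      exact hpq (hselfP t P1 P2 p q hP1 hP2 hp hq h))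
    (by
      intro PP t ht _ PP' hs t' ht' _ hk p hp p' hp'
      simp only [Finset.mem_biUnion, Finset.mem_filter] at hp hp'
      obtain ⟨P, ⟨_, hP⟩, hp⟩ := hp
      obtain ⟨P', ⟨hm', hP'⟩, hp'⟩ := hp'
      have hn := (Finset.mem_filter.1 (hs hm')).2
      have second : ¬ tle p' p := fun h => hn (ble_trans (jt_lift' hb1 hb1 hp hp' h) hP.ble)
      refine ⟨?_, second⟩
      rintro ⟨j, d1, d2, d3⟩
      rcases Nat.eq_zero_or_pos j with rfl | hj
      · apply second
        rw [Tile.ext3 (p := p) (q := p') (by simpa using d1) (by simpa using d2) (by simpa using d3.symm)]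
        exact tle_refl _
      have m1 := mem_jt.1 hp
      have m2 := mem_jt.1 hp'
      rw [m2.2.2, m1.2.2] at d3
      have q1 := half_shift hb1 hj d3
      obtain ⟨j1, a1, a2, a3⟩ := hP
      obtain ⟨j2, c1, c2, c3⟩ := hP'
      have k1 := congrArg Bitile.k a1
      have k2 := congrArg Bitile.k c1
      have l1 := congrArg Bitile.l a1
      have l2 := congrArg Bitile.l c1
      rw [nd_k] at k1 k2
      rw [nd_l] at l1 l2
      rw [l2, Nat.div_div_eq_div_mul, ← pow_add] at q1
      have x' := xi_bounds (q := t.k - j1) q1 (by push_cast at k1 k2 ⊢; omega)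
      have q0 : t.l/2^j1 = 2*P.l+b := by
        rw [pow_succ, ← Nat.div_div_eq_div_mul] at l1; omega
      have x := xi_bounds (q := t.k - j1) q0 rfl
      have pq : (0:ℝ) < 2^(-(t.k - (j1:ℤ))) := by positivity
      interval_cases b
      · simp only [zero_ne_one, if_false, neg_le_neg_iff] at hk
        push_cast at x x'
        linarith [x.2, x'.1]
      · simp only [if_true] at hk
        push_cast at x x'
        linarith [x.1, x'.2]) PP
  exact ⟨QQ, c, h1, fun P hP => not_lt.1 (h2 P hP), h3⟩

lemma select {A : ℤ → ℕ → ℕ → ℂ} (hA : IsAmp A) {e s : ℝ} (hB : Bessel A e) (L : ℕ)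
    (bad : ℤ → ℕ → Prop) (PP : Finset Bitile) :
    ∃ QQ c, Red PP QQ c ∧ SizeLE A L bad QQ s ∧ s^2 * c ≤ 3*e := by
  obtain ⟨Q1, c1, r1, p1, e1⟩ := top_pass (s := s) hA hB L bad PP
  obtain ⟨Q2, c2, r2, p2, e2⟩ := b_pass (s := s) hB L bad 0 two_pos Q1
  obtain ⟨Q3, c3, r3, p3, e3⟩ := b_pass (s := s) hB L bad 1 one_lt_two Q2
  refine ⟨Q3, c1+c2+c3, (r1.trans r2).trans r3, ⟨fun P hP => p1 P (r2.subset (r3.subset hP)), ?_⟩, by linarith⟩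
  intro t ht b hb
  interval_cases b
  · refine le_trans ?_ (p2 t (r3.subset ht))
    exact Finset.sum_le_sum_of_subset_of_nonneg (Finset.filter_subset_filter _ r3.subset)
      fun P _ _ => en_nonneg _ _ _ _ _
  · exact p3 t ht

end Work

section Work
open Classical

lemma SizeLE.min {A : ℤ → ℕ → ℕ → ℂ} {L : ℕ} {bad : ℤ → ℕ → Prop} {PP : Finset Bitile} {s s' : ℝ}
    (h : SizeLE A L bad PP s) (h' : SizeLE A L bad PP s') : SizeLE A L bad PP (min s s') := by
  rcases le_total s s' with hh | hh
  · rwa [min_eq_left hh]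
  · rwa [min_eq_right hh]

lemma level_step {A1 A2 A3 : ℤ → ℕ → ℕ → ℂ} (hA1 : IsAmp A1) (hA2 : IsAmp A2) (hA3 : IsAmp A3)
    {M : ℕ} {bad : ℤ → ℕ → Prop} (hbad : DownC bad) (hz : ∀ k n l, bad k n → A2 k n l = 0)
    {PP : Finset Bitile} (hc : Conv PP) (hnb : ∀ P ∈ PP, ¬ bad P.k P.n)
    {r1 r2 r3 S1 S2 S3 : ℝ} (pr1 : 0 < r1) (pr2 : 0 < r2) (pr3 : 0 < r3)
    (pS1 : 0 < S1) (pS2 : 0 < S2) (pS3 : 0 < S3)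
    (B1 : Bessel A1 (r1^2)) (B2 : Bessel A2 (r2^2)) (B3 : Bessel A3 (r3^2))
    (n : ℤ)
    (Z1 : SizeLE A1 0 (fun _ _ => False) PP (min (2^(-n)*r1) S1))
    (Z2 : SizeLE A2 (M+1) (fun _ _ => False) PP (min (2^(-n)*r2) S2))
    (Z3 : SizeLE A3 (M+1) bad PP (min (2^(-n)*r3) S3))
    (Y1 : SizeLE A1 0 (fun _ _ => False) PP S1)
    (Y2 : SizeLE A2 (M+1) (fun _ _ => False) PP S2)
    (Y3 : SizeLE A3 (M+1) bad PP S3) :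
    ∃ QQ ⊆ PP, Conv QQ ∧
      SizeLE A1 0 (fun _ _ => False) QQ (min (2^(-(n+1))*r1) S1) ∧
      SizeLE A2 (M+1) (fun _ _ => False) QQ (min (2^(-(n+1))*r2) S2) ∧
      SizeLE A3 (M+1) bad QQ (min (2^(-(n+1))*r3) S3) ∧
      ‖∑ P ∈ PP, Lam A1 A2 A3 M P‖ ≤
        1224 * (2^(2*n) * (min (2^(-n)*r1) S1 * min (2^(-n)*r2) S2 * min (2^(-n)*r3) S3))
        + ‖∑ P ∈ QQ, Lam A1 A2 A3 M P‖ := by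
  obtain ⟨Q1, c1, R1, s1, d1⟩ := select (s := 2^(-(n+1))*r1) hA1 B1 0 (fun _ _ => False) PP
  obtain ⟨Q2, c2, R2, s2, d2⟩ := select (s := 2^(-(n+1))*r2) hA2 B2 (M+1) (fun _ _ => False) Q1
  obtain ⟨Q3, c3, R3, s3, d3⟩ := select (s := 2^(-(n+1))*r3) hA3 B3 (M+1) bad Q2
  have R := (R1.trans R2).trans R3
  have key : ∀ (r c : ℝ), 0 < r → (2^(-(n+1))*r)^2*c ≤ 3*r^2 → c ≤ 12 * 2^(2*n) := by
    intro r c hr h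
    have e : ((2:ℝ)^(-(n+1))*r)^2 = r^2 * (2^(2*n) * 4)⁻¹ := by
      rw [mul_pow, ← zpow_natCast ((2:ℝ)^(-(n+1))) 2, ← zpow_mul, mul_comm (r^2)]
      congr 1
      rw [show (4:ℝ) = 2^(2:ℤ) by norm_num, ← zpow_add₀ two_ne_zero, ← zpow_neg]
      congr 1; push_cast; ring
    rw [e] at h
    have hr2 : 0 < r^2 := by positivity
    have pp : (0:ℝ) < 2^(2*n) * 4 := by positivity
    have h' : (2^(2*n) * 4)⁻¹ * c ≤ 3 := by
      by_contra hh
      push Not at hh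
      have := mul_lt_mul_of_pos_left hh hr2
      linarith
    rw [inv_mul_le_iff₀ pp] at h'
    linarith
  have pn : (0:ℝ) < 2^(-n) := by positivity
  refine ⟨Q3, R.subset, R.conv hc, ?_, ?_, ?_, ?_⟩
  · exact (s1.mono (R3.subset.trans R2.subset)).min (Y1.mono R.subset)
  · exact (s2.mono R3.subset).min (Y2.mono R.subset)
  · exact s3.min (Y3.mono R.subset)
  · set σ := min (2^(-n)*r1) S1 * min (2^(-n)*r2) S2 * min (2^(-n)*r3) S3 with hσ
    have m1 : 0 < min (2^(-n)*r1) S1 := lt_min (by positivity) pS1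
    have m2 : 0 < min (2^(-n)*r2) S2 := lt_min (by positivity) pS2
    have m3 : 0 < min (2^(-n)*r3) S3 := lt_min (by positivity) pS3
    have pσ : 0 < σ := by positivity
    have := R.sum_bound (Lam A1 A2 A3 M) (34*σ) hc (fun RR hR hcR t ht =>
      tree_estimate hA1 hA2 hA3 hbad hz hcR (fun P hP => hnb P (hR hP)) m1 m2 m3
        (Z1.mono hR) (Z2.mono hR) (Z3.mono hR) ht)
    refine this.trans ?_
    have k1 := key r1 c1 pr1 d1
    have k2 := key r2 c2 pr2 d2
    have k3 := key r3 c3 pr3 d3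
    have : 34*σ*(c1+c2+c3) ≤ 34*σ*(36*2^(2*n)) := by gcongr; linarith
    nlinarith [this]

lemma level_iter {A1 A2 A3 : ℤ → ℕ → ℕ → ℂ} (hA1 : IsAmp A1) (hA2 : IsAmp A2) (hA3 : IsAmp A3)
    {M : ℕ} {bad : ℤ → ℕ → Prop} (hbad : DownC bad) (hz : ∀ k n l, bad k n → A2 k n l = 0)
    {PP : Finset Bitile} (hc : Conv PP) (hnb : ∀ P ∈ PP, ¬ bad P.k P.n)
    {r1 r2 r3 S1 S2 S3 : ℝ} (pr1 : 0 < r1) (pr2 : 0 < r2) (pr3 : 0 < r3)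
    (pS1 : 0 < S1) (pS2 : 0 < S2) (pS3 : 0 < S3)
    (B1 : Bessel A1 (r1^2)) (B2 : Bessel A2 (r2^2)) (B3 : Bessel A3 (r3^2))
    (n : ℤ)
    (Z1 : SizeLE A1 0 (fun _ _ => False) PP (min (2^(-n)*r1) S1))
    (Z2 : SizeLE A2 (M+1) (fun _ _ => False) PP (min (2^(-n)*r2) S2))
    (Z3 : SizeLE A3 (M+1) bad PP (min (2^(-n)*r3) S3))
    (Y1 : SizeLE A1 0 (fun _ _ => False) PP S1)
    (Y2 : SizeLE A2 (M+1) (fun _ _ => False) PP S2)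
    (Y3 : SizeLE A3 (M+1) bad PP S3) (J : ℕ) :
    ∃ QQ ⊆ PP, Conv QQ ∧
      SizeLE A1 0 (fun _ _ => False) QQ (min (2^(-(n+J))*r1) S1) ∧
      SizeLE A2 (M+1) (fun _ _ => False) QQ (min (2^(-(n+J))*r2) S2) ∧
      SizeLE A3 (M+1) bad QQ (min (2^(-(n+J))*r3) S3) ∧
      ‖∑ P ∈ PP, Lam A1 A2 A3 M P‖ ≤
        ∑ j ∈ Finset.range J, 1224 * (2^(2*(n+j)) *
          (min (2^(-(n+j))*r1) S1 * min (2^(-(n+j))*r2) S2 * min (2^(-(n+j))*r3) S3))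
        + ‖∑ P ∈ QQ, Lam A1 A2 A3 M P‖ := by
  induction J with
  | zero => exact ⟨PP, subset_rfl, hc, by simpa using Z1, by simpa using Z2, by simpa using Z3, by simp⟩
  | succ J ih =>
    obtain ⟨QQ, hQ, hcQ, z1, z2, z3, hb⟩ := ih
    obtain ⟨RR, hR, hcR, w1, w2, w3, hb'⟩ := level_step hA1 hA2 hA3 hbad hz hcQ (fun P hP => hnb P (hQ hP))
      pr1 pr2 pr3 pS1 pS2 pS3 B1 B2 B3 (n+J) z1 z2 z3 (Y1.mono hQ) (Y2.mono hQ) (Y3.mono hQ)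
    have e : n + J + 1 = n + ((J+1:ℕ):ℤ) := by push_cast; ring
    rw [e] at w1 w2 w3
    refine ⟨RR, hR.trans hQ, hcR, w1, w2, w3, ?_⟩
    rw [Finset.sum_range_succ]
    linarith

lemma min_rpow {a S t : ℝ} (ha : 0 < a) (hS : 0 < S) (h0 : 0 ≤ t) (h1 : t ≤ 1) :
    min a S ≤ a^t * S^(1-t) := by
  have m : 0 < min a S := lt_min ha hS
  calc min a S = (min a S)^t * (min a S)^(1-t) := by
        rw [← Real.rpow_add m]; simp
    _ ≤ a^t * S^(1-t) := by
        have a1 : (min a S)^t ≤ a^t := Real.rpow_le_rpow m.le (min_le_left _ _) h0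
        have a2 : (min a S)^(1-t) ≤ S^(1-t) := Real.rpow_le_rpow m.le (min_le_right _ _) (by linarith)
        gcongr

lemma lev_num (n : ℤ) {r1 r2 r3 S1 S2 S3 : ℝ} (pr1 : 0 < r1) (pr2 : 0 < r2) (pr3 : 0 < r3)
    (pS1 : 0 < S1) (pS2 : 0 < S2) (pS3 : 0 < S3) {t t' : ℝ} (h0 : 0 ≤ t) (h1 : t ≤ 1)
    (h0' : 0 ≤ t') (h1' : t' ≤ 1) :
    2^(2*n) * (min (2^(-n)*r1) S1 * min (2^(-n)*r2) S2 * min (2^(-n)*r3) S3) ≤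
    (2:ℝ)^((n:ℝ)*(2-2*t-t')) * (r1^t*S1^(1-t)*(r2^t*S2^(1-t))*(r3^t'*S3^(1-t'))) := by
  have pn : (0:ℝ) < 2^(-n) := by positivity
  have e : ∀ s : ℝ, ((2:ℝ)^(-n))^s = 2^(-(n:ℝ)*s) := by
    intro s
    rw [← Real.rpow_intCast, ← Real.rpow_mul two_pos.le]; push_cast; rfl
  have a1 := min_rpow (mul_pos pn pr1) pS1 h0 h1
  have a2 := min_rpow (mul_pos pn pr2) pS2 h0 h1
  have a3 := min_rpow (mul_pos pn pr3) pS3 h0' h1'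
  rw [Real.mul_rpow pn.le pr1.le, e] at a1
  rw [Real.mul_rpow pn.le pr2.le, e] at a2
  rw [Real.mul_rpow pn.le pr3.le, e] at a3
  have m1 : 0 < min (2^(-n)*r1) S1 := lt_min (by positivity) pS1
  have m2 : 0 < min (2^(-n)*r2) S2 := lt_min (by positivity) pS2
  have m3 : 0 < min (2^(-n)*r3) S3 := lt_min (by positivity) pS3
  have e2 : (2:ℝ)^(2*n) = 2^((n:ℝ)*2) := by
    rw [← Real.rpow_intCast]; push_cast; rw [mul_comm]
  rw [e2]
  calc _ ≤ (2:ℝ)^((n:ℝ)*2) * ((2^(-(n:ℝ)*t)*r1^t*S1^(1-t)) * (2^(-(n:ℝ)*t)*r2^t*S2^(1-t)) * (2^(-(n:ℝ)*t')*r3^t'*S3^(1-t'))) := by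
        gcongr
    _ = (2^((n:ℝ)*2) * 2^(-(n:ℝ)*t) * 2^(-(n:ℝ)*t) * 2^(-(n:ℝ)*t')) * (r1^t*S1^(1-t)*(r2^t*S2^(1-t))*(r3^t'*S3^(1-t'))) := by ring
    _ = _ := by
        rw [← Real.rpow_add two_pos, ← Real.rpow_add two_pos, ← Real.rpow_add two_pos]
        congr 2; ring

/-- geometric two sided sum -/
lemma geo2 {q : ℝ} (q0 : 0 ≤ q) (q1 : q < 1) (K J : ℕ) :
    ∑ j ∈ Finset.range J, q^((-(K:ℤ)+j).natAbs) ≤ 2/(1-q) := by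
  have hs := summable_geometric_of_lt_one q0 q1
  have ht := tsum_geometric_of_lt_one q0 q1
  have h : ∀ S : Finset ℕ, ∑ j ∈ S, q^j ≤ 1/(1-q) := fun S => by
    rw [one_div, ← ht]; exact hs.sum_le_tsum _ (fun _ _ => by positivity)
  have h1 : ∑ j ∈ (Finset.range J).filter (fun j => K ≤ j), q^((-(K:ℤ)+j).natAbs) ≤ 1/(1-q) := by
    rw [← Finset.sum_image (f := fun i => q^i) (g := fun j : ℕ => (-(K:ℤ)+j).natAbs)]
    · exact h _
    · intro a ha b hb hab
      simp only [Finset.coe_filter, Set.mem_setOf_eq] at ha hb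
      simp only at hab
      omega
  have h2 : ∑ j ∈ (Finset.range J).filter (fun j => ¬ K ≤ j), q^((-(K:ℤ)+j).natAbs) ≤ 1/(1-q) := by
    rw [← Finset.sum_image (f := fun i => q^i) (g := fun j : ℕ => (-(K:ℤ)+j).natAbs)]
    · exact h _
    · intro a ha b hb hab
      simp only [Finset.coe_filter, Set.mem_setOf_eq] at ha hb
      simp only at hab
      omega
  rw [← Finset.sum_filter_add_sum_filter_not _ (fun j => K ≤ j)]
  calc _ ≤ 1/(1-q) + 1/(1-q) := add_le_add h1 h2
    _ = _ := by ring

theorem class_est {A1 A2 A3 : ℤ → ℕ → ℕ → ℂ} (hA1 : IsAmp A1) (hA2 : IsAmp A2) (hA3 : IsAmp A3)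
    {M : ℕ} {bad : ℤ → ℕ → Prop} (hbad : DownC bad) (hz : ∀ k n l, bad k n → A2 k n l = 0)
    {PP : Finset Bitile} (hc : Conv PP) (hnb : ∀ P ∈ PP, ¬ bad P.k P.n)
    {r1 r2 r3 S1 S2 S3 : ℝ} (pr1 : 0 < r1) (pr2 : 0 < r2) (pr3 : 0 < r3)
    (pS1 : 0 < S1) (pS2 : 0 < S2) (pS3 : 0 < S3)
    (B1 : Bessel A1 (r1^2)) (B2 : Bessel A2 (r2^2)) (B3 : Bessel A3 (r3^2))
    (Y1 : SizeLE A1 0 (fun _ _ => False) PP S1)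
    (Y2 : SizeLE A2 (M+1) (fun _ _ => False) PP S2)
    (Y3 : SizeLE A3 (M+1) bad PP S3) {δ : ℝ} (hδ : 0 < δ) (hδ' : δ ≤ 1/8) :
    ‖∑ P ∈ PP, Lam A1 A2 A3 M P‖ ≤ 1224 * (2/(1-(2:ℝ)^(-(2*δ)))) *
      (r1^(1-2*δ)*S1^(2*δ)*(r2^(1-2*δ)*S2^(2*δ))*(r3^(6*δ)*S3^(1-6*δ))
      + r1^(1-2*δ)*S1^(2*δ)*(r2^(1-2*δ)*S2^(2*δ))*(r3^(2*δ)*S3^(1-2*δ))) := by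
  set D1 := r1^(1-2*δ)*S1^(2*δ)*(r2^(1-2*δ)*S2^(2*δ))*(r3^(6*δ)*S3^(1-6*δ)) with hD1
  set D2 := r1^(1-2*δ)*S1^(2*δ)*(r2^(1-2*δ)*S2^(2*δ))*(r3^(2*δ)*S3^(1-2*δ)) with hD2
  have pD1 : 0 < D1 := by positivity
  have pD2 : 0 < D2 := by positivity
  set q : ℝ := (2:ℝ)^(-(2*δ)) with hq
  have q0 : 0 ≤ q := by positivity
  have q1 : q < 1 := Real.rpow_lt_one_of_one_lt_of_neg one_lt_two (by linarith)
  have lev : ∀ n : ℤ, 2^(2*n) * (min (2^(-n)*r1) S1 * min (2^(-n)*r2) S2 * min (2^(-n)*r3) S3) ≤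
      q^n.natAbs * (D1+D2) := by
    intro n
    have x1 := lev_num n pr1 pr2 pr3 pS1 pS2 pS3 (t := 1-2*δ) (t' := 6*δ) (by linarith) (by linarith)
      (by linarith) (by linarith)
    have x2 := lev_num n pr1 pr2 pr3 pS1 pS2 pS3 (t := 1-2*δ) (t' := 2*δ) (by linarith) (by linarith)
      (by linarith) (by linarith)
    rw [show 1-(1-2*δ) = 2*δ by ring] at x1 x2
    have pq : 0 < q^n.natAbs := by positivity
    rcases le_or_gt 0 n with hn | hn
    · have e : (2:ℝ)^((n:ℝ)*(2-2*(1-2*δ)-6*δ)) = q^n.natAbs := by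
        rw [hq, ← Real.rpow_natCast, ← Real.rpow_mul two_pos.le]
        congr 1
        have : ((n.natAbs:ℕ):ℝ) = n := by
          rw [← Int.cast_natCast, Int.natAbs_of_nonneg hn]
        rw [this]; ring
      rw [e] at x1
      refine x1.trans ?_
      gcongr; linarith
    · have e : (2:ℝ)^((n:ℝ)*(2-2*(1-2*δ)-2*δ)) = q^n.natAbs := by
        rw [hq, ← Real.rpow_natCast, ← Real.rpow_mul two_pos.le]
        congr 1
        have : ((n.natAbs:ℕ):ℝ) = -n := by
          rw [← Int.cast_natCast, Int.ofNat_natAbs_of_nonpos hn.le]; push_cast; ring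
        rw [this]; ring
      rw [e] at x2
      refine x2.trans ?_
      gcongr; linarith
  obtain ⟨K, hK⟩ : ∃ K : ℕ, S1/r1 ≤ 2^K ∧ S2/r2 ≤ 2^K ∧ S3/r3 ≤ 2^K := by
    obtain ⟨K, hK⟩ := pow_unbounded_of_one_lt (max (S1/r1) (max (S2/r2) (S3/r3))) (one_lt_two (α := ℝ))
    exact ⟨K, (le_max_left _ _).trans hK.le, ((le_max_left _ _).trans (le_max_right _ _)).trans hK.le,
      ((le_max_right _ _).trans (le_max_right _ _)).trans hK.le⟩
  have mn : ∀ {S r : ℝ}, 0 < r → S/r ≤ 2^K → min (2^(-(-(K:ℤ)))*r) S = S := by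
    intro S r hr h
    rw [neg_neg, zpow_natCast]
    exact min_eq_right ((div_le_iff₀ hr).1 h)
  -- tail
  set X := ∑ P ∈ PP, (2:ℝ)^P.k with hX
  have bound : ∀ J : ℕ, ‖∑ P ∈ PP, Lam A1 A2 A3 M P‖ ≤
      1224 * (2/(1-q)) * (D1+D2) + (2^K*r1*S2*S3*X) * (1/2)^J := by
    intro J
    obtain ⟨QQ, hQ, hcQ, z1, z2, z3, hb⟩ := level_iter hA1 hA2 hA3 hbad hz hc hnb pr1 pr2 pr3 pS1 pS2 pS3
      B1 B2 B3 (-(K:ℤ)) (by rw [mn pr1 hK.1]; exact Y1) (by rw [mn pr2 hK.2.1]; exact Y2)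
      (by rw [mn pr3 hK.2.2]; exact Y3) Y1 Y2 Y3 J
    refine hb.trans (add_le_add ?_ ?_)
    · calc _ ≤ ∑ j ∈ Finset.range J, 1224 * (q^((-(K:ℤ)+j).natAbs) * (D1+D2)) :=
            Finset.sum_le_sum fun j _ => by linarith [lev (-(K:ℤ)+j)]
        _ = 1224 * (∑ j ∈ Finset.range J, q^((-(K:ℤ)+j).natAbs)) * (D1+D2) := by
            rw [← Finset.mul_sum, ← Finset.sum_mul]; ring
        _ ≤ _ := by
            have := geo2 q0 q1 K J
            gcongr
    · have pp : (0:ℝ) < 2^(-(-(K:ℤ)+J)) := by positivity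
      have m1 : 0 < min (2^(-(-(K:ℤ)+J))*r1) S1 := lt_min (by positivity) pS1
      have ep : (2:ℝ)^(-(-(K:ℤ)+J)) = 2^K * (1/2)^J := by
        rw [neg_add, neg_neg, zpow_add₀ two_ne_zero, zpow_neg, zpow_natCast, zpow_natCast, one_div, inv_pow]
      refine (norm_sum_le _ _).trans ?_
      calc ∑ P ∈ QQ, ‖Lam A1 A2 A3 M P‖ ≤ ∑ P ∈ QQ, (2^K*r1*S2*S3) * (1/2)^J * 2^P.k := by
            refine Finset.sum_le_sum fun P hP => ?_
            have l := Lam_bound (A1 := A1) (A2 := A2) (A3 := A3) M P (bad := bad) hz m1 pS2 pS3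
              (z1.amp_le hA1 downC_false m1 hP (by omega))
            have u2 := (Y2.mono hQ).en_le hA2 downC_false hP (b := 0) two_pos
            have u3 := (Y3.mono hQ).en_le hA3 hbad hP (b := 0) two_pos
            refine l.trans ?_
            have pk : (0:ℝ) < 2^P.k := by positivity
            calc _ ≤ (2^(-(-(K:ℤ)+J))*r1) * ((S3/S2 * (S2^2*2^P.k) + S2/S3 * (S3^2*2^P.k))/2) := by
                  gcongr
                  · have := en_nonneg A2 (M+1) (fun _ _ => False) 0 P
                    have := en_nonneg A3 (M+1) bad 0 P
                    positivity
                  · exact min_le_left _ _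
              _ = _ := by rw [ep]; field_simp; ring
        _ ≤ ∑ P ∈ PP, (2^K*r1*S2*S3) * (1/2)^J * 2^P.k :=
            Finset.sum_le_sum_of_subset_of_nonneg hQ fun P _ _ => by positivity
        _ = _ := by rw [← Finset.mul_sum]; ring
  have lim : Filter.Tendsto (fun J : ℕ => 1224 * (2/(1-q)) * (D1+D2) + (2^K*r1*S2*S3*X) * (1/2:ℝ)^J)
      Filter.atTop (nhds (1224 * (2/(1-q)) * (D1+D2) + (2^K*r1*S2*S3*X) * 0)) :=
    ((_root_.tendsto_pow_atTop_nhds_zero_of_lt_one (by norm_num) (by norm_num)).const_mul _).const_add _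
  rw [mul_zero, add_zero] at lim
  exact ge_of_tendsto' lim bound

end Work

section Work
open Classical

lemma walsh_zero (x : ℝ) : walsh 0 x = if 0 ≤ x ∧ x < 1 then 1 else 0 := by
  rw [walsh]; simp

lemma walsh_even (l : ℕ) (x : ℝ) : walsh (2*l) x = walsh l (2*x) + walsh l (2*x-1) := by
  rcases Nat.eq_zero_or_pos l with rfl | h
  · rw [mul_zero, walsh_zero, walsh_zero, walsh_zero]
    by_cases h1 : 0 ≤ x ∧ x < 1
    · by_cases h2 : 2*x < 1
      · rw [if_pos h1, if_pos ⟨by linarith, h2⟩, if_neg (fun h => by linarith [h.1])]; norm_num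
      · rw [if_pos h1, if_neg (fun h => h2 h.2), if_pos ⟨by linarith, by linarith⟩]; norm_num
    · rw [if_neg h1, if_neg (fun h => h1 ⟨by linarith [h.1], by linarith [h.2]⟩),
        if_neg (fun h => h1 ⟨by linarith [h.1], by linarith [h.2]⟩)]; norm_num
  · rw [walsh, dif_neg (by omega), if_pos (by omega), Nat.mul_div_cancel_left _ two_pos]

lemma walsh_odd (l : ℕ) (x : ℝ) : walsh (2*l+1) x = walsh l (2*x) - walsh l (2*x-1) := by
  rw [walsh, dif_neg (by omega), if_neg (by omega), show (2*l+1)/2 = l by omega]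

/-- sup normalized packets -/
def ww (k : ℤ) (n l : ℕ) (x : ℝ) : ℝ := walsh l ((2:ℝ)^(-k) * x - n)

lemma two_zpow_pred (k : ℤ) : (2:ℝ)^(-(k-1)) = 2 * 2^(-k) := by
  rw [show -(k-1) = 1 + -k by ring, zpow_add₀ two_ne_zero, zpow_one]

lemma ww_even (k : ℤ) (n l : ℕ) (x : ℝ) :
    ww k n (2*l) x = ww (k-1) (2*n) l x + ww (k-1) (2*n+1) l x := by
  unfold ww
  rw [walsh_even, two_zpow_pred]; push_cast; congr 2 <;> ring

lemma ww_odd (k : ℤ) (n l : ℕ) (x : ℝ) :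
    ww k n (2*l+1) x = ww (k-1) (2*n) l x - ww (k-1) (2*n+1) l x := by
  unfold ww
  rw [walsh_odd, two_zpow_pred]; push_cast; congr 2 <;> ring

lemma mem_dyadicI {k : ℤ} {n : ℕ} {x : ℝ} :
    x ∈ dyadicI k n ↔ 0 ≤ (2:ℝ)^(-k) * x - n ∧ (2:ℝ)^(-k) * x - n < 1 := by
  unfold dyadicI
  have p : (0:ℝ) < 2^k := by positivity
  rw [Set.mem_Ico, zpow_neg, sub_nonneg, sub_lt_iff_lt_add, le_inv_mul_iff₀ p, inv_mul_lt_iff₀ p, add_comm (1:ℝ)]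

lemma dyadicI_disj {k : ℤ} {n n' : ℕ} {x : ℝ} (h : x ∈ dyadicI k n) (h' : x ∈ dyadicI k n') : n = n' := by
  rw [mem_dyadicI] at h h'
  have a : (n:ℝ) < n' + 1 := by linarith [h.1, h'.2]
  have b : (n':ℝ) < n + 1 := by linarith [h.2, h'.1]
  have a' : n < n'+1 := by exact_mod_cast a
  have b' : n' < n+1 := by exact_mod_cast b
  omega

lemma dyadicI_split (k : ℤ) (n : ℕ) : dyadicI k n = dyadicI (k-1) (2*n) ∪ dyadicI (k-1) (2*n+1) := by
  ext x
  rw [Set.mem_union, mem_dyadicI, mem_dyadicI, mem_dyadicI, two_zpow_pred]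
  push_cast
  constructor
  · rintro ⟨a, b⟩
    by_cases h : 2*2^(-k)*x - 2*n < 1
    · left; exact ⟨by linarith, h⟩
    · right; constructor <;> linarith
  · rintro (⟨a, b⟩ | ⟨a, b⟩) <;> constructor <;> linarith

lemma dyadicI_parent (k : ℤ) (j m : ℕ) : dyadicI (k-j) m ⊆ dyadicI k (m/2^j) := by
  induction j generalizing m with
  | zero => simp
  | succ j ih =>
    have h1 : dyadicI (k-(j+1:ℕ)) m ⊆ dyadicI (k-j) (m/2) := by
      rw [dyadicI_split (k-j), show k - ((j+1:ℕ):ℤ) = k - j - 1 by push_cast; ring]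
      rcases Nat.even_or_odd' m with ⟨c, rfl | rfl⟩
      · rw [Nat.mul_div_cancel_left _ two_pos]; exact subset_union_left
      · rw [show (2*c+1)/2 = c by omega]; exact subset_union_right
    have := ih (m/2)
    rw [Nat.div_div_eq_div_mul, ← pow_succ'] at this
    exact h1.trans this

lemma measurableSet_dyadicI (k : ℤ) (n : ℕ) : MeasurableSet (dyadicI k n) := measurableSet_Ico

lemma volume_dyadicI (k : ℤ) (n : ℕ) : volume (dyadicI k n) = ENNReal.ofReal (2^k) := by
  rw [dyadicI, Real.volume_Ico]; congr 1; ring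

lemma walsh_sq (l : ℕ) : ∀ x : ℝ, walsh l x * walsh l x = if 0 ≤ x ∧ x < 1 then 1 else 0 := by
  induction l using Nat.strong_induction_on with
  | _ l ih =>
    intro x
    rcases Nat.eq_zero_or_pos l with rfl | hl
    · rw [walsh_zero]; split_ifs <;> norm_num
    have hc : ∀ m, m < l → walsh m (2*x) * walsh m (2*x-1) = 0 := by
      intro m hm
      have h1 := ih m hm (2*x)
      have h2 := ih m hm (2*x-1)
      by_cases h : 2*x < 1
      · rw [if_neg (fun h => by linarith [h.1])] at h2
        rw [mul_self_eq_zero.1 h2, mul_zero]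
      · rw [if_neg (fun h' => h h'.2)] at h1
        rw [mul_self_eq_zero.1 h1, zero_mul]
    have key : ∀ m, m < l → walsh m (2*x) * walsh m (2*x) + walsh m (2*x-1)* walsh m (2*x-1) = if 0 ≤ x ∧ x < 1 then 1 else 0 := by
      intro m hm
      rw [ih m hm, ih m hm]
      by_cases h1 : 0 ≤ x ∧ x < 1
      · by_cases h2 : 2*x < 1
        · rw [if_pos h1, if_pos ⟨by linarith, h2⟩, if_neg (fun h => by linarith [h.1])]; norm_num
        · rw [if_pos h1, if_neg (fun h => h2 h.2), if_pos ⟨by linarith, by linarith⟩]; norm_num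
      · rw [if_neg h1, if_neg (fun h => h1 ⟨by linarith [h.1], by linarith [h.2]⟩),
          if_neg (fun h => h1 ⟨by linarith [h.1], by linarith [h.2]⟩)]; norm_num
    rcases Nat.even_or_odd' l with ⟨c, rfl | rfl⟩
    · rw [walsh_even, ← key c (by omega)]; linear_combination 2 * hc c (by omega)
    · rw [walsh_odd, ← key c (by omega)]; linear_combination -2 * hc c (by omega)

lemma walsh_meas (l : ℕ) : Measurable (walsh l) := by
  induction l using Nat.strong_induction_on with
  | _ l ih =>
    rcases Nat.eq_zero_or_pos l with rfl | hl
    · have : walsh 0 = (Ico (0:ℝ) 1).indicator 1 := by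
        ext x; rw [walsh_zero]; simp [Set.indicator, Set.mem_Ico]
      rw [this]; exact measurable_one.indicator measurableSet_Ico
    · rcases Nat.even_or_odd' l with ⟨c, rfl | rfl⟩
      · have : walsh (2*c) = fun x => walsh c (2*x) + walsh c (2*x-1) := by ext x; rw [walsh_even]
        rw [this]
        have := ih c (by omega)
        exact (this.comp (by fun_prop)).add (this.comp (by fun_prop))
      · have : walsh (2*c+1) = fun x => walsh c (2*x) - walsh c (2*x-1) := by ext x; rw [walsh_odd]
        rw [this]
        have := ih c (by omega)
        exact (this.comp (by fun_prop)).sub (this.comp (by fun_prop))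

lemma ww_meas (k : ℤ) (n l : ℕ) : Measurable (ww k n l) := (walsh_meas l).comp (by fun_prop)

lemma ww_sq (k : ℤ) (n l : ℕ) (x : ℝ) : ww k n l x * ww k n l x = (dyadicI k n).indicator 1 x := by
  unfold ww
  rw [walsh_sq, Set.indicator]
  simp only [mem_dyadicI, Pi.one_apply]

lemma ww_off {k : ℤ} {n l : ℕ} {x : ℝ} (h : x ∉ dyadicI k n) : ww k n l x = 0 := by
  have := ww_sq k n l x
  rw [Set.indicator_of_notMem h] at this
  exact mul_self_eq_zero.1 this

lemma ww_abs (k : ℤ) (n l : ℕ) (x : ℝ) : |ww k n l x| = (dyadicI k n).indicator 1 x := by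
  have := ww_sq k n l x
  rw [← abs_mul_abs_self] at this
  by_cases h : x ∈ dyadicI k n
  · rw [Set.indicator_of_mem h] at this ⊢
    simp only [Pi.one_apply] at this ⊢
    nlinarith [abs_nonneg (ww k n l x)]
  · rw [ww_off h, Set.indicator_of_notMem h, abs_zero]

lemma ww_abs_le (k : ℤ) (n l : ℕ) (x : ℝ) : |ww k n l x| ≤ 1 := by
  rw [ww_abs]; exact Set.indicator_le_self' (fun _ _ => zero_le_one) x

lemma ww_int (k : ℤ) (n l : ℕ) : Integrable (ww k n l) := by
  have : Integrable ((dyadicI k n).indicator (1:ℝ → ℝ)) := by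
    refine (integrable_indicator_iff (measurableSet_dyadicI k n)).2 ?_
    refine integrableOn_const (C := (1:ℝ)) ?_ ?_
    · rw [volume_dyadicI]; exact ofReal_ne_top
    · simp
  refine this.mono (ww_meas k n l).aestronglyMeasurable (Filter.Eventually.of_forall fun x => ?_)
  rw [Real.norm_eq_abs, ww_abs, Real.norm_eq_abs]
  exact le_abs_self _

lemma ww_int_mul (k : ℤ) (n l : ℕ) (k' : ℤ) (n' l' : ℕ) : Integrable (fun x => ww k n l x * ww k' n' l' x) := by
  refine (ww_int k n l).mono ((ww_meas k n l).mul (ww_meas k' n' l')).aestronglyMeasurable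
    (Filter.Eventually.of_forall fun x => ?_)
  rw [norm_mul]
  exact mul_le_of_le_one_right (norm_nonneg _) (ww_abs_le _ _ _ _)

/-- L2 inner product of packets -/
def ip (k : ℤ) (n l : ℕ) (k' : ℤ) (n' l' : ℕ) : ℝ := ∫ x, ww k n l x * ww k' n' l' x

lemma ip_self (k : ℤ) (n l : ℕ) : ip k n l k n l = 2^k := by
  unfold ip
  simp only [ww_sq]
  rw [integral_indicator_one (measurableSet_dyadicI k n), measureReal_def, volume_dyadicI,
    ENNReal.toReal_ofReal (by positivity)]

lemma ip_ne {k : ℤ} {n n' l l' : ℕ} (h : n ≠ n') : ip k n l k n' l' = 0 := by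
  unfold ip
  have : ∀ x, ww k n l x * ww k n' l' x = 0 := by
    intro x
    by_cases h1 : x ∈ dyadicI k n
    · rw [ww_off (n := n') (fun h2 => h (dyadicI_disj h1 h2)), mul_zero]
    · rw [ww_off h1, zero_mul]
  simp [this]

lemma ip_comm (k : ℤ) (n l : ℕ) (k' : ℤ) (n' l' : ℕ) : ip k n l k' n' l' = ip k' n' l' k n l := by
  unfold ip; simp only [mul_comm]

lemma ip_even (k : ℤ) (n l : ℕ) (k' : ℤ) (n' l' : ℕ) :
    ip k n l k' n' (2*l') = ip k n l (k'-1) (2*n') l' + ip k n l (k'-1) (2*n'+1) l' := by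
  unfold ip
  simp only [ww_even, mul_add]
  exact integral_add (ww_int_mul _ _ _ _ _ _) (ww_int_mul _ _ _ _ _ _)

lemma ip_odd (k : ℤ) (n l : ℕ) (k' : ℤ) (n' l' : ℕ) :
    ip k n l k' n' (2*l'+1) = ip k n l (k'-1) (2*n') l' - ip k n l (k'-1) (2*n'+1) l' := by
  unfold ip
  simp only [ww_odd, mul_sub]
  exact integral_sub (ww_int_mul _ _ _ _ _ _) (ww_int_mul _ _ _ _ _ _)

lemma ip_freq (N : ℕ) : ∀ (k : ℤ) (n l l' : ℕ), l + l' ≤ N → l ≠ l' → ip k n l k n l' = 0 := by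
  induction N with
  | zero => intro k n l l' h hne; omega
  | succ N ih =>
    intro k n l l' h hne
    have z1 : ∀ a b, ip (k-1) (2*n) a (k-1) (2*n+1) b = 0 := fun a b => ip_ne (by omega)
    have z2 : ∀ a b, ip (k-1) (2*n+1) a (k-1) (2*n) b = 0 := fun a b => ip_ne (by omega)
    have ex : ∀ a b, ip (k-1) (2*n) a k n (2*b) = ip (k-1) (2*n) a (k-1) (2*n) b := fun a b => by
      rw [ip_even, z1, add_zero]
    have ey : ∀ a b, ip (k-1) (2*n+1) a k n (2*b) = ip (k-1) (2*n+1) a (k-1) (2*n+1) b := fun a b => by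
      rw [ip_even, z2, zero_add]
    have ox : ∀ a b, ip (k-1) (2*n) a k n (2*b+1) = ip (k-1) (2*n) a (k-1) (2*n) b := fun a b => by
      rw [ip_odd, z1, sub_zero]
    have oy : ∀ a b, ip (k-1) (2*n+1) a k n (2*b+1) = -ip (k-1) (2*n+1) a (k-1) (2*n+1) b := fun a b => by
      rw [ip_odd, z2, zero_sub]
    rcases Nat.even_or_odd' l with ⟨a, rfl | rfl⟩ <;> rcases Nat.even_or_odd' l' with ⟨b, rfl | rfl⟩
    · rw [ip_even, ip_comm, ex, ip_comm k n, ey, ih _ _ _ _ (by omega) (by omega), ih _ _ _ _ (by omega) (by omega), add_zero]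
    · rw [ip_odd, ip_comm, ex, ip_comm k n, ey]
      by_cases hab : a = b
      · subst hab; rw [ip_self, ip_self, sub_self]
      · rw [ih _ _ _ _ (by omega) (by omega), ih _ _ _ _ (by omega) (by omega), sub_self]
    · rw [ip_even, ip_comm, ox, ip_comm k n, oy]
      by_cases hab : a = b
      · subst hab; rw [ip_self, ip_self]; ring
      · rw [ih _ _ _ _ (by omega) (by omega), ih _ _ _ _ (by omega) (by omega)]; ring
    · rw [ip_odd, ip_comm, ox, ip_comm k n, oy, ih _ _ _ _ (by omega) (by omega), ih _ _ _ _ (by omega) (by omega)]; ring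

lemma ip_tile (j : ℕ) : ∀ (k : ℤ) (m n l l' : ℕ), l'/2^j ≠ l → ip (k-j) m l k n l' = 0 := by
  induction j with
  | zero =>
    intro k m n l l' h
    simp only [pow_zero, Nat.div_one] at h
    simp only [Nat.cast_zero, sub_zero]
    by_cases hm : m = n
    · subst hm; exact ip_freq _ _ _ _ _ le_rfl h.symm
    · exact ip_ne hm
  | succ j ih =>
    intro k m n l l' h
    have h' : (l'/2)/2^j ≠ l := by rwa [Nat.div_div_eq_div_mul, ← pow_succ']
    have e : k - ((j+1:ℕ):ℤ) = (k-1) - j := by push_cast; ring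
    rcases Nat.even_or_odd' l' with ⟨b, rfl | rfl⟩
    · rw [Nat.mul_div_cancel_left _ two_pos] at h'
      rw [ip_even, e, ih _ _ _ _ _ h', ih _ _ _ _ _ h', add_zero]
    · rw [show (2*b+1)/2 = b by omega] at h'
      rw [ip_odd, e, ih _ _ _ _ _ h', ih _ _ _ _ _ h', sub_zero]

lemma ip_tile' {j : ℕ} {k : ℤ} {m n l l' : ℕ} (h : m/2^j ≠ n) : ip (k-j) m l k n l' = 0 := by
  unfold ip
  have : ∀ x, ww (k-j) m l x * ww k n l' x = 0 := by
    intro x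
    by_cases h1 : x ∈ dyadicI (k-j) m
    · rw [ww_off (n := n) (fun h2 => h (dyadicI_disj (dyadicI_parent k j m h1) h2)), mul_zero]
    · rw [ww_off h1, zero_mul]
  simp [this]

lemma ip_incomp_aux {p q : Tile} (h : ¬ tle p q) (hk : p.k ≤ q.k) : ip p.k p.n p.l q.k q.n q.l = 0 := by
  obtain ⟨j, hj⟩ := Int.le.dest hk
  have hp : p.k = q.k - j := by linarith
  unfold tle at h
  push Not at h
  have := h j hp
  rw [hp]
  by_cases h1 : p.n/2^j = q.n
  · exact ip_tile _ _ _ _ _ _ (this h1)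
  · exact ip_tile' h1

lemma ip_incomp {p q : Tile} (h : ¬ tle p q) (h' : ¬ tle q p) : ip p.k p.n p.l q.k q.n q.l = 0 := by
  rcases le_total p.k q.k with hk | hk
  · exact ip_incomp_aux h hk
  · rw [ip_comm]; exact ip_incomp_aux h' hk

end Work

section Work
open Classical

structure Adm (f : ℝ → ℂ) (E : Set ℝ) : Prop where
  fm : Measurable f
  em : MeasurableSet E
  ev : volume E < ∞
  le : ∀ x, ‖f x‖ ≤ E.indicator (1 : ℝ → ℝ) x

def amp (f : ℝ → ℂ) (k : ℤ) (n l : ℕ) : ℂ := (2:ℂ)^(-k) * ∫ x, f x * (ww k n l x : ℂ)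

def rho (E : Set ℝ) (k : ℤ) (n : ℕ) : ℝ := (2:ℝ)^(-k) * volume.real (E ∩ dyadicI k n)

lemma int_ind {E : Set ℝ} (em : MeasurableSet E) (ev : volume E < ∞) :
    Integrable (E.indicator (1 : ℝ → ℝ)) := by
  refine (integrable_indicator_iff em).2 (integrableOn_const (C := (1:ℝ)) ev.ne ?_)
  simp

lemma Adm.le_one {f : ℝ → ℂ} {E : Set ℝ} (h : Adm f E) (x : ℝ) : ‖f x‖ ≤ 1 :=
  (h.le x).trans (Set.indicator_le_self' (fun _ _ => zero_le_one) x)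

lemma Adm.int {f : ℝ → ℂ} {E : Set ℝ} (h : Adm f E) : Integrable f := by
  refine (int_ind h.em h.ev).mono h.fm.aestronglyMeasurable (Filter.Eventually.of_forall fun x => ?_)
  exact (h.le x).trans (le_abs_self _)

lemma Adm.int_mul {f : ℝ → ℂ} {E : Set ℝ} (h : Adm f E) {g : ℝ → ℂ} (gm : Measurable g)
    (gb : ∀ x, ‖g x‖ ≤ 1) : Integrable (fun x => f x * g x) := by
  refine h.int.mono (h.fm.mul gm).aestronglyMeasurable (Filter.Eventually.of_forall fun x => ?_)
  rw [norm_mul]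
  exact mul_le_of_le_one_right (norm_nonneg _) (gb x)

lemma wwC_meas (k : ℤ) (n l : ℕ) : Measurable (fun x => (ww k n l x : ℂ)) :=
  Complex.measurable_ofReal.comp (ww_meas k n l)

lemma wwC_le (k : ℤ) (n l : ℕ) (x : ℝ) : ‖(ww k n l x : ℂ)‖ ≤ 1 := by
  rw [Complex.norm_real]; exact ww_abs_le k n l x

lemma Adm.int_ww {f : ℝ → ℂ} {E : Set ℝ} (h : Adm f E) (k : ℤ) (n l : ℕ) :
    Integrable (fun x => f x * (ww k n l x : ℂ)) := h.int_mul (wwC_meas k n l) (wwC_le k n l)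

lemma two_zpow_predC (k : ℤ) : (2:ℂ)^(-k) = 2^(-(k-1)) / 2 := by
  rw [show -(k-1) = -k + 1 by ring, zpow_add₀ two_ne_zero, zpow_one, mul_div_cancel_right₀ _ two_ne_zero]

lemma Adm.isAmp {f : ℝ → ℂ} {E : Set ℝ} (h : Adm f E) : IsAmp (amp f) := by
  intro k n l
  unfold amp
  constructor
  · simp only [ww_even, Complex.ofReal_add, mul_add]
    rw [integral_add (h.int_ww _ _ _) (h.int_ww _ _ _), two_zpow_predC k]; ring
  · simp only [ww_odd, Complex.ofReal_sub, mul_sub]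
    rw [integral_sub (h.int_ww _ _ _) (h.int_ww _ _ _), two_zpow_predC k]; ring

lemma rho_nonneg (E : Set ℝ) (k : ℤ) (n : ℕ) : 0 ≤ rho E k n := by unfold rho; positivity

lemma vol_inter_ne_top {k : ℤ} {n : ℕ} (E : Set ℝ) : volume (E ∩ dyadicI k n) ≠ ∞ :=
  ((measure_mono inter_subset_right).trans_lt (by rw [volume_dyadicI]; exact ofReal_lt_top)).ne

lemma rho_split {E : Set ℝ} (em : MeasurableSet E) (k : ℤ) (n : ℕ) :
    rho E k n = (rho E (k-1) (2*n) + rho E (k-1) (2*n+1))/2 := by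
  unfold rho
  rw [dyadicI_split, inter_union_distrib_left, two_zpow_pred]
  rw [measureReal_union ?_ (em.inter (measurableSet_dyadicI _ _)) (vol_inter_ne_top _) (vol_inter_ne_top _)]
  · ring
  · rw [Set.disjoint_left]
    rintro x ⟨_, h1⟩ ⟨_, h2⟩
    have := dyadicI_disj h1 h2
    omega

lemma rho_le_one (E : Set ℝ) (k : ℤ) (n : ℕ) : rho E k n ≤ 1 := by
  unfold rho
  have : volume.real (E ∩ dyadicI k n) ≤ 2^k := by
    rw [measureReal_def]
    refine ENNReal.toReal_le_of_le_ofReal (by positivity) ?_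
    rw [← volume_dyadicI k n]; exact measure_mono inter_subset_right
  rw [zpow_neg, inv_mul_le_iff₀ (by positivity)]
  linarith

lemma rho_mono {E E' : Set ℝ} (h : E ⊆ E') (k : ℤ) (n : ℕ) : rho E k n ≤ rho E' k n := by
  unfold rho
  gcongr
  exact vol_inter_ne_top _

lemma Adm.amp_le {f : ℝ → ℂ} {E : Set ℝ} (h : Adm f E) (k : ℤ) (n l : ℕ) : ‖amp f k n l‖ ≤ rho E k n := by
  unfold amp rho
  rw [norm_mul, norm_zpow, Complex.norm_ofNat]
  gcongr
  refine (norm_integral_le_integral_norm _).trans ?_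
  rw [← integral_indicator_one (h.em.inter (measurableSet_dyadicI k n))]
  refine integral_mono_of_nonneg (Filter.Eventually.of_forall fun x => norm_nonneg _)
    (int_ind (h.em.inter (measurableSet_dyadicI k n)) ((measure_mono inter_subset_left).trans_lt h.ev)) ?_
  refine Filter.Eventually.of_forall fun x => ?_
  simp only [norm_mul, Complex.norm_real, Real.norm_eq_abs, ww_abs]
  rw [Set.inter_indicator_one]
  simp only [Pi.mul_apply]
  exact mul_le_mul_of_nonneg_right (h.le x) (Set.indicator_nonneg (fun _ _ => zero_le_one) x)

lemma amp_zero {f : ℝ → ℂ} {k : ℤ} {n : ℕ} (h : ∀ x ∈ dyadicI k n, f x = 0) (l : ℕ) : amp f k n l = 0 := by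
  unfold amp
  have : ∀ x, f x * (ww k n l x : ℂ) = 0 := by
    intro x
    by_cases hx : x ∈ dyadicI k n
    · rw [h x hx, zero_mul]
    · rw [ww_off hx]; simp
  simp [this]

lemma amp_congr {f g : ℝ → ℂ} {k : ℤ} {n : ℕ} (h : ∀ x ∈ dyadicI k n, f x = g x) (l : ℕ) :
    amp f k n l = amp g k n l := by
  unfold amp
  congr 2
  ext x
  by_cases hx : x ∈ dyadicI k n
  · rw [h x hx]
  · rw [ww_off hx]; simp

lemma ip_incomp' {U : Finset Tile} (hU : Incomp U) {p q : Tile} (hp : p ∈ U) (hq : q ∈ U) :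
    ip p.k p.n p.l q.k q.n q.l = if p = q then 2^p.k else 0 := by
  split_ifs with h
  · subst h; exact ip_self _ _ _
  · exact ip_incomp (hU p hp q hq h) (hU q hq p hp (Ne.symm h))

lemma Adm.int_amp {f : ℝ → ℂ} (k : ℤ) (n l : ℕ) : ∫ x, f x * (ww k n l x : ℂ) = 2^k * amp f k n l := by
  unfold amp
  rw [← mul_assoc, ← zpow_add₀ two_ne_zero]; simp

lemma Adm.bessel {f : ℝ → ℂ} {E : Set ℝ} (h : Adm f E) : Bessel (amp f) (volume.real E) := by
  intro U hU
  set a : Tile → ℂ := fun p => amp f p.k p.n p.l with ha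
  set w : Tile → ℝ → ℂ := fun p x => (ww p.k p.n p.l x : ℂ) with hw
  set g : ℝ → ℂ := fun x => ∑ p ∈ U, a p * w p x with hg
  set T : ℝ := ∑ p ∈ U, EE (amp f) p.k p.n p.l with hT
  have wi : ∀ p q, Integrable (fun x => w p x * w q x) := fun p q => by
    have := (ww_int_mul p.k p.n p.l q.k q.n q.l).ofReal (𝕜 := ℂ)
    simpa [hw] using this
  have fw : ∀ p, Integrable (fun x => f x * w p x) := fun p => h.int_ww _ _ _
  have ff : Integrable (fun x => f x * (starRingEnd ℂ) (f x)) := by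
    refine h.int_mul (Complex.continuous_conj.measurable.comp h.fm) fun x => ?_
    simpa using h.le_one x
  set H : ℝ → ℂ := fun x => f x * (starRingEnd ℂ) (f x)
    - 2 * ∑ p ∈ U, (starRingEnd ℂ) (a p) * (f x * w p x)
    + ∑ p ∈ U, ∑ q ∈ U, a p * (starRingEnd ℂ) (a q) * (w p x * w q x) with hH
  have i2 : Integrable (fun x => 2 * ∑ p ∈ U, (starRingEnd ℂ) (a p) * (f x * w p x)) :=
    (integrable_finsetSum _ fun p _ => (fw p).const_mul _).const_mul _
  have i3 : Integrable (fun x => ∑ p ∈ U, ∑ q ∈ U, a p * (starRingEnd ℂ) (a q) * (w p x * w q x)) :=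
    integrable_finsetSum _ fun p _ => integrable_finsetSum _ fun q _ => (wi p q).const_mul _
  have Hi : Integrable H := (ff.sub i2).add i3
  have Hpos : ∀ x, 0 ≤ (H x).re := by
    intro x
    have : (H x).re = Complex.normSq (f x - g x) := by
      have e1 : ((Complex.normSq (f x - g x) : ℝ) : ℂ) = (f x - g x) * (starRingEnd ℂ) (f x - g x) :=
        (Complex.mul_conj _).symm
      have e2 : (starRingEnd ℂ) (g x) = ∑ p ∈ U, (starRingEnd ℂ) (a p) * w p x := by
        simp only [hg, map_sum, map_mul]
        refine Finset.sum_congr rfl fun p _ => ?_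
        rw [hw]; simp [Complex.conj_ofReal]
      have e3 : H x = f x * (starRingEnd ℂ) (f x) - 2 * (f x * (starRingEnd ℂ) (g x)) + g x * (starRingEnd ℂ) (g x) := by
        rw [e2]
        simp only [hH, hg]
        rw [Finset.mul_sum U _ (f x), Finset.sum_mul_sum]
        congr 1
        · congr 2
          exact Finset.sum_congr rfl fun p _ => by ring
        · exact Finset.sum_congr rfl fun p _ => Finset.sum_congr rfl fun q _ => by ring
      have e4 : (f x * (starRingEnd ℂ) (g x)).re = (g x * (starRingEnd ℂ) (f x)).re := by
        simp [Complex.mul_re]; ring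
      have e5 := congrArg Complex.re e1
      rw [Complex.ofReal_re] at e5
      rw [e5, e3, map_sub]
      have : (f x - g x) * ((starRingEnd ℂ) (f x) - (starRingEnd ℂ) (g x)) =
        f x * (starRingEnd ℂ) (f x) - f x * (starRingEnd ℂ) (g x) - g x * (starRingEnd ℂ) (f x) + g x * (starRingEnd ℂ) (g x) := by ring
      rw [this]
      simp only [Complex.add_re, Complex.sub_re, ← e4]
      rw [two_mul, Complex.add_re]; ring
    rw [this]; exact Complex.normSq_nonneg _
  have I0 : 0 ≤ (∫ x, H x).re := by
    have := integral_re (𝕜 := ℂ) Hi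
    simp only [RCLike.re_to_complex] at this
    rw [← this]
    exact integral_nonneg Hpos
  have wip : ∀ p q, ∫ x, w p x * w q x = (ip p.k p.n p.l q.k q.n q.l : ℂ) := fun p q => by
    unfold ip
    rw [← integral_complex_ofReal]
    simp [hw]
  have aa : ∀ p, (starRingEnd ℂ) (a p) * (2^p.k * a p) = (EE (amp f) p.k p.n p.l : ℝ) := fun p => by
    unfold EE
    have := Complex.mul_conj (a p)
    rw [Complex.normSq_eq_norm_sq] at this
    push_cast at this ⊢
    rw [← this]; simp only [ha]; ring
  have I1 : ∫ x, H x = (∫ x, f x * (starRingEnd ℂ) (f x)) - 2 * (T:ℂ) + T := by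
    simp only [hH]
    have i12 : Integrable (fun x => f x * (starRingEnd ℂ) (f x)
        - 2 * ∑ p ∈ U, (starRingEnd ℂ) (a p) * (f x * w p x)) := ff.sub i2
    rw [integral_add i12 i3, integral_sub ff i2]
    congr 1
    · congr 1
      rw [integral_const_mul, integral_finset_sum _ fun p _ => (fw p).const_mul _, hT, Complex.ofReal_sum]
      congr 1
      refine Finset.sum_congr rfl fun p _ => ?_
      rw [integral_const_mul, ← aa]
      simp only [hw, ha]
      rw [Adm.int_amp]
    · rw [integral_finset_sum _ fun p _ => integrable_finsetSum _ fun q _ => (wi p q).const_mul _, hT, Complex.ofReal_sum]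
      refine Finset.sum_congr rfl fun p hp => ?_
      rw [integral_finset_sum _ fun q _ => (wi p q).const_mul _, ← aa]
      simp only [integral_const_mul, wip]
      rw [Finset.sum_eq_single p]
      · rw [ip_self]; push_cast; ring
      · intro q hq hne
        rw [ip_incomp' hU hp hq, if_neg (Ne.symm hne)]; simp
      · intro hh; exact absurd hp hh
  have I2 : (∫ x, f x * (starRingEnd ℂ) (f x)).re ≤ volume.real E := by
    refine (Complex.re_le_norm _).trans ((norm_integral_le_integral_norm _).trans ?_)
    rw [← integral_indicator_one h.em]
    refine integral_mono_of_nonneg (Filter.Eventually.of_forall fun x => norm_nonneg _) (int_ind h.em h.ev) ?_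
    refine Filter.Eventually.of_forall fun x => ?_
    simp only [norm_mul, RCLike.norm_conj]
    exact (mul_le_of_le_one_right (norm_nonneg _) (h.le_one x)).trans (h.le x)
  rw [I1] at I0
  rw [two_mul] at I0
  simp only [Complex.add_re, Complex.sub_re, Complex.ofReal_re] at I0
  linarith

lemma Bessel.mono {A : ℤ → ℕ → ℕ → ℂ} {e e' : ℝ} (h : Bessel A e) (he : e ≤ e') : Bessel A e' :=
  fun U hU => (h U hU).trans he

end Work

section Work
open Classical

lemma dy_sub {a k : ℤ} {m n : ℕ} (h : Ico ((2:ℝ)^a*m) (2^a*(m+1)) ⊆ Ico ((2:ℝ)^k*n) (2^k*(n+1))) :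
    (2:ℝ)^k*n ≤ 2^a*m ∧ (2:ℝ)^a*(m+1) ≤ 2^k*(n+1) ∧ a ≤ k := by
  have pa : (0:ℝ) < 2^a := by positivity
  rw [Set.Ico_subset_Ico_iff (by linarith)] at h
  refine ⟨h.1, h.2, ?_⟩
  have : (2:ℝ)^a ≤ 2^k := by linarith [h.1, h.2]
  exact (zpow_le_zpow_iff_right₀ (by norm_num)).1 this

lemma dy_eq {a k : ℤ} {m n : ℕ} (h : Ico ((2:ℝ)^a*m) (2^a*(m+1)) ⊆ Ico ((2:ℝ)^k*n) (2^k*(n+1)))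
    (h' : Ico ((2:ℝ)^k*n) (2^k*(n+1)) ⊆ Ico ((2:ℝ)^a*m) (2^a*(m+1))) : a = k ∧ m = n := by
  have h1 := dy_sub h
  have h2 := dy_sub h'
  have e : a = k := le_antisymm h1.2.2 h2.2.2
  subst e
  have pa : (0:ℝ) < 2^a := by positivity
  have : (2:ℝ)^a*m = 2^a*n := le_antisymm h2.1 h1.1
  exact ⟨rfl, by exact_mod_cast mul_left_cancel₀ pa.ne' this⟩

lemma dilate_tile (L : ℕ) (p : Tile) :
    dilate L p.toSet = p.timeI ×ˢ Ico ((2:ℝ)^((L:ℤ)-p.k) * p.l) ((2:ℝ)^((L:ℤ)-p.k) * (p.l+1)) := by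
  have pL : (0:ℝ) < 2^L := by positivity
  have e : (2:ℝ)^((L:ℤ)-p.k) = 2^L * 2^(-p.k) := by
    rw [sub_eq_add_neg, zpow_add₀ two_ne_zero, zpow_natCast]
  rw [e]
  ext ⟨x, y⟩
  simp only [dilate, Tile.toSet, Tile.freqI, Set.mem_image, Set.mem_prod, Set.mem_Ico, Prod.exists, Prod.mk.injEq]
  constructor
  · rintro ⟨a, b, ⟨h1, h2, h3⟩, rfl, rfl⟩
    refine ⟨h1, ?_, ?_⟩
    · rw [mul_assoc]; gcongr
    · rw [mul_assoc]; gcongr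
  · rintro ⟨h1, h2, h3⟩
    refine ⟨x, (2^L)⁻¹*y, ⟨h1, ?_, ?_⟩, rfl, by field_simp⟩
    · rw [le_inv_mul_iff₀ pL, ← mul_assoc]; exact h2
    · rw [inv_mul_lt_iff₀ pL, ← mul_assoc]; exact h3

lemma Tile.timeI_ne (p : Tile) : p.timeI.Nonempty := by
  have : (0:ℝ) < 2^p.k := by positivity
  exact Set.nonempty_Ico.2 (by nlinarith)

lemma Tile.freqI_ne (p : Tile) : p.freqI.Nonempty := by
  have : (0:ℝ) < 2^(-p.k) := by positivity
  exact Set.nonempty_Ico.2 (by nlinarith)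

lemma maxTiles_dilate (L : ℕ) (k : ℤ) (n c : ℕ) :
    maxTiles (dilate L (Tile.mk k n c).toSet) =
      ↑((Finset.Ico (c*2^L) ((c+1)*2^L)).image (fun l => Tile.mk k n l)) := by
  rw [dilate_tile]
  have pk : (0:ℝ) < 2^(-k) := by positivity
  have eL : (2:ℝ)^((L:ℤ)-k) = 2^L * 2^(-k) := by
    rw [sub_eq_add_neg, zpow_add₀ two_ne_zero, zpow_natCast]
  have sub : ∀ p : Tile, p.toSet ⊆ (Tile.mk k n c).timeI ×ˢ Ico ((2:ℝ)^((L:ℤ)-k) * c) ((2:ℝ)^((L:ℤ)-k) * (c+1)) ↔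
      p.timeI ⊆ (Tile.mk k n c).timeI ∧ p.freqI ⊆ Ico ((2:ℝ)^((L:ℤ)-k) * c) ((2:ℝ)^((L:ℤ)-k) * (c+1)) := by
    intro p
    unfold Tile.toSet
    rw [Set.prod_subset_prod_iff]
    constructor
    · rintro (h | h | h)
      · exact h
      · exact absurd h p.timeI_ne.ne_empty
      · exact absurd h p.freqI_ne.ne_empty
    · exact Or.inl
  have fr : ∀ l : ℕ, (Tile.mk k n l).freqI ⊆ Ico ((2:ℝ)^((L:ℤ)-k) * c) ((2:ℝ)^((L:ℤ)-k) * (c+1)) ↔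
      l ∈ Finset.Ico (c*2^L) ((c+1)*2^L) := by
    intro l
    unfold Tile.freqI
    simp only
    rw [Set.Ico_subset_Ico_iff (by linarith), eL, Finset.mem_Ico]
    constructor
    · rintro ⟨h1, h2⟩
      rw [mul_comm ((2:ℝ)^L), mul_assoc] at h1 h2
      have h1' := le_of_mul_le_mul_left h1 pk
      have h2' := le_of_mul_le_mul_left h2 pk
      have h1'' : 2^L*c ≤ l := by exact_mod_cast h1'
      have h2'' : l+1 ≤ 2^L*(c+1) := by exact_mod_cast h2'
      constructor
      · linarith
      · linarith
    · rintro ⟨h1, h2⟩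
      rw [mul_comm ((2:ℝ)^L), mul_assoc, mul_assoc]
      have h1'' : 2^L*c ≤ l := by linarith
      have h2'' : l+1 ≤ 2^L*(c+1) := by linarith
      constructor
      · gcongr; exact_mod_cast h1''
      · gcongr; exact_mod_cast h2''
  ext p
  simp only [maxTiles, Set.mem_setOf_eq, Finset.coe_image, Set.mem_image, Finset.mem_coe]
  constructor
  · rintro ⟨h1, h2⟩
    rw [sub] at h1
    have hk := (dy_sub h1.1).2.2
    simp only at hk
    obtain ⟨j, hj⟩ := Int.le.dest hk
    have ej : (2:ℝ)^(-p.k) = 2^j * 2^(-k) := by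
      rw [← zpow_natCast, ← zpow_add₀ two_ne_zero]; congr 1; linarith
    have hf : (Tile.mk k n (p.l*2^j)).freqI ⊆ p.freqI := by
      unfold Tile.freqI
      simp only
      rw [Set.Ico_subset_Ico_iff (by linarith), ej]
      push_cast
      have : (1:ℝ) ≤ 2^j := one_le_pow₀ one_le_two
      constructor
      · linarith
      · nlinarith
    have := h2 ⟨k, n, p.l*2^j⟩ ((sub _).2 ⟨by exact subset_rfl, hf.trans h1.2⟩) ⟨h1.1, hf⟩
    refine ⟨p.l*2^j, (fr _).1 (by rw [this]; exact h1.2), this⟩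
  · rintro ⟨l, hl, rfl⟩
    refine ⟨(sub _).2 ⟨by exact subset_rfl, (fr l).2 hl⟩, ?_⟩
    rintro q hq ⟨t1, t2⟩
    rw [sub] at hq
    have e1 := dy_eq hq.1 t1
    obtain ⟨qk, qn, ql⟩ := q
    obtain ⟨rfl, rfl⟩ := e1
    have pq : (0:ℝ) < 2^(-qk) := by positivity
    unfold Tile.freqI at t2
    have := (dy_eq (a := -qk) (k := -qk) (m := ql) (n := l) t2 (by
      have := (Set.Ico_subset_Ico_iff (by linarith)).1 t2
      simp only at this
      refine (Set.Ico_subset_Ico_iff (by linarith)).2 ⟨by linarith, by linarith⟩)).2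
    rw [this]

lemma projT_eq (f : ℝ → ℂ) (k : ℤ) (n l : ℕ) (x : ℝ) :
    projT ⟨k, n, l⟩ f x = amp f k n l * (ww k n l x : ℂ) := by
  have hs : ((Real.sqrt ((2:ℝ)^(-k)) : ℝ) : ℂ) * ((Real.sqrt ((2:ℝ)^(-k)) : ℝ) : ℂ) = (2:ℂ)^(-k) := by
    rw [← Complex.ofReal_mul, Real.mul_self_sqrt (by positivity)]; push_cast; rfl
  unfold projT coef amp Tile.wp
  have : ∀ y, f y * ((Real.sqrt ((2:ℝ)^(-k)) * walsh l ((2:ℝ)^(-k) * y - n) : ℝ) : ℂ) =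
      ((Real.sqrt ((2:ℝ)^(-k)) : ℝ) : ℂ) * (f y * (ww k n l y : ℂ)) := by
    intro y; unfold ww; push_cast; ring
  simp only [this]
  rw [integral_const_mul, ← hs]
  unfold ww; push_cast; ring

lemma phid_eq (P : Bitile) (x : ℝ) : P.phid x = ww P.k P.n (2*P.l) x := by
  unfold Bitile.phid Tile.wp Bitile.d ww
  rw [← mul_assoc, ← Real.sqrt_mul (by positivity), ← zpow_add₀ two_ne_zero]; simp

lemma proj_local {f : ℝ → ℂ} (hA : IsAmp (amp f)) (k : ℤ) (n l : ℕ) (x : ℝ) :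
    amp f k n (2*l) * (ww k n (2*l) x : ℂ) + amp f k n (2*l+1) * (ww k n (2*l+1) x : ℂ) =
    amp f (k-1) (2*n) l * (ww (k-1) (2*n) l x : ℂ) + amp f (k-1) (2*n+1) l * (ww (k-1) (2*n+1) l x : ℂ) := by
  rw [(hA k n l).1, (hA k n l).2, ww_even, ww_odd]; push_cast; ring

lemma proj_change {f : ℝ → ℂ} (hA : IsAmp (amp f)) (L : ℕ) : ∀ (k : ℤ) (n c : ℕ) (x : ℝ),
    bs L c (fun l => amp f k n l * (ww k n l x : ℂ)) =
    bs L n (fun m => amp f (k-L) m c * (ww (k-L) m c x : ℂ)) := by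
  induction L with
  | zero => intro k n c x; simp [bs_zero]
  | succ L ih =>
    intro k n c x
    rw [bs_add L 1]
    have : ∀ j, bs 1 j (fun l => amp f k n l * (ww k n l x : ℂ)) =
      amp f (k-1) (2*n) j * (ww (k-1) (2*n) j x : ℂ) + amp f (k-1) (2*n+1) j * (ww (k-1) (2*n+1) j x : ℂ) := by
      intro j
      rw [← proj_local hA, bs_succ, bs_zero, bs_zero]
    simp only [this]
    rw [bs_fadd, ih, ih, bs_succ, show k - ((L+1:ℕ):ℤ) = k - 1 - L by push_cast; ring]

lemma piProj_eq {f : ℝ → ℂ} (hA : IsAmp (amp f)) (L : ℕ) (P : Bitile) (x : ℝ) :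
    piProj (dilate L P.d.toSet) f x =
      bs L P.n (fun m => amp f (P.k-L) m (2*P.l) * (ww (P.k-L) m (2*P.l) x : ℂ)) := by
  unfold piProj projSet Bitile.d
  rw [maxTiles_dilate, ← proj_change hA]
  rw [Finset.tsum_subtype' _ (fun p => projT p f x), Finset.sum_image, bs_eq_sum]
  · simp only [projT_eq]
  · intro a _ b _ h
    simpa using h

lemma ww_mul_ne {k : ℤ} {m m' l l' : ℕ} (h : m ≠ m') (x : ℝ) : ww k m l x * ww k m' l' x = 0 := by
  by_cases h1 : x ∈ dyadicI k m
  · rw [ww_off (n := m') (fun h2 => h (dyadicI_disj h1 h2)), mul_zero]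
  · rw [ww_off h1, zero_mul]

lemma block_prod (a b : ℕ → ℂ) (L n : ℕ) (k : ℤ) (l : ℕ) (x : ℝ) :
    bs L n (fun m => a m * (ww k m l x : ℂ)) * bs L n (fun m => b m * (ww k m l x : ℂ)) =
    bs L n (fun m => a m * b m * ((dyadicI k m).indicator (1:ℝ→ℝ) x : ℝ)) := by
  simp only [bs_eq_sum]
  rw [Finset.sum_mul_sum]
  refine Finset.sum_congr rfl fun m hm => ?_
  rw [Finset.sum_eq_single m]
  · rw [← ww_sq k m l x]; push_cast; ring
  · intro q _ hq
    have := ww_mul_ne (k := k) (l := l) (l' := l) (Ne.symm hq) x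
    have h2 : (ww k m l x : ℂ) * (ww k q l x : ℂ) = 0 := by exact_mod_cast this
    linear_combination a m * b q * h2
  · intro h; exact absurd hm h

/-- the integrand of a single bitile -/
def FP (f1 f2 f3 : ℝ → ℂ) (L : ℕ) (P : Bitile) (x : ℝ) : ℂ :=
  (P.phid x : ℂ) * projT P.u f1 x * piProj (dilate L P.d.toSet) f2 x * piProj (dilate L P.d.toSet) f3 x

lemma phid_proj (f : ℝ → ℂ) (P : Bitile) (x : ℝ) : (P.phid x : ℂ) * projT P.u f x = amp f P.k P.n (2*P.l+1) *
    (((dyadicI (P.k-1) (2*P.n)).indicator (1:ℝ→ℝ) x : ℝ) - ((dyadicI (P.k-1) (2*P.n+1)).indicator (1:ℝ→ℝ) x : ℝ) : ℂ) := by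
  rw [phid_eq]
  unfold Bitile.u
  rw [projT_eq, ww_odd, ww_even, ← ww_sq (P.k-1) (2*P.n) P.l x, ← ww_sq (P.k-1) (2*P.n+1) P.l x]
  push_cast; ring

lemma bs_mul_right {K : Type*} [CommSemiring K] (d m : ℕ) (c : K) (F : ℕ → K) :
    bs d m F * c = bs d m (fun j => F j * c) := by
  simp only [bs_eq_sum, Finset.sum_mul]

lemma ind_child (k : ℤ) (M m c : ℕ) (x : ℝ) :
    (dyadicI (k-M) m).indicator (1:ℝ→ℝ) x * (dyadicI k c).indicator (1:ℝ→ℝ) x =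
    if m/2^M = c then (dyadicI (k-M) m).indicator (1:ℝ→ℝ) x else 0 := by
  by_cases h : x ∈ dyadicI (k-M) m
  · have h' := dyadicI_parent k M m h
    split_ifs with e
    · rw [e] at h'
      rw [Set.indicator_of_mem h']; simp
    · rw [Set.indicator_of_notMem (s := dyadicI k c) (fun h2 => e (dyadicI_disj h' h2)), mul_zero]
  · rw [Set.indicator_of_notMem h]; simp

lemma FP_eq {f1 f2 f3 : ℝ → ℂ} (h2 : IsAmp (amp f2)) (h3 : IsAmp (amp f3)) (M : ℕ) (P : Bitile) (x : ℝ) :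
    FP f1 f2 f3 (M+1) P x = amp f1 P.k P.n (2*P.l+1) *
     (bs M (2*P.n) (fun m => amp f2 (P.k-(M+1:ℕ)) m (2*P.l) * amp f3 (P.k-(M+1:ℕ)) m (2*P.l) * ((dyadicI (P.k-(M+1:ℕ)) m).indicator (1:ℝ→ℝ) x : ℝ))
     - bs M (2*P.n+1) (fun m => amp f2 (P.k-(M+1:ℕ)) m (2*P.l) * amp f3 (P.k-(M+1:ℕ)) m (2*P.l) * ((dyadicI (P.k-(M+1:ℕ)) m).indicator (1:ℝ→ℝ) x : ℝ))) := by
  unfold FP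
  rw [mul_assoc, piProj_eq h2, piProj_eq h3, block_prod, phid_proj, mul_assoc]
  congr 1
  rw [bs_succ]
  have e : P.k - ((M+1:ℕ):ℤ) = (P.k-1) - M := by push_cast; ring
  rw [e]
  have key : ∀ c c' : ℕ, bs M c (fun m => amp f2 (P.k-1-M) m (2*P.l) * amp f3 (P.k-1-M) m (2*P.l) * ((dyadicI (P.k-1-M) m).indicator (1:ℝ→ℝ) x : ℝ))
      * ((dyadicI (P.k-1) c').indicator (1:ℝ→ℝ) x : ℝ) = if c = c' then
      bs M c (fun m => amp f2 (P.k-1-M) m (2*P.l) * amp f3 (P.k-1-M) m (2*P.l) * ((dyadicI (P.k-1-M) m).indicator (1:ℝ→ℝ) x : ℝ)) else 0 := by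
    intro c c'
    rw [bs_mul_right]
    have : ∀ m, (((dyadicI (P.k-1-M) m).indicator (1:ℝ→ℝ) x : ℝ) : ℂ) * ((dyadicI (P.k-1) c').indicator (1:ℝ→ℝ) x : ℝ) =
      if m/2^M = c' then (((dyadicI (P.k-1-M) m).indicator (1:ℝ→ℝ) x : ℝ) : ℂ) else 0 := by
      intro m
      have := ind_child (P.k-1) M m c' x
      rw [← Complex.ofReal_mul, this]; split_ifs <;> simp
    split_ifs with h
    · subst h
      refine bs_congr fun m hm => ?_
      rw [mul_assoc, this, if_pos hm]
    · rw [← bs_fzero (M := ℂ) M c]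
      refine bs_congr fun m hm => ?_
      rw [mul_assoc, this, if_neg (by rw [hm]; exact h), mul_zero]
  have k1 := key (2*P.n) (2*P.n)
  have k2 := key (2*P.n) (2*P.n+1)
  have k3 := key (2*P.n+1) (2*P.n)
  have k4 := key (2*P.n+1) (2*P.n+1)
  rw [if_pos rfl] at k1 k4
  rw [if_neg (by omega)] at k2 k3
  linear_combination k1 - k2 + k3 - k4

lemma ind_intC (k : ℤ) (m : ℕ) (c : ℂ) : Integrable (fun x => c * ((dyadicI k m).indicator (1:ℝ→ℝ) x : ℝ)) := by
  have := (int_ind (measurableSet_dyadicI k m) (by rw [volume_dyadicI]; exact ofReal_lt_top)).ofReal (𝕜 := ℂ)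
  exact this.const_mul c

lemma ind_integralC (k : ℤ) (m : ℕ) (c : ℂ) : ∫ x, c * ((dyadicI k m).indicator (1:ℝ→ℝ) x : ℝ) = c * 2^k := by
  rw [integral_const_mul, integral_complex_ofReal, integral_indicator_one (measurableSet_dyadicI k m), measureReal_def,
    volume_dyadicI, ENNReal.toReal_ofReal (by positivity)]
  push_cast; rfl

lemma bs_int {d n : ℕ} {F : ℕ → ℝ → ℂ} (h : ∀ m, Integrable (F m)) : Integrable (fun x => bs d n (fun m => F m x)) := by
  simp only [bs_eq_sum]
  exact integrable_finsetSum _ fun m _ => h m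

lemma bs_integral {d n : ℕ} {F : ℕ → ℝ → ℂ} (h : ∀ m, Integrable (F m)) :
    ∫ x, bs d n (fun m => F m x) = bs d n (fun m => ∫ x, F m x) := by
  simp only [bs_eq_sum]
  exact integral_finset_sum _ fun m _ => h m

lemma FP_int {f1 f2 f3 : ℝ → ℂ} (h2 : IsAmp (amp f2)) (h3 : IsAmp (amp f3)) (M : ℕ) (P : Bitile) :
    Integrable (FP f1 f2 f3 (M+1) P) := by
  have : FP f1 f2 f3 (M+1) P = _ := funext fun x => FP_eq h2 h3 M P x
  rw [this]
  exact ((bs_int fun m => ind_intC _ _ _).sub (bs_int fun m => ind_intC _ _ _)).const_mul _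

lemma FP_integral {f1 f2 f3 : ℝ → ℂ} (h2 : IsAmp (amp f2)) (h3 : IsAmp (amp f3)) (M : ℕ) (P : Bitile) :
    ∫ x, FP f1 f2 f3 (M+1) P x = Lam (amp f1) (amp f2) (amp f3) M P := by
  simp only [FP_eq h2 h3]
  rw [integral_const_mul, integral_sub (bs_int fun m => ind_intC _ _ _) (bs_int fun m => ind_intC _ _ _),
    bs_integral fun m => ind_intC _ _ _, bs_integral fun m => ind_intC _ _ _]
  simp only [ind_integralC]
  unfold Lam
  rw [← bs_mul_right, ← bs_mul_right]
  push_cast; ring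

end Work

section Work
open Classical

lemma FP_norm {f1 f2 f3 : ℝ → ℂ} (h2 : IsAmp (amp f2)) (h3 : IsAmp (amp f3)) (M : ℕ) (P : Bitile) :
    ∫ x, ‖FP f1 f2 f3 (M+1) P x‖ ≤ ‖amp f1 P.k P.n (2*P.l+1)‖ *
      ((en (amp f2) (M+1) (fun _ _ => False) 0 P + en (amp f3) (M+1) (fun _ _ => False) 0 P)/2) := by
  set a := fun m => amp f2 (P.k-(M+1:ℕ)) m (2*P.l) with ha
  set b := fun m => amp f3 (P.k-(M+1:ℕ)) m (2*P.l) with hb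
  set I := fun (m : ℕ) (x : ℝ) => (dyadicI (P.k-(M+1:ℕ)) m).indicator (1:ℝ→ℝ) x with hI
  have I0 : ∀ m x, 0 ≤ I m x := fun m x => Set.indicator_nonneg (fun _ _ => zero_le_one) x
  have ii : ∀ m, Integrable (I m) := fun m =>
    int_ind (measurableSet_dyadicI _ m) (by rw [volume_dyadicI]; exact ofReal_lt_top)
  have pt : ∀ x, ‖FP f1 f2 f3 (M+1) P x‖ ≤ ‖amp f1 P.k P.n (2*P.l+1)‖ *
      ∑ m ∈ Finset.Ico (P.n*2^(M+1)) ((P.n+1)*2^(M+1)), (‖a m‖^2+‖b m‖^2)/2 * I m x := by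
    intro x
    rw [FP_eq h2 h3, norm_mul]
    gcongr
    rw [← bs_eq_sum, bs_succ]
    refine (norm_sub_le _ _).trans (add_le_add ?_ ?_)
    all_goals
      refine (bs_norm _).trans (bs_mono fun m _ => ?_)
      rw [norm_mul, norm_mul, Complex.norm_real, Real.norm_eq_abs, abs_of_nonneg (I0 m x)]
      refine mul_le_mul_of_nonneg_right ?_ (I0 m x)
      nlinarith [sq_nonneg (‖a m‖ - ‖b m‖)]
  calc _ ≤ ∫ x, ‖amp f1 P.k P.n (2*P.l+1)‖ *
      ∑ m ∈ Finset.Ico (P.n*2^(M+1)) ((P.n+1)*2^(M+1)), (‖a m‖^2+‖b m‖^2)/2 * I m x := by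
        refine integral_mono_of_nonneg (Filter.Eventually.of_forall fun x => norm_nonneg _) ?_
          (Filter.Eventually.of_forall pt)
        exact (integrable_finsetSum _ fun m _ => (ii m).const_mul _).const_mul _
    _ = _ := by
        rw [integral_const_mul, integral_finset_sum _ fun m _ => (ii m).const_mul _]
        congr 1
        unfold en
        rw [bs_eq_sum, bs_eq_sum, ← Finset.sum_add_distrib, Finset.sum_div]
        refine Finset.sum_congr rfl fun m _ => ?_
        simp only [if_false]
        rw [integral_const_mul, integral_indicator_one (measurableSet_dyadicI _ m), measureReal_def,
          volume_dyadicI, ENNReal.toReal_ofReal (by positivity)]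
        unfold EE
        simp only [ha, hb, add_zero]; ring

lemma en_scale {A : ℤ → ℕ → ℕ → ℂ} {e : ℝ} (hB : Bessel A e) (L : ℕ) (κ : ℤ) (s : Finset Bitile) :
    ∑ P ∈ s.filter (fun P => P.k = κ), en A L (fun _ _ => False) 0 P ≤ e := by
  unfold en
  simp only [bs_eq_sum, if_false]
  rw [Finset.sum_sigma', ← Finset.sum_image (f := fun p : Tile => EE A p.k p.n p.l)
    (g := fun x : (_ : Bitile) × ℕ => Tile.mk (x.1.k - L) x.2 (2*x.1.l+0))]
  · refine hB _ ?_
    intro p hp q hq hne ht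
    obtain ⟨x, hx, rfl⟩ := Finset.mem_image.1 hp
    obtain ⟨y, hy, rfl⟩ := Finset.mem_image.1 hq
    rw [Finset.mem_sigma, Finset.mem_filter] at hx hy
    obtain ⟨j, h1, h2, h3⟩ := ht
    simp only at h1 h2 h3
    have : j = 0 := by
      have := hx.1.2; have := hy.1.2; omega
    subst this
    apply hne
    simp only [pow_zero, Nat.div_one] at h2 h3
    rw [hx.1.2, hy.1.2, h2, h3]
  · rintro ⟨P, m⟩ hx ⟨Q, m'⟩ hy h
    have hx := Finset.mem_coe.1 hx
    have hy := Finset.mem_coe.1 hy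
    rw [Finset.mem_sigma, Finset.mem_filter, mem_block] at hx hy
    simp only [Tile.mk.injEq] at h hx hy
    obtain ⟨h1, rfl, h3⟩ := h
    have : P = Q := by
      obtain ⟨Pk, Pn, Pl⟩ := P
      obtain ⟨Qk, Qn, Ql⟩ := Q
      simp only [Bitile.mk.injEq] at *
      refine ⟨by omega, by rw [← hx.2, ← hy.2], by omega⟩
    subst this
    rfl

lemma strip_iff {N : ℕ} {P : Bitile} : P ∈ stripBitiles N ↔ (2:ℝ)^(1-P.k)*(P.l+1) ≤ 2^N := by
  unfold stripBitiles Bitile.freqI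
  have : (0:ℝ) < 2^(1-P.k) := by positivity
  rw [Set.mem_setOf_eq, Set.Ico_subset_Ico_iff (by linarith)]
  constructor
  · exact fun h => h.2
  · exact fun h => ⟨by positivity, h⟩

lemma strip_k {N : ℕ} {P : Bitile} (h : P ∈ stripBitiles N) : 1 - (N:ℤ) ≤ P.k := by
  rw [strip_iff] at h
  have p : (0:ℝ) < 2^(1-P.k) := by positivity
  have : (2:ℝ)^(1-P.k) ≤ 2^(N:ℤ) := by
    rw [zpow_natCast]; nlinarith [(Nat.cast_nonneg P.l : (0:ℝ) ≤ P.l)]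
  have := (zpow_le_zpow_iff_right₀ (by norm_num : (1:ℝ) < 2)).1 this
  omega

lemma sum_scales (N : ℕ) (S : Finset ℤ) (h : ∀ κ ∈ S, 1 - (N:ℤ) ≤ κ) : ∑ κ ∈ S, (2:ℝ)^(-κ) ≤ 2^N := by
  have e : ∀ κ ∈ S, (2:ℝ)^(-κ) = 2^N * ((1/2) * (1/2:ℝ)^((κ-(1-N)).toNat)) := by
    intro κ hκ
    have := h κ hκ
    have e1 : ((κ-(1-N)).toNat:ℤ) = κ-(1-N) := Int.toNat_of_nonneg (by omega)
    rw [← zpow_natCast (1/2:ℝ), e1, one_div, inv_zpow', ← zpow_natCast, ← zpow_neg_one, ← zpow_add₀ two_ne_zero,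
      ← zpow_add₀ two_ne_zero]
    congr 1; ring
  rw [Finset.sum_congr rfl e, ← Finset.mul_sum, ← Finset.mul_sum]
  rw [← Finset.sum_image (f := fun i => (1/2:ℝ)^i) (g := fun κ : ℤ => (κ-(1-N)).toNat)]
  · have hs := summable_geometric_two
    have := hs.sum_le_tsum (S.image (fun κ : ℤ => (κ-(1-N)).toNat)) (fun _ _ => by positivity)
    rw [tsum_geometric_two] at this
    have p : (0:ℝ) < 2^N := by positivity
    nlinarith
  · intro a ha b hb hab
    have := h a ha; have := h b hb
    simp only at hab
    omega

instance : Countable Bitile :=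
  Function.Injective.countable (f := fun P : Bitile => (P.k, P.n, P.l)) (by
    rintro ⟨a, b, c⟩ ⟨a', b', c'⟩ h
    simpa using h)

lemma form_hasSum {f1 f2 f3 : ℝ → ℂ} {E1 E2 E3 : Set ℝ} (h1 : Adm f1 E1) (h2 : Adm f2 E2) (h3 : Adm f3 E3)
    (M N : ℕ) :
    HasSum (fun P : stripBitiles N => Lam (amp f1) (amp f2) (amp f3) M P.1) (quartileForm (M+1) N f1 f2 f3) := by
  have hs : Summable (fun P : stripBitiles N => ∫ x, ‖FP f1 f2 f3 (M+1) P.1 x‖) := by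
    refine summable_of_sum_le (c := volume.real E1 * ((volume.real E2 + volume.real E3)/2) * 2^N)
      (fun P => integral_nonneg fun x => norm_nonneg _) fun s => ?_
    set t : Finset Bitile := s.map ⟨Subtype.val, Subtype.val_injective⟩ with ht
    have hst : ∀ P ∈ t, P ∈ stripBitiles N := by
      intro P hP
      rw [ht, Finset.mem_map] at hP
      obtain ⟨Q, _, rfl⟩ := hP
      exact Q.2
    have e : ∑ P ∈ s, ∫ x, ‖FP f1 f2 f3 (M+1) P.1 x‖ = ∑ P ∈ t, ∫ x, ‖FP f1 f2 f3 (M+1) P x‖ := by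
      rw [ht, Finset.sum_map]; rfl
    rw [e]
    have a1 : ∀ P : Bitile, ‖amp f1 P.k P.n (2*P.l+1)‖ ≤ (2:ℝ)^(-P.k) * volume.real E1 := by
      intro P
      refine (h1.amp_le _ _ _).trans ?_
      unfold rho
      gcongr
      · exact h1.ev.ne
      · exact inter_subset_left
    set G : Bitile → ℝ := fun P => (en (amp f2) (M+1) (fun _ _ => False) 0 P + en (amp f3) (M+1) (fun _ _ => False) 0 P)/2 with hG
    have G0 : ∀ P, 0 ≤ G P := fun P => by
      have := en_nonneg (amp f2) (M+1) (fun _ _ => False) 0 P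
      have := en_nonneg (amp f3) (M+1) (fun _ _ => False) 0 P
      simp only [hG]; linarith
    calc _ ≤ ∑ P ∈ t, (2:ℝ)^(-P.k) * volume.real E1 * G P :=
          Finset.sum_le_sum fun P _ => (FP_norm h2.isAmp h3.isAmp M P).trans
            (mul_le_mul_of_nonneg_right (a1 P) (G0 P))
      _ = ∑ κ ∈ t.image (fun P => P.k), ∑ P ∈ t.filter (fun P => P.k = κ), (2:ℝ)^(-P.k) * volume.real E1 * G P := by
          rw [Finset.sum_fiberwise_of_maps_to]
          exact fun P hP => Finset.mem_image_of_mem _ hP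
      _ ≤ ∑ κ ∈ t.image (fun P => P.k), (2:ℝ)^(-κ) * (volume.real E1 * ((volume.real E2 + volume.real E3)/2)) := by
          refine Finset.sum_le_sum fun κ _ => ?_
          have e1 : ∑ P ∈ t.filter (fun P => P.k = κ), (2:ℝ)^(-P.k) * volume.real E1 * G P =
              (2:ℝ)^(-κ) * volume.real E1 * ∑ P ∈ t.filter (fun P => P.k = κ), G P := by
            rw [Finset.mul_sum]
            refine Finset.sum_congr rfl fun P hP => ?_
            rw [(Finset.mem_filter.1 hP).2]
          rw [e1, mul_assoc]
          have b2 := en_scale h2.bessel (M+1) κ t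
          have b3 := en_scale h3.bessel (M+1) κ t
          have : ∑ P ∈ t.filter (fun P => P.k = κ), G P ≤ (volume.real E2 + volume.real E3)/2 := by
            simp only [hG]
            rw [← Finset.sum_div, Finset.sum_add_distrib]; linarith
          gcongr
      _ ≤ _ := by
          rw [← Finset.sum_mul, mul_comm]
          have := sum_scales N (t.image (fun P => P.k)) (by
            intro κ hκ
            obtain ⟨P, hP, rfl⟩ := Finset.mem_image.1 hκ
            exact strip_k (hst P hP))
          gcongr
  have := hasSum_integral_of_summable_integral_norm (F := fun P : stripBitiles N => FP f1 f2 f3 (M+1) P.1)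
    (fun P => FP_int h2.isAmp h3.isAmp M P.1) hs
  simp only [FP_integral h2.isAmp h3.isAmp] at this
  exact this

/-- convex hull -/
lemma hull_exists (s : Finset Bitile) (N : ℕ) (hs : ∀ P ∈ s, P ∈ stripBitiles N) :
    ∃ t : Finset Bitile, s ⊆ t ∧ Conv t ∧ ∀ P ∈ t, P ∈ stripBitiles N := by
  have fin : {Q : Bitile | ∃ P ∈ s, ∃ R ∈ s, ble P Q ∧ ble Q R}.Finite := by
    refine Set.Finite.subset (s := ⋃ P ∈ s, ⋃ R ∈ s, ↑(((Finset.range ((R.k-P.k).toNat+1)) ×ˢ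
      (Finset.range ((R.k-P.k).toNat+1))).image (fun i : ℕ × ℕ => nd R i.2 (P.n/2^i.1)))) ?_ ?_
    · exact Set.Finite.biUnion s.finite_toSet fun P _ => Set.Finite.biUnion s.finite_toSet fun R _ => Finset.finite_toSet _
    · rintro Q ⟨P, hP, R, hR, ⟨i, h1, h2⟩, ⟨j, h3, h4⟩⟩
      simp only [Set.mem_iUnion]
      refine ⟨P, hP, R, hR, ?_⟩
      rw [Finset.mem_coe, Finset.mem_image]
      refine ⟨(i, j), ?_, ?_⟩
      · have k1 := congrArg Bitile.k h1
        have k2 := congrArg Bitile.k h3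
        simp only [nd] at k1 k2
        simp only [Finset.mem_product, Finset.mem_range]
        omega
      · simp only
        rw [h2]; exact h3.symm
  refine ⟨fin.toFinset, ?_, ?_, ?_⟩
  · intro P hP
    rw [Set.Finite.mem_toFinset]
    exact ⟨P, hP, P, hP, ble_refl P, ble_refl P⟩
  · intro P Q R hP hR h1 h2
    rw [Set.Finite.mem_toFinset] at *
    obtain ⟨P', hP', _, _, a, _⟩ := hP
    obtain ⟨_, _, R', hR', _, b⟩ := hR
    exact ⟨P', hP', R', hR', ble_trans a h1, ble_trans h2 b⟩
  · intro Q hQ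
    rw [Set.Finite.mem_toFinset] at hQ
    obtain ⟨P, hP, _, _, ⟨i, h1, h2⟩, _⟩ := hQ
    have := strip_iff.1 (hs P hP)
    rw [strip_iff]
    refine le_trans ?_ this
    have k1 := congrArg Bitile.k h1
    have l1 := congrArg Bitile.l h1
    simp only [nd] at k1 l1
    have e : (2:ℝ)^(1-P.k) = 2^(1-Q.k) * 2^i := by
      rw [k1, ← zpow_natCast, ← zpow_add₀ two_ne_zero]; congr 1; ring
    rw [e, l1, mul_assoc]
    gcongr
    have : Q.l + 1 ≤ 2^i*(Q.l/2^i+1) := Nat.lt_mul_div_succ _ (by positivity)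
    exact_mod_cast this

lemma form_bound {f1 f2 f3 : ℝ → ℂ} {E1 E2 E3 : Set ℝ} (h1 : Adm f1 E1) (h2 : Adm f2 E2) (h3 : Adm f3 E3)
    (M N : ℕ) {D : ℝ} (hD : ∀ t : Finset Bitile, Conv t → ‖∑ P ∈ t, Lam (amp f1) (amp f2) (amp f3) M P‖ ≤ D) :
    ‖quartileForm (M+1) N f1 f2 f3‖ ≤ D := by
  have hs := form_hasSum h1 h2 h3 M N
  refine le_of_forall_pos_le_add fun η hη => ?_
  have := Metric.tendsto_atTop.1 hs η hη
  obtain ⟨s, hs'⟩ := this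
  obtain ⟨t, hst, hct, ht⟩ := hull_exists (s.map ⟨Subtype.val, Subtype.val_injective⟩) N (by
    intro P hP
    obtain ⟨Q, _, rfl⟩ := Finset.mem_map.1 hP
    exact Q.2)
  have h := hs' (t.subtype (fun P => P ∈ stripBitiles N)) (by
    intro P hP
    rw [Finset.mem_subtype]
    exact hst (Finset.mem_map_of_mem _ hP))
  rw [Finset.sum_subtype_of_mem (fun P => Lam (amp f1) (amp f2) (amp f3) M P) ht] at h
  rw [dist_eq_norm] at h
  have := hD t hct
  have e := norm_sub_norm_le (quartileForm (M+1) N f1 f2 f3) (∑ P ∈ t, Lam (amp f1) (amp f2) (amp f3) M P)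
  rw [norm_sub_rev] at h
  linarith

end Work

section Work
open Classical

def Up (E : Set ℝ) (τ : ℝ) (k : ℤ) (n : ℕ) : Prop := ∃ j : ℕ, τ < rho E (k+j) (n/2^j)

lemma Up.self {E : Set ℝ} {τ : ℝ} {k : ℤ} {n : ℕ} (h : τ < rho E k n) : Up E τ k n := ⟨0, by simpa using h⟩

lemma Up.mono {E : Set ℝ} {τ τ' : ℝ} {k : ℤ} {n : ℕ} (h : Up E τ k n) (ht : τ' ≤ τ) : Up E τ' k n := by
  obtain ⟨j, hj⟩ := h
  exact ⟨j, ht.trans_lt hj⟩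

lemma up_downC (E : Set ℝ) (τ : ℝ) : DownC (Up E τ) := by
  rintro k n ⟨j, hj⟩
  refine ⟨⟨j+1, ?_⟩, ⟨j+1, ?_⟩⟩
  · rw [pow_succ', ← Nat.div_div_eq_div_mul, show (2*n)/2 = n by omega,
      show k - 1 + ((j+1:ℕ):ℤ) = k + j by push_cast; ring]
    exact hj
  · rw [pow_succ', ← Nat.div_div_eq_div_mul, show (2*n+1)/2 = n by omega,
      show k - 1 + ((j+1:ℕ):ℤ) = k + j by push_cast; ring]
    exact hj

/-- the union of all dyadic intervals of large density -/
def GG (E : Set ℝ) (τ : ℝ) : Set ℝ := ⋃ p ∈ {p : ℤ × ℕ | τ < rho E p.1 p.2}, dyadicI p.1 p.2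

lemma Up.sub {E : Set ℝ} {τ : ℝ} {k : ℤ} {n : ℕ} (h : Up E τ k n) : dyadicI k n ⊆ GG E τ := by
  obtain ⟨j, hj⟩ := h
  have := dyadicI_parent (k+j) j n
  rw [add_sub_cancel_right] at this
  refine this.trans ?_
  exact subset_biUnion_of_mem (u := fun p : ℤ × ℕ => dyadicI p.1 p.2) (x := (k+(j:ℤ), n/2^j)) hj

lemma GG_meas (E : Set ℝ) (τ : ℝ) : MeasurableSet (GG E τ) :=
  MeasurableSet.biUnion (Set.to_countable _) fun p _ => measurableSet_dyadicI _ _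

lemma dyadic_nest {k k' : ℤ} (h : k ≤ k') (n n' : ℕ) :
    dyadicI k n ⊆ dyadicI k' n' ∨ Disjoint (dyadicI k' n') (dyadicI k n) := by
  obtain ⟨j, hj⟩ := Int.le.dest h
  have hk : k = k' - j := by omega
  have hp := dyadicI_parent k' j n
  rw [← hk] at hp
  by_cases e : n/2^j = n'
  · left; rwa [e] at hp
  · right
    rw [Set.disjoint_left]
    intro x hx hx'
    exact e (dyadicI_disj (hp hx') hx)

lemma weak_fin {E : Set ℝ} (em : MeasurableSet E) {τ : ℝ} (hτ : 0 < τ) (S : Finset (ℤ × ℕ))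
    (hS : ∀ p ∈ S, τ < rho E p.1 p.2) :
    ENNReal.ofReal τ * volume (⋃ p ∈ S, dyadicI p.1 p.2) ≤ volume (E ∩ ⋃ p ∈ S, dyadicI p.1 p.2) := by
  induction S using Finset.strongInduction with
  | H S ih =>
    rcases S.eq_empty_or_nonempty with rfl | hne
    · simp
    obtain ⟨p, hp, hmax⟩ := S.exists_max_image (fun p => p.1) hne
    set S' := S.filter (fun q => Disjoint (dyadicI p.1 p.2) (dyadicI q.1 q.2)) with hS'
    have hss : S' ⊂ S := by
      refine Finset.filter_ssubset.2 ⟨p, hp, fun hd => ?_⟩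
      have := disjoint_self.1 hd
      have h2 := volume_dyadicI p.1 p.2
      rw [this] at h2
      simp at h2
      have : (0:ℝ) < 2^p.1 := by positivity
      linarith
    have IH := ih S' hss (fun q hq => hS q (hss.1 hq))
    have hU : (⋃ q ∈ S, dyadicI q.1 q.2) = dyadicI p.1 p.2 ∪ ⋃ q ∈ S', dyadicI q.1 q.2 := by
      apply Subset.antisymm
      · refine iUnion₂_subset fun q hq => ?_
        rcases dyadic_nest (hmax q hq) q.2 p.2 with h | h
        · exact h.trans subset_union_left
        · refine subset_union_of_subset_right ?_ _
          exact subset_biUnion_of_mem (u := fun p : ℤ × ℕ => dyadicI p.1 p.2)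
            (show q ∈ (S' : Set (ℤ × ℕ)) by simp [hS', hq, h])
      · refine union_subset ?_ (biUnion_subset_biUnion_left hss.1)
        exact subset_biUnion_of_mem (u := fun p : ℤ × ℕ => dyadicI p.1 p.2) hp
    have hd : Disjoint (dyadicI p.1 p.2) (⋃ q ∈ S', dyadicI q.1 q.2) := by
      rw [Set.disjoint_iUnion₂_right]
      intro q hq
      exact (Finset.mem_filter.1 hq).2
    have hm' : MeasurableSet (⋃ q ∈ S', dyadicI q.1 q.2) :=
      Finset.measurableSet_biUnion _ fun q _ => measurableSet_dyadicI _ _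
    rw [hU, inter_union_distrib_left, measure_union hd hm',
      measure_union (hd.mono inter_subset_right inter_subset_right) (em.inter hm'), mul_add]
    refine add_le_add ?_ IH
    have h1 := hS p hp
    unfold rho at h1
    rw [volume_dyadicI, ← ENNReal.ofReal_mul hτ.le]
    refine ENNReal.ofReal_le_of_le_toReal ?_
    rw [← measureReal_def]
    have p2 : (0:ℝ) < 2^p.1 := by positivity
    rw [zpow_neg, inv_mul_eq_div, lt_div_iff₀ p2] at h1
    exact h1.le

lemma weak {E : Set ℝ} (em : MeasurableSet E) (ev : volume E < ∞) {τ : ℝ} (hτ : 0 < τ) :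
    volume (GG E τ) ≤ ENNReal.ofReal (volume.real E / τ) := by
  have e : GG E τ = ⋃ S : Finset (ℤ × ℕ), ⋃ p ∈ S.filter (fun p => τ < rho E p.1 p.2), dyadicI p.1 p.2 := by
    ext x
    simp only [GG, mem_iUnion, mem_setOf_eq, Finset.mem_filter, exists_prop]
    constructor
    · rintro ⟨p, hp, hx⟩
      exact ⟨{p}, p, ⟨by simp, hp⟩, hx⟩
    · rintro ⟨S, p, ⟨_, hp⟩, hx⟩
      exact ⟨p, hp, hx⟩
  rw [e, Directed.measure_iUnion]
  · refine iSup_le fun S => ?_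
    have := weak_fin em hτ (S.filter (fun p => τ < rho E p.1 p.2)) (fun p hp => (Finset.mem_filter.1 hp).2)
    have h2 := this.trans (measure_mono inter_subset_left)
    rw [ENNReal.ofReal_div_of_pos hτ, ENNReal.le_div_iff_mul_le (Or.inl (by simpa using hτ)) (Or.inl (by simp)),
      mul_comm, measureReal_def, ENNReal.ofReal_toReal ev.ne]
    exact h2
  · intro S T
    refine ⟨S ∪ T, ?_, ?_⟩
    · intro x hx
      obtain ⟨p, hp, hx⟩ := mem_iUnion₂.1 hx
      rw [Finset.mem_filter] at hp
      exact mem_iUnion₂.2 ⟨p, Finset.mem_filter.2 ⟨Finset.mem_union_left _ hp.1, hp.2⟩, hx⟩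
    · intro x hx
      obtain ⟨p, hp, hx⟩ := mem_iUnion₂.1 hx
      rw [Finset.mem_filter] at hp
      exact mem_iUnion₂.2 ⟨p, Finset.mem_filter.2 ⟨Finset.mem_union_right _ hp.1, hp.2⟩, hx⟩

lemma Lam_zero {A1 A2 A3 : ℤ → ℕ → ℕ → ℂ} {M : ℕ} {P : Bitile}
    (h : ∀ m, m/2^(M+1) = P.n → A2 (P.k-(M+1:ℕ)) m (2*P.l) * A3 (P.k-(M+1:ℕ)) m (2*P.l) = 0) :
    Lam A1 A2 A3 M P = 0 := by
  unfold Lam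
  rw [bs_congr (d := M) (m := 2*P.n) (G := fun _ => 0), bs_congr (d := M) (m := 2*P.n+1) (G := fun _ => 0), bs_fzero, bs_fzero]
  · simp
  · intro j hj
    exact h j (div_child (c := 1) (by norm_num) hj)
  · intro j hj
    exact h j (div_child (c := 0) (by norm_num) hj)

lemma Lam_congr1 {A1 B1 A2 A3 : ℤ → ℕ → ℕ → ℂ} {M : ℕ} {P : Bitile}
    (h : A1 P.k P.n (2*P.l+1) = B1 P.k P.n (2*P.l+1)) : Lam A1 A2 A3 M P = Lam B1 A2 A3 M P := by
  unfold Lam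
  rw [h]

lemma rho_zero_desc {E : Set ℝ} {k : ℤ} {n : ℕ} (h : rho E k n = 0) (j m : ℕ) (hm : m/2^j = n) :
    rho E (k-j) m = 0 := by
  unfold rho at *
  have p2 : (2:ℝ)^(-k) ≠ 0 := by positivity
  have h0 := (mul_eq_zero.1 h).resolve_left p2
  have : volume.real (E ∩ dyadicI (k-j) m) ≤ volume.real (E ∩ dyadicI k n) := by
    refine measureReal_mono (inter_subset_inter_right _ ?_) (vol_inter_ne_top _)
    rw [← hm]; exact dyadicI_parent k j m
  have h2 : volume.real (E ∩ dyadicI (k-j) m) = 0 := le_antisymm (this.trans h0.le) measureReal_nonneg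
  rw [h2, mul_zero]

lemma Lam_zero3 {A1 A2 : ℤ → ℕ → ℕ → ℂ} {f3 : ℝ → ℂ} {E3 : Set ℝ} (h3 : Adm f3 E3) {M : ℕ} {P : Bitile}
    (h : rho E3 P.k P.n = 0) : Lam A1 A2 (amp f3) M P = 0 := by
  refine Lam_zero fun m hm => ?_
  have := h3.amp_le (P.k-(M+1:ℕ)) m (2*P.l)
  rw [rho_zero_desc h _ _ hm] at this
  rw [norm_le_zero_iff.1 this, mul_zero]

lemma num1 {v x b δ ε : ℝ} (hv : 0 < v) (hv2 : v ≤ 2) (hx : 0 < x) (hx1 : x ≤ 1) (hb : 0 ≤ b) (hbδ : b ≤ 3*δ)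
    (hδε : 3*δ ≤ ε) (hε : ε < 1/2) :
    (√v)^(2*b) * (v*√(8*x))^(1-2*b) ≤ 16 * v^(1-ε) * x^(1/2-3*δ) := by
  have e1 : (√v)^(2*b) = v^b := by
    rw [Real.sqrt_eq_rpow, ← Real.rpow_mul hv.le]; congr 1; ring
  have e2 : (v*√(8*x))^(1-2*b) = v^(1-2*b) * ((8:ℝ)^(1/2-b) * x^(1/2-b)) := by
    rw [Real.mul_rpow hv.le (Real.sqrt_nonneg _), Real.sqrt_eq_rpow, ← Real.rpow_mul (by positivity),
      ← Real.mul_rpow (by norm_num) hx.le]; congr 2; ring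
  have e3 : v^b * v^(1-2*b) = v^(1-ε) * v^(ε-b) := by
    rw [← Real.rpow_add hv, ← Real.rpow_add hv]; congr 1; ring
  have a1 : v^(ε-b) ≤ 2 := by
    calc v^(ε-b) ≤ 2^(ε-b) := Real.rpow_le_rpow hv.le hv2 (by linarith)
      _ ≤ 2^(1:ℝ) := Real.rpow_le_rpow_of_exponent_le (by norm_num) (by linarith)
      _ = 2 := Real.rpow_one 2
  have a2 : (8:ℝ)^(1/2-b) ≤ 8 := by
    calc (8:ℝ)^(1/2-b) ≤ 8^(1:ℝ) := Real.rpow_le_rpow_of_exponent_le (by norm_num) (by linarith)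
      _ = 8 := Real.rpow_one 8
  have a3 : x^(1/2-b) ≤ x^(1/2-3*δ) := Real.rpow_le_rpow_of_exponent_ge hx hx1 (by linarith)
  rw [e1, e2, ← mul_assoc, e3]
  calc v^(1-ε) * v^(ε-b) * ((8:ℝ)^(1/2-b) * x^(1/2-b)) ≤ v^(1-ε) * 2 * (8 * x^(1/2-3*δ)) := by gcongr
    _ = _ := by ring

lemma num2 {v y α δ : ℝ} (hv : 0 < v) (hy : 0 < y) (hα : 0 < α) (h : 0 ≤ 1/2-δ-α) :
    (√(min v y))^(1-2*δ) ≤ v^α * y^(1/2-δ-α) := by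
  have hm : 0 < min v y := lt_min hv hy
  have e1 : (√(min v y))^(1-2*δ) = (min v y)^α * (min v y)^(1/2-δ-α) := by
    rw [Real.sqrt_eq_rpow, ← Real.rpow_mul hm.le, ← Real.rpow_add hm]; congr 1; ring
  rw [e1]
  exact mul_le_mul (Real.rpow_le_rpow hm.le (min_le_left _ _) hα.le)
    (Real.rpow_le_rpow hm.le (min_le_right _ _) h) (by positivity) (by positivity)

end Work

section Work
open Classical

lemma num3 {α δ : ℝ} (hδ : δ ≤ α/4) (i : ℕ) :
    ((2:ℝ)^i)^(1/2-δ-α) * ((1/2:ℝ)^i)^(1/2-3*δ) ≤ ((2:ℝ)^(-(α/2)))^i := by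
  have e0 : (1/2:ℝ)^i = ((2:ℝ)^i)^(-1:ℝ) := by
    rw [Real.rpow_neg_one, one_div, inv_pow]
  have py : (0:ℝ) < 2^i := by positivity
  rw [e0, ← Real.rpow_mul py.le, ← Real.rpow_add py]
  have e1 : ((2:ℝ)^(-(α/2)))^i = ((2:ℝ)^i)^(-(α/2)) := by
    rw [← Real.rpow_natCast, ← Real.rpow_mul (by norm_num), ← Real.rpow_natCast, ← Real.rpow_mul (by norm_num), mul_comm]
  rw [e1]
  exact Real.rpow_le_rpow_of_exponent_le (one_le_pow₀ (by norm_num)) (by linarith)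

lemma num4 {K r1 c2 T1 T2 W X Y s1 : ℝ} (hK : 0 ≤ K) (hr1 : 0 ≤ r1) (hs1 : 0 ≤ s1) (hc2 : 0 ≤ c2)
    (h1 : r1 ≤ X) (hs : s1 ≤ 2) (hc : c2 ≤ 2)
    (h2 : T1 ≤ 16*W*Y) (h3 : T2 ≤ 16*W*Y) (hW : 0 ≤ W) (hY : 0 ≤ Y) :
    K * (r1*s1*c2*T1 + r1*s1*c2*T2) ≤ K*128*(W*(X*Y)) := by
  have hX : 0 ≤ X := hr1.trans h1
  have a : r1*s1*c2 ≤ X*2*2 := by gcongr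
  have b : T1 + T2 ≤ 32*W*Y := by linarith
  calc K * (r1*s1*c2*T1 + r1*s1*c2*T2) = K * (r1*s1*c2*(T1+T2)) := by ring
    _ ≤ K * (r1*s1*c2*(32*W*Y)) := by gcongr
    _ ≤ K * (X*2*2*(32*W*Y)) := by gcongr
    _ = _ := by ring

def KK (δ : ℝ) : ℝ := 1224 * (2/(1-(2:ℝ)^(-(2*δ))))

lemma KK_nonneg {δ : ℝ} (hδ : 0 < δ) : 0 ≤ KK δ := by
  have : (2:ℝ)^(-(2*δ)) ≤ 1 := Real.rpow_le_one_of_one_le_of_nonpos (by norm_num) (by linarith)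
  unfold KK
  have : 0 ≤ 1-(2:ℝ)^(-(2*δ)) := by linarith
  positivity

lemma up_ble {E : Set ℝ} {τ : ℝ} {P Q : Bitile} (h : Up E τ Q.k Q.n) (hb : ble P Q) : Up E τ P.k P.n := by
  obtain ⟨i, h1, h2⟩ := hb
  have := (up_downC E τ).desc h i P.n h2
  have e : P.k = Q.k - i := by rw [h1]; rfl
  rwa [e]

lemma class_bound {f1 f2 f3 : ℝ → ℂ} {E1 E2 E3 : Set ℝ} (h1 : Adm f1 E1) (h2 : Adm f2 E2) (h3 : Adm f3 E3)
    (p1 : 0 < volume.real E1) (p3 : 0 < volume.real E3) (u2 : volume.real E2 ≤ 2) (u3 : volume.real E3 ≤ 2)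
    (hz : ∀ x ∈ GG E3 (2*volume.real E3), f2 x = 0) (M : ℕ) {t : Finset Bitile} (ht : Conv t)
    {ε α δ : ℝ} (hε : ε < 1/2) (hα : 0 < α) (hδ : 0 < δ) (hδ8 : δ ≤ 1/8) (hδα : δ ≤ α/4) (hδε : δ ≤ ε/4)
    (hδα' : δ ≤ (1/2-α)/4) (i : ℕ) :
    ‖∑ P ∈ t.filter (fun P => ¬ Up E3 (2*volume.real E3*(1/2)^i) P.k P.n ∧
        Up E3 (2*volume.real E3*(1/2)^(i+1)) P.k P.n), Lam (amp f1) (amp f2) (amp f3) M P‖ ≤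
      KK δ * 128 * ((volume.real E1)^α * (volume.real E3)^(1-ε)) * ((2:ℝ)^(-(α/2)))^i := by
  set v1 := volume.real E1 with hv1
  set v3 := volume.real E3 with hv3
  set PP := t.filter (fun P => ¬ Up E3 (2*v3*(1/2)^i) P.k P.n ∧ Up E3 (2*v3*(1/2)^(i+1)) P.k P.n) with hPP
  set G := GG E3 (2*v3*(1/2)^(i+1)) with hG
  set g1 := G.indicator f1 with hg1
  have mG : MeasurableSet G := GG_meas _ _
  have hg : Adm g1 (E1 ∩ G) := by
    refine ⟨h1.fm.indicator mG, h1.em.inter mG, (measure_mono inter_subset_left).trans_lt h1.ev, fun x => ?_⟩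
    by_cases hx : x ∈ G
    · rw [hg1, indicator_of_mem hx]
      refine (h1.le x).trans ?_
      by_cases hx1 : x ∈ E1
      · rw [indicator_of_mem hx1, indicator_of_mem (show x ∈ E1 ∩ G from ⟨hx1, hx⟩)]
      · rw [indicator_of_notMem hx1]; exact indicator_nonneg (fun _ _ => zero_le_one) x
    · rw [hg1, indicator_of_notMem hx, norm_zero]; exact indicator_nonneg (fun _ _ => zero_le_one) x
  have mem : ∀ P ∈ PP, P ∈ t ∧ ¬ Up E3 (2*v3*(1/2)^i) P.k P.n ∧ Up E3 (2*v3*(1/2)^(i+1)) P.k P.n :=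
    fun P hP => Finset.mem_filter.1 hP
  have x1 : (1/2:ℝ)^i ≤ 1 := pow_le_one₀ (by norm_num) (by norm_num)
  have x0 : (0:ℝ) < (1/2:ℝ)^i := by positivity
  have hsum : ∑ P ∈ PP, Lam (amp f1) (amp f2) (amp f3) M P = ∑ P ∈ PP, Lam (amp g1) (amp f2) (amp f3) M P := by
    refine Finset.sum_congr rfl fun P hP => Lam_congr1 (amp_congr (fun x hx => ?_) _)
    rw [hg1, indicator_of_mem ((mem P hP).2.2.sub hx)]
  have hconv : Conv PP := by
    intro P Q R hP hR hPQ hQR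
    refine Finset.mem_filter.2 ⟨ht P Q R (mem P hP).1 (mem R hR).1 hPQ hQR, fun hu => ?_, ?_⟩
    · exact (mem P hP).2.1 (up_ble hu hPQ)
    · exact up_ble (mem R hR).2.2 hQR
  have e1 : volume.real (E1 ∩ G) ≤ min v1 (2^i) := by
    refine le_min (measureReal_mono inter_subset_left h1.ev.ne) ?_
    have hw := weak h3.em h3.ev (τ := 2*v3*(1/2)^(i+1)) (by positivity)
    have e : v3/(2*v3*(1/2)^(i+1)) = 2^i := by
      rw [pow_succ, one_div, inv_pow]; field_simp
    rw [← hv3, e] at hw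
    rw [measureReal_def]
    exact ENNReal.toReal_le_of_le_ofReal (by positivity) ((measure_mono inter_subset_right).trans hw)
  have pm : 0 < min v1 ((2:ℝ)^i) := lt_min p1 (by positivity)
  have hnb : ∀ P ∈ PP, ¬ Up E3 (2*v3) P.k P.n := by
    intro P hP hu
    exact (mem P hP).2.1 (hu.mono (by nlinarith))
  have hr : ∀ P ∈ PP, rho E3 P.k P.n ≤ 2*v3*(1/2)^i := by
    intro P hP
    by_contra hc
    exact (mem P hP).2.1 (Up.self (not_le.1 hc))
  rw [hsum]
  have sq2 : √2^2 = (2:ℝ) := Real.sq_sqrt (by norm_num)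
  have base := class_est (M := M) hg.isAmp h2.isAmp h3.isAmp (up_downC E3 (2*v3))
    (fun k n l hu => amp_zero (fun x hx => hz x (hu.sub hx)) l) hconv hnb
    (r1 := √(min v1 (2^i))) (r2 := √2) (r3 := √v3) (S1 := √2) (S2 := √2) (S3 := v3*√(8*(1/2)^i))
    (by positivity) (by positivity) (by positivity) (by positivity) (by positivity) (by positivity)
    (by rw [Real.sq_sqrt pm.le]; exact hg.bessel.mono e1)
    (by rw [sq2]; exact h2.bessel.mono u2)
    (by rw [Real.sq_sqrt p3.le]; exact h3.bessel)
    (size_init hg.isAmp downC_false (rho_nonneg _) (rho_split hg.em) hg.amp_le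
      (lam := 1) (fun k n _ => rho_le_one _ _ _) 0
      (fun P _ => by linarith [rho_le_one (E1 ∩ G) P.k P.n])
      (fun P _ => by rw [sq2]; linarith [rho_le_one (E1 ∩ G) P.k P.n]))
    (size_init h2.isAmp downC_false (rho_nonneg _) (rho_split h2.em) h2.amp_le
      (lam := 1) (fun k n _ => rho_le_one _ _ _) (M+1)
      (fun P _ => by linarith [rho_le_one E2 P.k P.n])
      (fun P _ => by rw [sq2]; linarith [rho_le_one E2 P.k P.n]))
    (size_init h3.isAmp (up_downC E3 (2*v3)) (rho_nonneg _) (rho_split h3.em) h3.amp_le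
      (lam := 2*v3) (fun k n hn => by by_contra hc; exact hn (Up.self (not_le.1 hc))) (M+1)
      (fun P hP => by have := hr P hP; nlinarith)
      (fun P hP => by
        have := hr P hP
        rw [mul_pow, Real.sq_sqrt (by positivity)]
        nlinarith))
    hδ hδ8
  refine base.trans ?_
  have s1 : √2^(2*δ) ≤ (2:ℝ) := by
    rw [Real.sqrt_eq_rpow, ← Real.rpow_mul (by norm_num)]
    calc (2:ℝ)^(1/2*(2*δ)) ≤ 2^(1:ℝ) := Real.rpow_le_rpow_of_exponent_le (by norm_num) (by linarith)
      _ = 2 := Real.rpow_one 2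
  have c2 : √2^(1-2*δ)*√2^(2*δ) ≤ (2:ℝ) := by
    rw [← Real.rpow_add (by positivity), sub_add_cancel, Real.rpow_one]
    nlinarith [Real.sqrt_nonneg 2]
  have t1 := num1 (v := v3) (x := (1/2)^i) (b := 3*δ) (δ := δ) (ε := ε) p3 u3 x0 x1 (by linarith) le_rfl (by linarith) hε
  have t2 := num1 (v := v3) (x := (1/2)^i) (b := δ) (δ := δ) (ε := ε) p3 u3 x0 x1 (by linarith) (by linarith) (by linarith) hε
  rw [show 2*(3*δ) = 6*δ by ring] at t1
  have q := num4 (K := KK δ) (r1 := √(min v1 (2^i))^(1-2*δ)) (s1 := √2^(2*δ)) (c2 := √2^(1-2*δ)*√2^(2*δ))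
    (KK_nonneg hδ) (by positivity) (by positivity) (by positivity)
    (num2 (α := α) (δ := δ) p1 (by positivity) hα (by linarith)) s1 c2 t1 t2 (by positivity) (by positivity)
  refine (le_of_eq ?_).trans (q.trans ?_)
  · unfold KK; rfl
  have n3 := num3 hδα i
  have hK := KK_nonneg hδ
  calc KK δ * 128 * (v3^(1-ε) * (v1^α * ((2:ℝ)^i)^(1/2-δ-α) * ((1/2:ℝ)^i)^(1/2-3*δ)))
      = KK δ * 128 * (v1^α * v3^(1-ε)) * (((2:ℝ)^i)^(1/2-δ-α) * ((1/2:ℝ)^i)^(1/2-3*δ)) := by ring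
    _ ≤ _ := by gcongr

lemma total_bound {f1 f2 f3 : ℝ → ℂ} {E1 E2 E3 : Set ℝ} (h1 : Adm f1 E1) (h2 : Adm f2 E2) (h3 : Adm f3 E3)
    (p1 : 0 < volume.real E1) (p3 : 0 < volume.real E3) (u2 : volume.real E2 ≤ 2) (u3 : volume.real E3 ≤ 2)
    (hz : ∀ x ∈ GG E3 (2*volume.real E3), f2 x = 0) (M : ℕ) {t : Finset Bitile} (ht : Conv t)
    {ε α δ : ℝ} (hε : ε < 1/2) (hα : 0 < α) (hδ : 0 < δ) (hδ8 : δ ≤ 1/8) (hδα : δ ≤ α/4) (hδε : δ ≤ ε/4)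
    (hδα' : δ ≤ (1/2-α)/4) :
    ‖∑ P ∈ t, Lam (amp f1) (amp f2) (amp f3) M P‖ ≤
      KK δ * 128 / (1-(2:ℝ)^(-(α/2))) * ((volume.real E1)^α * (volume.real E3)^(1-ε)) := by
  set v1 := volume.real E1 with hv1
  set v3 := volume.real E3 with hv3
  set F := Lam (amp f1) (amp f2) (amp f3) M with hF
  set a : ℕ → ℂ := fun i => ∑ P ∈ t.filter (fun P => Up E3 (2*v3*(1/2)^i) P.k P.n), F P with ha
  have a0 : a 0 = 0 := by
    refine Finset.sum_eq_zero fun P hP => ?_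
    have hu := (Finset.mem_filter.1 hP).2
    rw [pow_zero, mul_one] at hu
    refine Lam_zero fun m hm => ?_
    have := (up_downC E3 (2*v3)).desc hu (M+1) m hm
    rw [amp_zero (fun x hx => hz x (this.sub hx)), zero_mul]
  have hstep : ∀ i, a (i+1) - a i = ∑ P ∈ t.filter (fun P => ¬ Up E3 (2*v3*(1/2)^i) P.k P.n ∧
        Up E3 (2*v3*(1/2)^(i+1)) P.k P.n), F P := by
    intro i
    simp only [ha, Finset.sum_filter]
    rw [← Finset.sum_sub_distrib]
    refine Finset.sum_congr rfl fun P _ => ?_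
    have hm : Up E3 (2*v3*(1/2)^i) P.k P.n → Up E3 (2*v3*(1/2)^(i+1)) P.k P.n := fun h => h.mono (by
      rw [pow_succ]
      have : 0 < 2*v3*(1/2)^i := by positivity
      linarith)
    by_cases c1 : Up E3 (2*v3*(1/2)^i) P.k P.n
    · simp only [c1, hm c1, if_true, not_true, false_and, if_false, sub_self]
    · by_cases c2 : Up E3 (2*v3*(1/2)^(i+1)) P.k P.n <;> simp only [c1, c2, if_true, not_false_eq_true, true_and, and_false, if_false, sub_zero]
  have hlast : ∃ I, a I = ∑ P ∈ t, F P := by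
    have ev : ∀ᶠ I : ℕ in Filter.atTop, ∀ P ∈ t, F P ≠ 0 → Up E3 (2*v3*(1/2)^I) P.k P.n := by
      refine (Filter.eventually_all_finset t).2 fun P _ => ?_
      by_cases hP : F P = 0
      · exact Filter.Eventually.of_forall fun _ h => (h hP).elim
      have hr : rho E3 P.k P.n ≠ 0 := fun h => hP (Lam_zero3 h3 h)
      have hr' : 0 < rho E3 P.k P.n := lt_of_le_of_ne (rho_nonneg _ _ _) hr.symm
      have tt : Filter.Tendsto (fun I : ℕ => 2*v3*(1/2:ℝ)^I) Filter.atTop (nhds (2*v3*0)) :=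
        (_root_.tendsto_pow_atTop_nhds_zero_of_lt_one (by norm_num) (by norm_num)).const_mul _
      rw [mul_zero] at tt
      filter_upwards [tt.eventually_lt_const hr'] with I hI _
      exact Up.self hI
    obtain ⟨I, hI⟩ := ev.exists
    refine ⟨I, ?_⟩
    simp only [ha, Finset.sum_filter]
    refine Finset.sum_congr rfl fun P hP => ?_
    by_cases c : F P = 0
    · simp [c]
    · rw [if_pos (hI P hP c)]
  obtain ⟨I, hI⟩ := hlast
  have q0 : (0:ℝ) ≤ (2:ℝ)^(-(α/2)) := by positivity
  have q1 : (2:ℝ)^(-(α/2)) < 1 := Real.rpow_lt_one_of_one_lt_of_neg (by norm_num) (by linarith)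
  have hK := KK_nonneg hδ
  rw [← hI, ← sub_zero (a I), ← a0, ← Finset.sum_range_sub]
  calc ‖∑ i ∈ Finset.range I, (a (i+1) - a i)‖ ≤ ∑ i ∈ Finset.range I, ‖a (i+1) - a i‖ := norm_sum_le _ _
    _ ≤ ∑ i ∈ Finset.range I, KK δ * 128 * (v1^α * v3^(1-ε)) * ((2:ℝ)^(-(α/2)))^i := by
        refine Finset.sum_le_sum fun i _ => ?_
        rw [hstep]
        exact class_bound h1 h2 h3 p1 p3 u2 u3 hz M ht hε hα hδ hδ8 hδα hδε hδα' i
    _ = KK δ * 128 * (v1^α * v3^(1-ε)) * ∑ i ∈ Finset.range I, ((2:ℝ)^(-(α/2)))^i := by rw [Finset.mul_sum]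
    _ ≤ KK δ * 128 * (v1^α * v3^(1-ε)) * (1-(2:ℝ)^(-(α/2)))⁻¹ := by
        refine mul_le_mul_of_nonneg_left ?_ (by positivity)
        rw [← tsum_geometric_of_lt_one q0 q1]
        exact (summable_geometric_of_lt_one q0 q1).sum_le_tsum _ (fun i _ => by positivity)
    _ = _ := by rw [div_eq_mul_inv]; ring

lemma lam_zero1 {A2 A3 : ℤ → ℕ → ℕ → ℂ} {f1 : ℝ → ℂ} {E1 : Set ℝ} (h1 : Adm f1 E1) (h : volume.real E1 = 0)
    (M : ℕ) (P : Bitile) : Lam (amp f1) A2 A3 M P = 0 := by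
  have h0 : ‖amp f1 P.k P.n (2*P.l+1)‖ ≤ 0 := by
    refine (h1.amp_le _ _ _).trans ?_
    unfold rho
    have : volume.real (E1 ∩ dyadicI P.k P.n) ≤ 0 := by
      rw [← h]; exact measureReal_mono inter_subset_left h1.ev.ne
    exact mul_nonpos_of_nonneg_of_nonpos (by positivity) this
  unfold Lam
  rw [norm_le_zero_iff.1 h0, zero_mul]

lemma rho_null {E : Set ℝ} (ev : volume E < ∞) (h : volume.real E = 0) (k : ℤ) (n : ℕ) : rho E k n = 0 := by
  unfold rho
  have : volume.real (E ∩ dyadicI k n) ≤ 0 := by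
    rw [← h]; exact measureReal_mono inter_subset_left ev.ne
  rw [le_antisymm this measureReal_nonneg, mul_zero]

theorem final (ε α : ℝ) (hε0 : 0 < ε) (hε : ε < 1/2) (hα0 : 0 < α) (hα : α < 1/2) :
    ∃ C : ℝ≥0, ∀ E1 E2 E3 : Set ℝ,
      MeasurableSet E1 → MeasurableSet E2 → MeasurableSet E3 →
      volume E1 < ∞ → volume E2 < ∞ → volume E3 < ∞ →
      volume E3 < volume E2 → 1 ≤ volume E2 → volume E2 ≤ 2 →
      ∃ E2' : Set ℝ, MeasurableSet E2' ∧ E2' ⊆ E2 ∧ volume E2 / 2 ≤ volume E2' ∧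
        ∀ (L N : ℕ), 2 ≤ L →
        ∀ f1 f2 f3 : ℝ → ℂ, Measurable f1 → Measurable f2 → Measurable f3 →
          (∀ x, ‖f1 x‖ ≤ E1.indicator 1 x) →
          (∀ x, ‖f2 x‖ ≤ E2.indicator 1 x) → (∀ x, x ∉ E2' → f2 x = 0) →
          (∀ x, ‖f3 x‖ ≤ E3.indicator 1 x) →
          (‖quartileForm L N f1 f2 f3‖₊ : ℝ≥0∞) ≤
            C * volume E1 ^ α * volume E3 ^ (1 - ε) := by
  set δ := min (min (α/4) (ε/4)) ((1/2-α)/4) with hδ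
  have d1 : δ ≤ α/4 := (min_le_left _ _).trans (min_le_left _ _)
  have d2 : δ ≤ ε/4 := (min_le_left _ _).trans (min_le_right _ _)
  have d3 : δ ≤ (1/2-α)/4 := min_le_right _ _
  have d0 : 0 < δ := lt_min (lt_min (by linarith) (by linarith)) (by linarith)
  have q1 : (2:ℝ)^(-(α/2)) < 1 := Real.rpow_lt_one_of_one_lt_of_neg (by norm_num) (by linarith)
  have hC : 0 ≤ KK δ * 128 / (1-(2:ℝ)^(-(α/2))) := by
    have := KK_nonneg d0
    have : 0 < 1-(2:ℝ)^(-(α/2)) := by linarith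
    positivity
  refine ⟨NNReal.mk _ hC, fun E1 E2 E3 m1 m2 m3 w1 w2 w3 h32 hE2 hE2' => ?_⟩
  have u2 : volume.real E2 ≤ 2 := by
    rw [measureReal_def]; exact ENNReal.toReal_le_of_le_ofReal (by norm_num) (by simpa using hE2')
  have u3 : volume.real E3 ≤ 2 := by
    refine le_trans ?_ u2
    exact (ENNReal.toReal_le_toReal w3.ne w2.ne).2 h32.le
  have zero : volume.real E1 = 0 ∨ volume.real E3 = 0 → ∀ (L N : ℕ), 2 ≤ L →
        ∀ f1 f2 f3 : ℝ → ℂ, Adm f1 E1 → Adm f2 E2 → Adm f3 E3 → quartileForm L N f1 f2 f3 = 0 := by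
    intro h L N hL f1 f2 f3 h1 h2 h3
    obtain ⟨M, rfl⟩ : ∃ M, L = M+1 := ⟨L-1, by omega⟩
    refine norm_le_zero_iff.1 (form_bound h1 h2 h3 M N fun t _ => ?_)
    rw [Finset.sum_eq_zero, norm_zero]
    intro P _
    rcases h with h | h
    · exact lam_zero1 h1 h M P
    · exact Lam_zero3 h3 (rho_null w3 h _ _)
  by_cases z3 : volume.real E3 = 0
  · refine ⟨E2, m2, Subset.rfl, ENNReal.half_le_self, ?_⟩
    intro L N hL f1 f2 f3 mf1 mf2 mf3 b1 b2 _ b3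
    rw [zero (Or.inr z3) L N hL f1 f2 f3 ⟨mf1, m1, w1, b1⟩ ⟨mf2, m2, w2, b2⟩ ⟨mf3, m3, w3, b3⟩]
    simp
  have p3 : 0 < volume.real E3 := lt_of_le_of_ne measureReal_nonneg (Ne.symm z3)
  set G := GG E3 (2*volume.real E3) with hG
  have mG : MeasurableSet G := GG_meas _ _
  have vG : volume G ≤ volume E2 / 2 := by
    have hw := weak m3 w3 (τ := 2*volume.real E3) (by positivity)
    refine hw.trans ?_
    rw [show volume.real E3/(2*volume.real E3) = 1/2 by field_simp, ENNReal.ofReal_div_of_pos (by norm_num)]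
    simp only [ofReal_one, ofReal_ofNat]
    gcongr
  refine ⟨E2 \ G, m2.diff mG, diff_subset, ?_, ?_⟩
  · have : volume E2 - volume G ≤ volume (E2 \ G) := le_measure_diff
    refine le_trans ?_ this
    refine le_trans ?_ (tsub_le_tsub_left vG _)
    rw [ENNReal.sub_half w2.ne]
  · intro L N hL f1 f2 f3 mf1 mf2 mf3 b1 b2 hz b3
    have h1 : Adm f1 E1 := ⟨mf1, m1, w1, b1⟩
    have h2 : Adm f2 E2 := ⟨mf2, m2, w2, b2⟩
    have h3 : Adm f3 E3 := ⟨mf3, m3, w3, b3⟩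
    by_cases z1 : volume.real E1 = 0
    · rw [zero (Or.inl z1) L N hL f1 f2 f3 h1 h2 h3]; simp
    have p1 : 0 < volume.real E1 := lt_of_le_of_ne measureReal_nonneg (Ne.symm z1)
    obtain ⟨M, rfl⟩ : ∃ M, L = M+1 := ⟨L-1, by omega⟩
    have B := form_bound h1 h2 h3 M N (fun t ht => total_bound h1 h2 h3 p1 p3 u2 u3
      (fun x hx => hz x (fun h => h.2 hx)) M ht hε hα0 d0 (by linarith) d1 d2 d3)
    have e1 : volume E1 ^ α = ENNReal.ofReal (volume.real E1 ^ α) := by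
      rw [← ENNReal.ofReal_rpow_of_pos p1, measureReal_def, ENNReal.ofReal_toReal w1.ne]
    have e3 : volume E3 ^ (1-ε) = ENNReal.ofReal (volume.real E3 ^ (1-ε)) := by
      rw [← ENNReal.ofReal_rpow_of_pos p3, measureReal_def, ENNReal.ofReal_toReal w3.ne]
    rw [e1, e3, mul_assoc, ← ENNReal.ofReal_mul (by positivity)]
    have e4 : ((NNReal.mk _ hC : ℝ≥0) : ℝ≥0∞) = ENNReal.ofReal (KK δ * 128 / (1-(2:ℝ)^(-(α/2)))) := by
      rw [ENNReal.ofReal_eq_coe_nnreal hC]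
    rw [e4, ← ENNReal.ofReal_mul hC]
    rw [← enorm_eq_nnnorm, ← ofReal_norm]
    exact ENNReal.ofReal_le_ofReal B

end Work

/-- Proposition (Diamond `b₃ ∪ d₂₃`). -/
theorem diamond_b3_d23 :
    ∀ ε α : ℝ, 0 < ε → ε < 1/2 → 0 < α → α < 1/2 →
    ∃ C : ℝ≥0, ∀ E1 E2 E3 : Set ℝ,
      MeasurableSet E1 → MeasurableSet E2 → MeasurableSet E3 →
      E1 ⊆ Ici 0 → E2 ⊆ Ici 0 → E3 ⊆ Ici 0 →
      volume E1 < ∞ → volume E2 < ∞ → volume E3 < ∞ →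
      volume E3 < volume E2 → 1 ≤ volume E2 → volume E2 ≤ 2 →
      ∃ E2' : Set ℝ, MeasurableSet E2' ∧ E2' ⊆ E2 ∧ volume E2 / 2 ≤ volume E2' ∧
        ∀ (L N : ℕ), 2 ≤ L →
        ∀ f1 f2 f3 : ℝ → ℂ, Measurable f1 → Measurable f2 → Measurable f3 →
          (∀ x, ‖f1 x‖ ≤ E1.indicator 1 x) →
          (∀ x, ‖f2 x‖ ≤ E2.indicator 1 x) → (∀ x, x ∉ E2' → f2 x = 0) →
          (∀ x, ‖f3 x‖ ≤ E3.indicator 1 x) →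
          (‖quartileForm L N f1 f2 f3‖₊ : ℝ≥0∞) ≤
            C * volume E1 ^ α * volume E3 ^ (1 - ε) := by
  intro ε α hε0 hε hα0 hα
  obtain ⟨C, hC⟩ := final ε α hε0 hε hα0 hα
  refine ⟨C, fun E1 E2 E3 m1 m2 m3 _ _ _ w1 w2 w3 h32 h21 h22 => ?_⟩
  exact hC E1 E2 E3 m1 m2 m3 w1 w2 w3 h32 h21 h22

end Quartile
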